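/- Fix an integer k ≥ 2 and ε > 0. There is a constant C_ε such that for all Q ≥ 1 and X ≥ 2, |EG_k(Q;X)| ≤ C_ε · X^{1+ε} (X/Q)^{k/2}. -/

import Mathlib

open MeasureTheory Complex
open scoped Classical

/-- `d_k(n)`: number of ordered k-tuples of positive integers with product n. -/
noncomputable def dk (k n : ℕ) : ℕ :=
  Nat.card {f : Fin k → ℕ // (∀ i, 0 < f i) ∧ ∏ i, f i = n}

/-- The off-diagonal error term `EG_k(Q;X)`, a sum over non-principal Dirichlet
characters. -/
noncomputable def EGk (k : ℕ) (Φ Ψ : ℝ → ℝ) (Q X : ℝ) : ℂ :=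
  ∑' m : ℕ, ∑' n : ℕ, ∑' a : ℕ, ∑' r : ℕ,
    if 1 ≤ m ∧ 1 ≤ n ∧ 1 ≤ r ∧ a ∣ Nat.gcd m n then
      (((dk k m : ℝ) * (dk k n : ℝ) * Ψ ((m : ℝ) / X) * Ψ ((n : ℝ) / X) *
          (((ArithmeticFunction.moebius a : ℤ) : ℝ) / (Nat.totient (a * r) : ℝ)) *
          Φ (|((m / Nat.gcd m n : ℕ) : ℝ) - ((n / Nat.gcd m n : ℕ) : ℝ)| /
              ((r : ℝ) * Q)) : ℝ) : ℂ) *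
        ∑' χ : DirichletCharacter ℂ (a * r),
          (if χ ≠ 1 then
            χ (((m / Nat.gcd m n : ℕ) : ZMod (a * r))) *
              (starRingEnd ℂ) (χ (((n / Nat.gcd m n : ℕ) : ZMod (a * r))))
          else 0)
    else 0

namespace EGB

section

/-- Gaussian partition-of-unity weight in the logarithmic variable. -/
noncomputable def W (u : ℝ) : ℝ := Real.exp (-u ^ 2 / 4) / (2 * √Real.pi)

lemma W_pos (u : ℝ) : 0 < W u := by unfold W; positivity

lemma continuous_W : Continuous W := by unfold W; fun_prop

lemma W_le (a u : ℝ) : W u ≤ Real.exp (a ^ 2 - a * u) := by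
  unfold W
  have h1 : 1 ≤ 2 * √Real.pi := by
    have : 1 ≤ √Real.pi := by
      rw [Real.one_le_sqrt]; linarith [Real.pi_gt_three]
    linarith
  calc _ ≤ Real.exp (-u ^ 2 / 4) := div_le_self (Real.exp_pos _).le h1
    _ ≤ _ := by
      apply Real.exp_le_exp.2
      nlinarith [sq_nonneg (u / 2 - a)]

lemma W_eq_gauss (u : ℝ) : W u = (2 * √Real.pi)⁻¹ * Real.exp (-(1/4) * u ^ 2) := by
  unfold W; rw [div_eq_inv_mul]; congr 2; ring

lemma integrable_W : Integrable W := by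
  rw [show W = _ from funext W_eq_gauss]
  exact (integrable_exp_neg_mul_sq (by norm_num)).const_mul _

lemma integral_W : ∫ u, W u = 1 := by
  rw [show W = _ from funext W_eq_gauss, integral_const_mul, integral_gaussian]
  rw [show Real.pi / (1/4) = 2^2 * Real.pi by ring, Real.sqrt_mul (by norm_num),
    Real.sqrt_sq (by norm_num)]
  have : 0 < √Real.pi := Real.sqrt_pos.2 Real.pi_pos
  field_simp

lemma W_repr (c u : ℝ) :
    (W u : ℂ) = (1 / (2 * Real.pi)) * ∫ v : ℝ, cexp ((c + v * I) ^ 2 - (c + v * I) * u) := by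
  have h : ∀ v : ℝ, ((c : ℂ) + v * I) ^ 2 - (c + v * I) * u
      = (-1) * (v:ℂ) ^ 2 + (I * (2 * c - u)) * v + (c ^ 2 - c * u) := by
    intro v; ring_nf; rw [I_sq]; ring
  simp_rw [h]
  rw [integral_cexp_quadratic (by norm_num)]
  unfold W
  have e1 : ((Real.pi : ℂ) / - -1) ^ (1 / 2 : ℂ) = ((√Real.pi : ℝ) : ℂ) := by
    rw [neg_neg, div_one, Real.sqrt_eq_rpow, Complex.ofReal_cpow Real.pi_pos.le]; norm_num
  rw [e1]
  have e2 : ((c : ℂ) ^ 2 - c * u - (I * (2 * c - u)) ^ 2 / (4 * -1)) = ((-u ^ 2 / 4 : ℝ) : ℂ) := by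
    push_cast; ring_nf; rw [I_sq]; ring
  rw [e2, ← Complex.ofReal_exp]
  have hp : (Real.pi : ℝ) = √Real.pi * √Real.pi := (Real.mul_self_sqrt Real.pi_pos.le).symm
  have h0 : √Real.pi ≠ 0 := (Real.sqrt_pos.2 Real.pi_pos).ne'
  norm_cast
  rw [show (1 / (2 * Real.pi) * (√Real.pi * Real.exp (-u ^ 2 / 4)))
    = Real.exp (-u ^ 2 / 4) * (√Real.pi / (2 * (√Real.pi * √Real.pi))) by rw [← hp]; ring]
  field_simp

/-- The unitarily normalised character `x ^ (-1/2 + 2 π i τ)` of the positive reals. -/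
noncomputable def ker (x τ : ℝ) : ℂ := cexp ((-(1 / 2) + 2 * Real.pi * τ * I) * Real.log x)

lemma ker_mul {x y : ℝ} (hx : 0 < x) (hy : 0 < y) (τ : ℝ) :
    ker (x * y) τ = ker x τ * ker y τ := by
  unfold ker; rw [Real.log_mul hx.ne' hy.ne', ← Complex.exp_add]; push_cast; ring_nf

lemma norm_ker (x τ : ℝ) : ‖ker x τ‖ = Real.exp (-(Real.log x) / 2) := by
  unfold ker; rw [Complex.norm_exp]; congr 1; simp; ring

lemma norm_ker_eq {x : ℝ} (hx : 0 < x) (τ : ℝ) : ‖ker x τ‖ = x ^ (-(1 / 2) : ℝ) := by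
  rw [norm_ker, Real.rpow_def_of_pos hx]; ring_nf

lemma continuous_ker (x : ℝ) : Continuous (ker x) := by unfold ker; fun_prop

lemma normSq_gamma_half (u : ℝ) :
    ‖Gamma (1 / 2 + u * I)‖ ^ 2 = Real.pi / Real.cosh (Real.pi * u) := by
  have h := Complex.Gamma_mul_Gamma_one_sub (1 / 2 + u * I)
  have hc : (1 : ℂ) - (1 / 2 + u * I) = (starRingEnd ℂ) (1 / 2 + u * I) := by
    simp [Complex.ext_iff]; norm_num
  rw [hc, Complex.Gamma_conj, Complex.mul_conj] at h
  have hs : Complex.sin (Real.pi * (1 / 2 + u * I)) = ((Real.cosh (Real.pi * u) : ℝ) : ℂ) := by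
    rw [show (Real.pi : ℂ) * (1 / 2 + u * I) = (Real.pi * u) * I + Real.pi / 2 by ring,
      Complex.sin_add_pi_div_two, Complex.cos_mul_I]
    push_cast; rfl
  rw [hs] at h
  rw [← Complex.normSq_eq_norm_sq]
  exact_mod_cast h

lemma two_cosh_ge (x : ℝ) : Real.exp |x| ≤ 2 * Real.cosh x := by
  rw [Real.cosh_eq]
  rcases abs_cases x with ⟨h, _⟩ | ⟨h, _⟩ <;> rw [h] <;>
    linarith [Real.exp_pos x, Real.exp_pos (-x)]

lemma twoPiI_ne {ξ : ℝ} (hξ : ξ ≠ 0) : (2 * Real.pi * ξ * I : ℂ) ≠ 0 := by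
  simp [hξ, Real.pi_ne_zero]

lemma norm_cpow_imag {ξ : ℝ} (hξ : ξ ≠ 0) (a u : ℝ) :
    ‖(2 * Real.pi * ξ * I : ℂ) ^ (-(a + u * I))‖
      ≤ (2 * Real.pi * |ξ|) ^ (-a) * Real.exp (Real.pi / 2 * |u|) := by
  rw [Complex.norm_cpow_of_ne_zero (twoPiI_ne hξ)]
  have h1 : ‖(2 * Real.pi * ξ * I : ℂ)‖ = 2 * Real.pi * |ξ| := by
    simp [abs_of_pos Real.pi_pos]
  rw [h1, div_eq_mul_inv, ← Real.exp_neg]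
  have h2 : (-((a:ℂ) + u * I)).re = -a := by simp
  have h3 : (-((a:ℂ) + u * I)).im = -u := by simp
  rw [h2, h3]
  gcongr
  have harg : |Complex.arg (2 * Real.pi * ξ * I)| ≤ Real.pi / 2 := by
    rw [Complex.abs_arg_le_pi_div_two_iff]; simp
  calc -(Complex.arg (2 * Real.pi * ξ * I) * -u) ≤ |Complex.arg (2 * Real.pi * ξ * I) * u| := by
        rw [mul_neg, neg_neg]; exact le_abs_self _
    _ ≤ _ := by rw [abs_mul]; gcongr

lemma gamma_half_bound {ξ : ℝ} (hξ : ξ ≠ 0) (u : ℝ) :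
    ‖Gamma (1 / 2 + u * I) * (2 * Real.pi * ξ * I : ℂ) ^ (-(1 / 2 + u * I))‖
      ≤ |ξ| ^ (-(1 / 2) : ℝ) := by
  have hx : 0 < |ξ| := abs_pos.2 hξ
  have h1 := norm_cpow_imag hξ (1 / 2) u
  push_cast at h1
  rw [norm_mul]
  have hG := normSq_gamma_half u
  refine (mul_le_mul_of_nonneg_left h1 (norm_nonneg _)).trans ?_
  rw [← abs_of_nonneg (by positivity : 0 ≤ |ξ| ^ (-(1 / 2) : ℝ))]
  apply le_trans (le_abs_self _)
  apply sq_le_sq.1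
  rw [mul_pow, mul_pow, hG, ← Real.rpow_mul_natCast (by positivity),
    ← Real.rpow_mul_natCast (by positivity), ← Real.exp_nat_mul]
  norm_num
  rw [Real.rpow_neg_one, Real.rpow_neg_one]
  have h2 := two_cosh_ge (Real.pi * u)
  rw [abs_mul, abs_of_pos Real.pi_pos] at h2
  have h3 : Real.exp (2 * (Real.pi / 2 * |u|)) = Real.exp (Real.pi * |u|) := by ring_nf
  rw [h3]
  have hpi := Real.pi_pos
  have hcp := Real.cosh_pos (Real.pi * u)
  rw [div_mul_eq_mul_div, div_le_iff₀ hcp, mul_inv]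
  have : Real.pi * ((2 * Real.pi)⁻¹ * |ξ|⁻¹ * Real.exp (Real.pi * |u|))
    = |ξ|⁻¹ * (Real.exp (Real.pi * |u|) / 2) := by field_simp
  rw [this]; gcongr; linarith

lemma gamma_three_halves_bound {ξ : ℝ} (hξ : ξ ≠ 0) (u : ℝ) :
    ‖Gamma (3 / 2 + u * I) * (2 * Real.pi * ξ * I : ℂ) ^ (-(3 / 2 + u * I))‖
      ≤ (1 + |u|) * |ξ| ^ (-(3 / 2) : ℝ) := by
  have hx : 0 < |ξ| := abs_pos.2 hξ
  have hne : (1 / 2 + u * I : ℂ) ≠ 0 := by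
    intro h; have := congrArg Complex.re h; simp at this
  rw [show (3 / 2 + u * I : ℂ) = (1 / 2 + u * I) + 1 by ring, Complex.Gamma_add_one _ hne,
    neg_add, Complex.cpow_add _ _ (twoPiI_ne hξ), Complex.cpow_neg_one]
  have h := gamma_half_bound hξ u
  rw [show ((1 / 2 + u * I : ℂ)) * Gamma (1 / 2 + u * I) *
    ((2 * Real.pi * ξ * I : ℂ) ^ (-(1 / 2 + u * I)) * (2 * Real.pi * ξ * I : ℂ)⁻¹)
    = (Gamma (1 / 2 + u * I) * (2 * Real.pi * ξ * I : ℂ) ^ (-(1 / 2 + u * I))) *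
      ((1 / 2 + u * I) * (2 * Real.pi * ξ * I : ℂ)⁻¹) by ring, norm_mul (Gamma _ * _),
    norm_mul (1 / 2 + u * I : ℂ), norm_inv]
  have h1 : ‖(2 * Real.pi * ξ * I : ℂ)‖ = 2 * Real.pi * |ξ| := by
    simp [abs_of_pos Real.pi_pos]
  rw [h1]
  have h2 : ‖(1 / 2 + u * I : ℂ)‖ ≤ 1 + |u| := by
    refine (norm_add_le _ _).trans ?_
    simp; norm_num
  have h4 : (2 * Real.pi * |ξ|)⁻¹ ≤ |ξ|⁻¹ := by
    apply inv_anti₀ hx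
    nlinarith [Real.pi_gt_three]
  calc _ ≤ |ξ| ^ (-(1 / 2) : ℝ) * ((1 + |u|) * |ξ|⁻¹) := by gcongr
    _ = (1 + |u|) * (|ξ| ^ (-(1 / 2) : ℝ) * |ξ| ^ (-1 : ℝ)) := by
      rw [Real.rpow_neg_one]; ring
    _ = _ := by rw [← Real.rpow_add hx]; norm_num

end

section
open Set Filter Topology

lemma integrableOn_rpow_exp {a b : ℝ} (ha : 0 < a) (hb : 0 < b) :
    IntegrableOn (fun t : ℝ => t ^ (a - 1) * Real.exp (-(b * t))) (Ioi 0) := by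
  have := integrableOn_rpow_mul_exp_neg_mul_rpow (p := 1) (s := a - 1) (b := b) (by linarith)
    one_pos hb
  simpa [neg_mul] using this

lemma norm_cpow_exp {t : ℝ} (ht : 0 < t) (a r : ℂ) :
    ‖(t : ℂ) ^ (a - 1) * cexp (-(r * t))‖ = t ^ (a.re - 1) * Real.exp (-(r.re * t)) := by
  rw [norm_mul, Complex.norm_cpow_eq_rpow_re_of_pos ht, Complex.norm_exp]; simp

lemma measurable_cpow_exp (a r : ℂ) :
    AEStronglyMeasurable (fun t : ℝ => (t : ℂ) ^ (a - 1) * cexp (-(r * t)))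
      (volume.restrict (Ioi 0)) := by
  apply ContinuousOn.aestronglyMeasurable _ measurableSet_Ioi
  intro t ht
  have : ContinuousAt (fun t : ℝ => (t : ℂ) ^ (a - 1)) t :=
    continuousAt_ofReal_cpow_const _ _ (Or.inr (ne_of_gt ht))
  exact (this.mul (by fun_prop)).continuousWithinAt

lemma integrable_cpow_exp {a r : ℂ} (ha : 0 < a.re) (hr : 0 < r.re) :
    IntegrableOn (fun t : ℝ => (t : ℂ) ^ (a - 1) * cexp (-(r * t))) (Ioi 0) := by
  refine (integrableOn_rpow_exp ha hr).mono' (measurable_cpow_exp a r) ?_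
  refine (ae_restrict_iff' measurableSet_Ioi).2 (Eventually.of_forall fun t ht => ?_)
  rw [norm_cpow_exp ht]

lemma laplace_cpow {a : ℂ} (ha : 0 < a.re) {r : ℂ} (hr : 0 < r.re) :
    ∫ t : ℝ in Ioi 0, (t : ℂ) ^ (a - 1) * cexp (-(r * t)) = r ^ (-a) * Gamma a := by
  set U : Set ℂ := {z | 0 < z.re} with hU
  have hUo : IsOpen U := isOpen_lt continuous_const Complex.continuous_re
  have hF : DifferentiableOn ℂ (fun r : ℂ => ∫ t : ℝ in Ioi 0, (t : ℂ) ^ (a - 1) * cexp (-(r * t)))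
      U := by
    intro r₀ hr₀
    have hδ : 0 < r₀.re / 2 := half_pos hr₀
    have := (hasDerivAt_integral_of_dominated_loc_of_deriv_le (𝕜 := ℂ)
      (μ := volume.restrict (Ioi (0:ℝ)))
      (F := fun (r : ℂ) (t : ℝ) => (t : ℂ) ^ (a - 1) * cexp (-(r * t)))
      (F' := fun (r : ℂ) (t : ℝ) => (t : ℂ) ^ (a - 1) * (cexp (-(r * t)) * (-t)))
      (x₀ := r₀) (s := Metric.ball r₀ (r₀.re / 2))
      (bound := fun t => t ^ (a.re + 1 - 1) * Real.exp (-(r₀.re / 2 * t)))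
      (Metric.ball_mem_nhds _ hδ)
      (Eventually.of_forall fun r => measurable_cpow_exp a r)
      (integrable_cpow_exp ha hr₀) ?_ ?_ (integrableOn_rpow_exp (by linarith) hδ) ?_).2
    · exact this.differentiableAt.differentiableWithinAt
    · have h := (measurable_cpow_exp a r₀).mul
        (Complex.continuous_ofReal.neg.aestronglyMeasurable)
      refine h.congr (Eventually.of_forall fun t => ?_)
      simp only [Pi.mul_apply, Pi.neg_apply]; ring
    · refine (ae_restrict_iff' measurableSet_Ioi).2 (Eventually.of_forall fun t ht r hrb => ?_)
      have ht : 0 < t := ht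
      rw [← mul_assoc, norm_mul, norm_cpow_exp ht, norm_neg, Complex.norm_real, Real.norm_eq_abs,
        abs_of_pos ht]
      have h1 : r₀.re / 2 ≤ r.re := by
        have h2 : |(r - r₀).re| < r₀.re / 2 :=
          (Complex.abs_re_le_norm _).trans_lt (by simpa [dist_eq_norm] using hrb)
        rw [Complex.sub_re] at h2
        linarith [(abs_lt.1 h2).1]
      rw [show t ^ (a.re - 1) * Real.exp (-(r.re * t)) * t
        = (t ^ (a.re - 1) * t) * Real.exp (-(r.re * t)) by ring, ← Real.rpow_add_one ht.ne',
        show a.re - 1 + 1 = a.re + 1 - 1 by ring]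
      gcongr
    · refine Eventually.of_forall fun t r _ => ?_
      apply HasDerivAt.const_mul
      apply HasDerivAt.cexp
      have := ((hasDerivAt_id r).mul_const (-(t:ℂ)))
      simp only [id, one_mul, mul_neg] at this
      exact this
  have hG : DifferentiableOn ℂ (fun r : ℂ => r ^ (-a) * Gamma a) U := by
    intro r₀ hr₀
    apply DifferentiableAt.differentiableWithinAt
    apply DifferentiableAt.mul_const
    exact (differentiableAt_id.cpow_const (Or.inl hr₀))
  have hc : IsPreconnected U := (convex_halfSpace_re_gt 0).isPreconnected
  have key := (hF.analyticOnNhd hUo).eqOn_of_preconnected_of_frequently_eq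
    (hG.analyticOnNhd hUo) hc (z₀ := 1) (by simp [hU]) ?_
  · exact key hr
  · have hreal : ∀ x : ℝ, 0 < x → ∫ t : ℝ in Ioi 0, (t : ℂ) ^ (a - 1) * cexp (-((x:ℂ) * t))
        = (x:ℂ) ^ (-a) * Gamma a := by
      intro x hx
      rw [Complex.integral_cpow_mul_exp_neg_mul_Ioi ha hx, one_div, Complex.cpow_neg,
        Complex.inv_cpow]
      rw [Complex.arg_ofReal_of_nonneg hx.le]; exact Real.pi_pos.ne
    have ht : Tendsto (fun n : ℕ => ((1 + 1 / ((n:ℝ) + 1) : ℝ) : ℂ)) atTop (𝓝[≠] 1) := by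
      rw [tendsto_nhdsWithin_iff]
      constructor
      · have h := (tendsto_one_div_add_atTop_nhds_zero_nat (𝕜 := ℝ)).const_add 1
        rw [add_zero] at h
        exact (Complex.continuous_ofReal.tendsto (1:ℝ)).comp h |>.trans (by simp)
      · refine Eventually.of_forall fun n => ?_
        have : (0:ℝ) < 1 / ((n:ℝ) + 1) := by positivity
        simp only [mem_compl_iff, mem_singleton_iff]
        intro h
        have h' : (1 + 1 / ((n:ℝ) + 1) : ℝ) = 1 := by exact_mod_cast h
        linarith
    exact ht.frequently (Eventually.of_forall fun n => hreal _ (by positivity)).frequently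
end

section
open Set Filter Topology

/-- The smooth weight to which Poisson summation is applied. -/
noncomputable def bump (τ s x : ℝ) : ℂ := if 0 < x then ker x τ * W (Real.log x - s) else 0

lemma norm_bump_le_exp (τ s : ℝ) {x : ℝ} (hx : 0 < x) (a : ℝ) :
    ‖bump τ s x‖ ≤ Real.exp (a ^ 2 + a * s) * x ^ (-a - 1 / 2) := by
  rw [bump, if_pos hx, norm_mul, norm_ker, Complex.norm_real, Real.norm_of_nonneg (W_pos _).le,
    Real.rpow_def_of_pos hx, ← Real.exp_add]
  refine (mul_le_mul_of_nonneg_left (W_le a _) (Real.exp_pos _).le).trans ?_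
  rw [← Real.exp_add]
  apply le_of_eq; congr 1; ring

lemma norm_bump_le (τ s x : ℝ) :
    ‖bump τ s x‖ ≤ (Real.exp (1 / 4 - s / 2) + Real.exp (9 / 4 + 3 / 2 * s)) * (1 + x ^ 2)⁻¹ := by
  rcases le_or_gt x 0 with hx | hx
  · rw [bump, if_neg hx.not_gt, norm_zero]; positivity
  · have h1 := norm_bump_le_exp τ s hx (-(1 / 2))
    have h2 := norm_bump_le_exp τ s hx (3 / 2)
    norm_num at h1 h2
    rw [← div_eq_mul_inv, le_div_iff₀ (by positivity)]
    have h3 : ‖bump τ s x‖ * x ^ 2 ≤ Real.exp (9 / 4 + 3 / 2 * s) := by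
      refine (mul_le_mul_of_nonneg_right h2 (sq_nonneg x)).trans (le_of_eq ?_)
      field_simp
    have h4 : (1 / 4 - s / 2) = 1 / 4 + -(1 / 2 * s) := by ring
    rw [h4]; linarith

lemma measurable_bump (τ s : ℝ) : Measurable (bump τ s) := by
  unfold bump ker W
  apply Measurable.ite measurableSet_Ioi
  · fun_prop
  · fun_prop

lemma integrable_bump (τ s : ℝ) : Integrable (bump τ s) :=
  (integrable_inv_one_add_sq.const_mul _).mono' (measurable_bump τ s).aestronglyMeasurable
    (Eventually.of_forall fun x => norm_bump_le τ s x)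

lemma continuous_bump (τ s : ℝ) : Continuous (bump τ s) := by
  rw [continuous_iff_continuousAt]
  intro x
  rcases lt_trichotomy x 0 with hx | hx | hx
  · have : bump τ s =ᶠ[𝓝 x] fun _ => 0 := by
      filter_upwards [gt_mem_nhds hx] with y hy
      rw [bump, if_neg (not_lt.2 hy.le)]
    exact continuousAt_const.congr this.symm
  · subst hx
    have h0 : bump τ s 0 = 0 := by simp [bump]
    rw [ContinuousAt, h0]
    apply squeeze_zero_norm (a := fun x => Real.exp (9 / 4 - 3 / 2 * s) * |x|)
    · intro x
      rcases le_or_gt x 0 with hx | hx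
      · rw [bump, if_neg hx.not_gt, norm_zero]; positivity
      · have h1 := norm_bump_le_exp τ s hx (-(3 / 2))
        norm_num at h1
        rw [abs_of_pos hx, show (9 / 4 - 3 / 2 * s) = 9 / 4 + -(3 / 2 * s) by ring]
        exact h1
    · have : Continuous fun x : ℝ => Real.exp (9 / 4 - 3 / 2 * s) * |x| := by fun_prop
      have h := this.tendsto 0
      simpa using h
  · have : bump τ s =ᶠ[𝓝 x] fun x => ker x τ * W (Real.log x - s) := by
      filter_upwards [lt_mem_nhds hx] with y hy
      rw [bump, if_pos hy]
    refine ContinuousAt.congr ?_ this.symm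
    have hl := Real.continuousAt_log hx.ne'
    unfold ker
    have h2 : ContinuousAt (fun x => W (Real.log x - s)) x :=
      continuous_W.continuousAt.comp (hl.sub continuousAt_const)
    have h3 : ContinuousAt (fun x => ((Real.log x : ℝ) : ℂ)) x :=
      Complex.continuous_ofReal.continuousAt.comp hl
    have h4 : ContinuousAt (fun x => ((W (Real.log x - s) : ℝ) : ℂ)) x :=
      Complex.continuous_ofReal.continuousAt.comp h2
    exact (Complex.continuous_exp.continuousAt.comp (continuousAt_const.mul h3)).mul h4

lemma norm_Gamma_le (a : ℝ) (ha : 0 < a) (u : ℝ) :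
    ‖Gamma (a + u * I)‖ ≤ ∫ t in Ioi (0:ℝ), t ^ (a - 1) * Real.exp (-(1 * t)) := by
  have h := laplace_cpow (a := a + u * I) (r := 1) (by simpa using ha) (by simp)
  rw [one_cpow, one_mul] at h
  rw [← h]
  refine (norm_integral_le_integral_norm _).trans (le_of_eq ?_)
  apply setIntegral_congr_fun measurableSet_Ioi
  intro t ht
  simp only
  rw [norm_cpow_exp ht]; simp

lemma norm_cpow_neg_le {r : ℂ} (hr : 0 ≤ r.re) {ρ : ℝ} (hρ : 0 < ρ) (hρr : ρ ≤ ‖r‖)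
    {a : ℝ} (ha : 0 < a) (u : ℝ) :
    ‖r ^ (-(a + u * I) : ℂ)‖ ≤ ρ ^ (-a) * Real.exp (Real.pi / 2 * |u|) := by
  have hr0 : r ≠ 0 := norm_pos_iff.1 (hρ.trans_le hρr)
  rw [Complex.norm_cpow_of_ne_zero hr0, div_eq_mul_inv, ← Real.exp_neg]
  have h2 : (-((a:ℂ) + u * I)).re = -a := by simp
  have h3 : (-((a:ℂ) + u * I)).im = -u := by simp
  rw [h2, h3]
  have h4 : ‖r‖ ^ (-a) ≤ ρ ^ (-a) := Real.rpow_le_rpow_of_nonpos hρ hρr (by linarith)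
  gcongr
  have harg : |Complex.arg r| ≤ Real.pi / 2 := by
    rw [Complex.abs_arg_le_pi_div_two_iff]; exact hr
  calc -(Complex.arg r * -u) ≤ |Complex.arg r * u| := by
        rw [mul_neg, neg_neg]; exact le_abs_self _
    _ ≤ _ := by rw [abs_mul]; gcongr

/-- `Γ(z) (2πiξ)^{-z}` on the vertical line of real part `a`. -/
noncomputable def gam (a ξ u : ℝ) : ℂ :=
  Gamma (a + u * I) * (2 * Real.pi * ξ * I : ℂ) ^ (-(a + u * I))

lemma norm_gauss_factor (c v s : ℝ) :
    ‖cexp ((c + v * I) ^ 2 + (c + v * I) * s)‖ = Real.exp (c ^ 2 + c * s) * Real.exp (-v ^ 2) := by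
  rw [Complex.norm_exp, ← Real.exp_add]; congr 1
  simp [pow_two]; ring

lemma integrable_exp_neg_sq : Integrable fun v : ℝ => Real.exp (-v ^ 2) := by
  simpa using integrable_exp_neg_mul_sq (b := 1) one_pos

lemma continuous_Gamma_line {a : ℝ} (ha : 0 < a) : Continuous fun u : ℝ => Gamma (a + u * I) := by
  rw [continuous_iff_continuousAt]
  intro u
  apply ContinuousAt.comp (f := fun u : ℝ => (a + u * I : ℂ)) (g := Gamma)
  · apply DifferentiableAt.continuousAt (𝕜 := ℂ)
    apply differentiableAt_Gamma
    intro m h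
    have := congrArg Complex.re h
    simp at this
    have : (0:ℝ) ≤ m := m.cast_nonneg
    linarith
  · fun_prop

lemma continuous_cpow_line {r : ℂ} (hr : r ≠ 0) (a : ℝ) :
    Continuous fun u : ℝ => r ^ (-(a + u * I) : ℂ) := by
  simp_rw [Complex.cpow_def_of_ne_zero hr]; fun_prop

lemma regularized_transform {c : ℝ} (hc : c < 1 / 2) (τ s : ℝ) {r : ℂ} (hr : 0 < r.re) :
    ∫ x in Ioi (0:ℝ), ker x τ * W (Real.log x - s) * cexp (-(r * x)) =
      (1 / (2 * Real.pi)) * ∫ v : ℝ, cexp ((c + v * I) ^ 2 + (c + v * I) * s) *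
        (Gamma ((1 / 2 - c : ℝ) + (2 * Real.pi * τ - v : ℝ) * I) *
          r ^ (-((1 / 2 - c : ℝ) + (2 * Real.pi * τ - v : ℝ) * I) : ℂ)) := by
  have ha : 0 < 1 / 2 - c := by linarith
  let g : ℝ → ℝ → ℂ := fun x v => cexp ((c + v * I) ^ 2 + (c + v * I) * s) *
    (cexp (((1 / 2 - c : ℝ) + (2 * Real.pi * τ - v : ℝ) * I - 1) * Real.log x) * cexp (-(r * x)))
  have hg : ∀ x v : ℝ, 0 < x → g x v = cexp ((c + v * I) ^ 2 + (c + v * I) * s) *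
      ((x:ℂ) ^ (((1 / 2 - c : ℝ) + (2 * Real.pi * τ - v : ℝ) * I : ℂ) - 1) * cexp (-(r * x))) := by
    intro x v hx
    simp only [g]
    rw [Complex.cpow_def_of_ne_zero (by exact_mod_cast hx.ne'), ← Complex.ofReal_log hx.le]
    congr 3; ring_nf
  have h1 : ∀ x ∈ Ioi (0:ℝ), ker x τ * W (Real.log x - s) * cexp (-(r * x))
      = (1 / (2 * Real.pi)) * ∫ v : ℝ, g x v := by
    intro x hx
    rw [W_repr c, mul_left_comm, mul_assoc, mul_assoc, ← integral_mul_const, ← integral_const_mul]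
    congr 2; ext v
    simp only [g, ker]
    rw [← Complex.exp_add, ← Complex.exp_add, ← Complex.exp_add, ← Complex.exp_add]
    congr 1; push_cast; ring
  rw [setIntegral_congr_fun measurableSet_Ioi h1, integral_const_mul]
  congr 1
  rw [integral_integral_swap]
  · congr 1; ext v
    rw [setIntegral_congr_fun measurableSet_Ioi (fun x hx => hg x v hx), integral_const_mul,
      laplace_cpow (by simpa using ha) hr, mul_comm (r ^ _)]
  · have hm : AEStronglyMeasurable (Function.uncurry g)
        ((volume.restrict (Ioi 0)).prod volume) := by
      apply Measurable.aestronglyMeasurable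
      simp only [g, Function.uncurry_def]; fun_prop
    have hb : Integrable (fun p : ℝ × ℝ => (p.1 ^ ((1 / 2 - c) - 1) * Real.exp (-(r.re * p.1))) *
        (Real.exp (c ^ 2 + c * s) * Real.exp (-p.2 ^ 2)))
        ((volume.restrict (Ioi 0)).prod volume) :=
      Integrable.mul_prod (integrableOn_rpow_exp ha hr) (integrable_exp_neg_sq.const_mul _)
    refine hb.mono' hm ?_
    rw [← Measure.restrict_univ (μ := (volume : Measure ℝ)), Measure.prod_restrict,
      Measure.restrict_univ]
    refine (ae_restrict_iff' (measurableSet_Ioi.prod MeasurableSet.univ)).2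
      (Eventually.of_forall fun p hp => ?_)
    have hp1 : 0 < p.1 := hp.1
    show ‖g p.1 p.2‖ ≤ _
    rw [hg _ _ hp1, norm_mul, norm_gauss_factor, norm_cpow_exp hp1, mul_comm]
    simp

lemma bump_transform {c : ℝ} (hc : c < 1 / 2) (τ s : ℝ) {ξ : ℝ} (hξ : ξ ≠ 0) :
    ∫ x : ℝ, cexp (-(2 * Real.pi * ξ * I * x)) * bump τ s x =
      (1 / (2 * Real.pi)) * ∫ v : ℝ, cexp ((c + v * I) ^ 2 + (c + v * I) * s) *
        gam (1 / 2 - c) ξ (2 * Real.pi * τ - v) := by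
  have ha : 0 < 1 / 2 - c := by linarith
  have hL : ∫ x : ℝ, cexp (-(2 * Real.pi * ξ * I * x)) * bump τ s x
      = ∫ x in Ioi (0:ℝ), ker x τ * W (Real.log x - s) * cexp (-(2 * Real.pi * ξ * I * x)) := by
    rw [← integral_indicator measurableSet_Ioi]
    congr 1; ext x
    by_cases hx : 0 < x
    · rw [indicator_of_mem (show x ∈ Ioi 0 from hx), bump, if_pos hx]; ring
    · rw [indicator_of_notMem (show x ∉ Ioi 0 from hx), bump, if_neg hx]; simp
  rw [hL]
  let r : ℕ → ℂ := fun n => ((1 / ((n:ℝ) + 1) : ℝ) : ℂ) + 2 * Real.pi * ξ * I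
  have hrre : ∀ n, (r n).re = 1 / ((n:ℝ) + 1) := by intro n; simp only [r, Complex.add_re, Complex.ofReal_re]; simp
  have hrim : ∀ n, (r n).im = 2 * Real.pi * ξ := by intro n; simp [r]
  have hrpos : ∀ n, 0 < (r n).re := by intro n; rw [hrre]; positivity
  have hrlim : Tendsto r atTop (𝓝 (2 * Real.pi * ξ * I)) := by
    have h := (tendsto_one_div_add_atTop_nhds_zero_nat (𝕜 := ℝ))
    have h2 := ((Complex.continuous_ofReal.tendsto (0:ℝ)).comp h).add_const (2 * Real.pi * ξ * I : ℂ)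
    simpa [r] using h2
  have hT1 : Tendsto (fun n => ∫ x in Ioi (0:ℝ), ker x τ * W (Real.log x - s) * cexp (-(r n * x)))
      atTop (𝓝 (∫ x in Ioi (0:ℝ), ker x τ * W (Real.log x - s) *
        cexp (-(2 * Real.pi * ξ * I * x)))) := by
    apply tendsto_integral_of_dominated_convergence (fun x => ‖bump τ s x‖)
    · intro n
      apply Measurable.aestronglyMeasurable
      unfold ker W; fun_prop
    · exact (integrable_bump τ s).norm.restrict
    · intro n
      refine (ae_restrict_iff' measurableSet_Ioi).2 (Eventually.of_forall fun x hx => ?_)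
      have hx' : 0 < x := hx
      rw [norm_mul, bump, if_pos hx']
      apply mul_le_of_le_one_right (norm_nonneg _)
      rw [Complex.norm_exp]
      apply Real.exp_le_one_iff.2
      have : 0 ≤ (r n).re * x := mul_nonneg (hrpos n).le hx'.le
      simpa using this
    · refine Eventually.of_forall fun x => ?_
      apply Tendsto.const_mul
      exact (Complex.continuous_exp.tendsto _).comp ((hrlim.mul_const _).neg)
  have hT2 : Tendsto (fun n => (1 / (2 * Real.pi)) * ∫ v : ℝ,
      cexp ((c + v * I) ^ 2 + (c + v * I) * s) *
        (Gamma ((1 / 2 - c : ℝ) + (2 * Real.pi * τ - v : ℝ) * I) *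
          (r n) ^ (-((1 / 2 - c : ℝ) + (2 * Real.pi * τ - v : ℝ) * I) : ℂ))) atTop
      (𝓝 ((1 / (2 * Real.pi)) * ∫ v : ℝ, cexp ((c + v * I) ^ 2 + (c + v * I) * s) *
        gam (1 / 2 - c) ξ (2 * Real.pi * τ - v))) := by
    apply Tendsto.const_mul
    set G0 := ∫ t in Ioi (0:ℝ), t ^ ((1 / 2 - c) - 1) * Real.exp (-(1 * t)) with hG0
    have hρ : 0 < 2 * Real.pi * |ξ| := by have := abs_pos.2 hξ; positivity
    have hG0n : 0 ≤ G0 := (norm_nonneg _).trans (norm_Gamma_le _ ha 0)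
    apply tendsto_integral_of_dominated_convergence (fun v =>
      Real.exp (c ^ 2 + c * s) * (G0 * (2 * Real.pi * |ξ|) ^ (-(1 / 2 - c))) *
        (Real.exp (Real.pi ^ 2 / 8 + Real.pi / 2 * |2 * Real.pi * τ|) * Real.exp (-(1 / 2) * v ^ 2)))
    · intro n
      apply Continuous.aestronglyMeasurable
      have hrne : r n ≠ 0 := by intro h; have := hrpos n; rw [h] at this; simp at this
      have e1 : Continuous fun v : ℝ => Gamma ((1 / 2 - c : ℝ) + (2 * Real.pi * τ - v : ℝ) * I) :=
        (continuous_Gamma_line ha).comp (by fun_prop : Continuous fun v : ℝ => 2 * Real.pi * τ - v)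
      have e2 : Continuous fun v : ℝ =>
          (r n) ^ (-((1 / 2 - c : ℝ) + (2 * Real.pi * τ - v : ℝ) * I) : ℂ) :=
        (continuous_cpow_line hrne (1 / 2 - c)).comp
          (by fun_prop : Continuous fun v : ℝ => 2 * Real.pi * τ - v)
      exact (by fun_prop : Continuous fun v : ℝ => cexp ((c + v * I) ^ 2 + (c + v * I) * s)).mul
        (e1.mul e2)
    · apply Integrable.const_mul
      apply Integrable.const_mul
      exact integrable_exp_neg_mul_sq (by norm_num)
    · intro n
      refine Eventually.of_forall fun v => ?_
      rw [norm_mul, norm_mul, norm_gauss_factor]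
      have b1 := norm_Gamma_le _ ha (2 * Real.pi * τ - v)
      have b2 : ‖(r n) ^ (-((1 / 2 - c : ℝ) + (2 * Real.pi * τ - v : ℝ) * I) : ℂ)‖ ≤ _ :=
        norm_cpow_neg_le (hrpos n).le hρ (by
          have := Complex.abs_im_le_norm (r n)
          rw [hrim, abs_mul, abs_mul, abs_of_pos Real.pi_pos] at this
          simpa using this) ha (2 * Real.pi * τ - v)
      have b3 : Real.exp (-v ^ 2) * Real.exp (Real.pi / 2 * |2 * Real.pi * τ - v|) ≤
          Real.exp (Real.pi ^ 2 / 8 + Real.pi / 2 * |2 * Real.pi * τ|) *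
            Real.exp (-(1 / 2) * v ^ 2) := by
        rw [← Real.exp_add, ← Real.exp_add]
        apply Real.exp_le_exp.2
        have h5 : |2 * Real.pi * τ - v| ≤ |2 * Real.pi * τ| + |v| := abs_sub _ _
        have h6 := mul_le_mul_of_nonneg_left h5 (half_pos Real.pi_pos).le
        nlinarith [sq_nonneg (Real.pi / 2 - |v|), sq_abs v]
      calc _ ≤ Real.exp (c ^ 2 + c * s) * Real.exp (-v ^ 2) * (G0 *
            ((2 * Real.pi * |ξ|) ^ (-(1 / 2 - c)) *
              Real.exp (Real.pi / 2 * |2 * Real.pi * τ - v|))) := by gcongr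
        _ = Real.exp (c ^ 2 + c * s) * (G0 * (2 * Real.pi * |ξ|) ^ (-(1 / 2 - c))) *
            (Real.exp (-v ^ 2) * Real.exp (Real.pi / 2 * |2 * Real.pi * τ - v|)) := by ring
        _ ≤ _ := by gcongr
    · refine Eventually.of_forall fun v => ?_
      unfold gam
      apply Tendsto.const_mul
      apply Tendsto.const_mul
      have hcont : ContinuousAt (fun z : ℂ =>
          z ^ (-((1 / 2 - c : ℝ) + (2 * Real.pi * τ - v : ℝ) * I) : ℂ)) (2 * Real.pi * ξ * I) := by
        apply continuousAt_cpow_const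
        right
        simp [hξ, Real.pi_ne_zero]
      exact hcont.tendsto.comp hrlim
  refine tendsto_nhds_unique hT1 (hT2.congr fun n => ?_)
  rw [regularized_transform hc τ s (hrpos n)]
end

section
open Set Filter Topology FourierTransform

section Gauss
variable {q : ℕ}

lemma sum_char_stdAddChar [NeZero q] {χ : DirichletCharacter ℂ q} (hχ : χ.IsPrimitive) (k : ZMod q) :
    ∑ j, χ j * ZMod.stdAddChar (k * j) = χ⁻¹ k * gaussSum χ ZMod.stdAddChar := by
  rw [← gaussSum_mulShift_of_isPrimitive _ hχ]
  simp [gaussSum, AddChar.mulShift_apply]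

lemma normSq_gaussSum [NeZero q] {χ : DirichletCharacter ℂ q} (hχ : χ.IsPrimitive) :
    ‖gaussSum χ ZMod.stdAddChar‖ ^ 2 = q := by
  set G := gaussSum χ ZMod.stdAddChar with hG
  have h1 : ∀ k, ZMod.dft χ k = χ⁻¹ (-k) * G := by
    intro k
    rw [ZMod.dft_apply, ← sum_char_stdAddChar hχ]
    refine Finset.sum_congr rfl fun j _ => ?_
    rw [smul_eq_mul, mul_comm]; ring_nf
  have h2 := congrFun (ZMod.dft_dft χ) (-1)
  rw [show ZMod.dft χ = fun k => χ⁻¹ (-k) * G from funext h1, ZMod.dft_apply] at h2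
  have h3 : ∑ j : ZMod q, ZMod.stdAddChar (-(j * -1)) • (χ⁻¹ (-j) * G)
      = (starRingEnd ℂ) G * G := by
    rw [hG, gaussSum, map_sum, Finset.sum_mul, ← Equiv.sum_comp (Equiv.neg (ZMod q))]
    refine Finset.sum_congr rfl fun j _ => ?_
    have e1 : (starRingEnd ℂ) (χ j) = χ⁻¹ j := MulChar.star_apply' χ j
    have e2 : (starRingEnd ℂ) (ZMod.stdAddChar j) = ZMod.stdAddChar (-j) :=
      (AddChar.map_neg_eq_conj _ _).symm
    rw [map_mul, e1, e2, smul_eq_mul]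
    simp only [Equiv.neg_apply, mul_neg, mul_one, neg_neg]
    ring
  rw [h3, mul_comm, Complex.mul_conj, Complex.normSq_eq_norm_sq] at h2
  simp only [neg_neg, map_one, smul_eq_mul, mul_one] at h2
  exact_mod_cast h2

lemma norm_char_neg_one (χ : DirichletCharacter ℂ q) : ‖χ (-1)‖ = 1 := by
  simpa using χ.unit_norm_eq_one (-1)

lemma norm_gaussSum [NeZero q] {χ : DirichletCharacter ℂ q} (hχ : χ.IsPrimitive) :
    ‖gaussSum χ ZMod.stdAddChar‖ = √q := by
  rw [← normSq_gaussSum hχ, Real.sqrt_sq (norm_nonneg _)]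
end Gauss

/-- The Fourier transform of `bump`. -/
noncomputable def bumpF (τ s ξ : ℝ) : ℂ :=
  ∫ x : ℝ, cexp (-(2 * Real.pi * ξ * I * x)) * bump τ s x

lemma gam_three_halves (ξ u : ℝ) : gam (3 / 2) ξ u =
    Gamma (3 / 2 + u * I) * (2 * Real.pi * ξ * I : ℂ) ^ (-(3 / 2 + u * I)) := by
  unfold gam; push_cast; rfl

lemma gam_half (ξ u : ℝ) : gam (1 / 2) ξ u =
    Gamma (1 / 2 + u * I) * (2 * Real.pi * ξ * I : ℂ) ^ (-(1 / 2 + u * I)) := by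
  unfold gam; push_cast; rfl

lemma continuous_gam {a : ℝ} (ha : 0 < a) {ξ : ℝ} (hξ : ξ ≠ 0) : Continuous (gam a ξ) :=
  (continuous_Gamma_line ha).mul (continuous_cpow_line (twoPiI_ne hξ) a)

/-- A polynomially bounded function is integrable against the Gaussian weight. -/
lemma integrable_gauss_mul {f : ℝ → ℝ} (hf : Measurable f) {C : ℝ} {N : ℕ}
    (hC : ∀ v, |f v| ≤ C * (1 + |v|) ^ N) : Integrable fun v => Real.exp (-v ^ 2) * f v := by
  have hC0 : 0 ≤ C := by
    have := (abs_nonneg _).trans (hC 0); simpa using this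
  have hI : Integrable fun v : ℝ => C * ((N.factorial : ℝ) * Real.exp 1 * Real.exp (1/2)) *
      Real.exp (-(1 / 2) * v ^ 2) :=
    (integrable_exp_neg_mul_sq (by norm_num)).const_mul _
  refine hI.mono' (by fun_prop) (Eventually.of_forall fun v => ?_)
  have h1 : (1 + |v|) ^ N ≤ N.factorial * Real.exp (1 + |v|) := by
    have := Real.pow_div_factorial_le_exp (1 + |v|) (by positivity) N
    rwa [div_le_iff₀' (by positivity)] at this
  rw [norm_mul, Real.norm_eq_abs, Real.norm_eq_abs, abs_of_pos (Real.exp_pos _)]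
  calc _ ≤ Real.exp (-v ^ 2) * (C * (N.factorial * Real.exp (1 + |v|))) := by
        gcongr; exact (hC v).trans (by gcongr)
    _ = C * N.factorial * (Real.exp (-v ^ 2) * Real.exp (1 + |v|)) := by ring
    _ ≤ C * N.factorial * (Real.exp 1 * Real.exp (1/2) * Real.exp (-(1 / 2) * v ^ 2)) := by
      refine mul_le_mul_of_nonneg_left ?_ (by positivity)
      rw [← Real.exp_add, ← Real.exp_add, ← Real.exp_add]
      apply Real.exp_le_exp.2
      nlinarith [sq_nonneg (1 - |v|), sq_abs v]
    _ = _ := by ring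

/-- Twist of the Gaussian factor that appears in `bump_transform`. -/
noncomputable def gfac (c s v : ℝ) : ℂ := cexp ((c + v * I) ^ 2 + (c + v * I) * s)

lemma bumpF_eq {c : ℝ} (hc : c < 1 / 2) (τ s : ℝ) {ξ : ℝ} (hξ : ξ ≠ 0) :
    bumpF τ s ξ = (1 / (2 * Real.pi)) * ∫ v : ℝ, gfac c s v *
        gam (1 / 2 - c) ξ (2 * Real.pi * τ - v) := bump_transform hc τ s hξ

lemma norm_bumpF_le (τ s : ℝ) {ξ : ℝ} (hξ : ξ ≠ 0) :
    ‖bumpF τ s ξ‖ ≤ (∫ v : ℝ, Real.exp (-v ^ 2) * (Real.exp (1 - s) *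
      (1 + |2 * Real.pi * τ - v|))) * |ξ| ^ (-(3 / 2) : ℝ) := by
  rw [bumpF_eq (c := -1) (by norm_num) τ s hξ, norm_mul]
  have h0 : ‖(1 / (2 * Real.pi) : ℂ)‖ ≤ 1 := by
    rw [norm_div, norm_mul]
    simp only [norm_one, Complex.norm_ofNat, Complex.norm_real, Real.norm_eq_abs,
      abs_of_pos Real.pi_pos]
    rw [div_le_one (by positivity)]; linarith [Real.pi_gt_three]
  refine (mul_le_of_le_one_left (norm_nonneg _) h0).trans ?_
  refine (norm_integral_le_integral_norm _).trans ?_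
  rw [← integral_mul_const]
  have hinteg : Integrable fun v : ℝ => Real.exp (-v ^ 2) * (Real.exp (1 - s) *
      (1 + |2 * Real.pi * τ - v|)) := by
    apply integrable_gauss_mul (by fun_prop) (C := Real.exp (1 - s) * (1 + |2 * Real.pi * τ|))
      (N := 1)
    intro v
    rw [abs_of_nonneg (by positivity), pow_one, mul_assoc (Real.exp _)]
    refine mul_le_mul_of_nonneg_left ?_ (Real.exp_pos _).le
    nlinarith [abs_sub (2 * Real.pi * τ) v, abs_nonneg v, abs_nonneg (2 * Real.pi * τ),
      mul_nonneg (abs_nonneg v) (abs_nonneg (2 * Real.pi * τ))]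
  apply integral_mono_of_nonneg (Eventually.of_forall fun v => norm_nonneg _)
    (hinteg.mul_const _) (Eventually.of_forall fun v => ?_)
  simp only
  rw [norm_mul, gfac, norm_gauss_factor, show (1 / 2 - (-1) : ℝ) = 3 / 2 by norm_num,
    gam_three_halves]
  have := gamma_three_halves_bound hξ (2 * Real.pi * τ - v)
  push_cast at this ⊢
  rw [show ((-1:ℝ) ^ 2 + (-1) * s) = 1 - s by ring]
  calc _ ≤ Real.exp (1 - s) * Real.exp (-v ^ 2) *
        ((1 + |2 * Real.pi * τ - v|) * |ξ| ^ (-(3 / 2) : ℝ)) := by gcongr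
    _ = _ := by ring

end

section
open Set Filter Topology FourierTransform

section Poisson
variable {q : ℕ}

lemma summable_bumpF [NeZero q] (τ s : ℝ) : Summable fun n : ℤ => bumpF τ s ((n : ℝ) / q) := by
  have hq : (0:ℝ) < q := by exact_mod_cast Nat.pos_of_ne_zero (NeZero.ne q)
  obtain ⟨C, hC⟩ : ∃ C, C = ∫ v : ℝ, Real.exp (-v ^ 2) * (Real.exp (1 - s) *
      (1 + |2 * Real.pi * τ - v|)) := ⟨_, rfl⟩
  have h : Summable fun n : ℤ => C * (q:ℝ) ^ (3 / 2 : ℝ) * |(n:ℝ)| ^ (-(3 / 2) : ℝ) :=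
    (Real.summable_abs_int_rpow (by norm_num)).mul_left _
  refine Summable.of_norm_bounded_eventually h ?_
  have hc : ({0}ᶜ : Set ℤ) ∈ (cofinite : Filter ℤ) := (Set.finite_singleton 0).compl_mem_cofinite
  filter_upwards [hc] with n hn
  have hn' : (n:ℝ) ≠ 0 := by exact_mod_cast hn
  refine (norm_bumpF_le τ s (div_ne_zero hn' hq.ne')).trans (le_of_eq ?_)
  rw [← hC]
  rw [abs_div, abs_of_pos hq, Real.div_rpow (abs_nonneg _) hq.le, Real.rpow_neg hq.le]
  field_simp

lemma bump_poisson [NeZero q] (τ s x : ℝ) : ∑' m : ℤ, bump τ s (q * (x + m)) =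
    ∑' n : ℤ, (1 / q : ℂ) * bumpF τ s ((n : ℝ) / q) * cexp (2 * Real.pi * I * n * x) := by
  have hq : (0:ℝ) < q := by exact_mod_cast Nat.pos_of_ne_zero (NeZero.ne q)
  have hF : ∀ n : ℤ, 𝓕 (fun x => bump τ s (q * x)) (n:ℝ)
      = (1 / q : ℂ) * bumpF τ s ((n : ℝ) / q) := by
    intro n
    rw [Real.fourier_real_eq_integral_exp_smul]
    have := Measure.integral_comp_mul_left
      (fun x : ℝ => cexp (-(2 * Real.pi * ((n:ℝ) / q : ℝ) * I * x)) * bump τ s x) (q:ℝ)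
    rw [abs_of_pos (inv_pos.2 hq), Complex.real_smul] at this
    rw [bumpF, one_div]
    push_cast at this ⊢
    rw [← this]
    congr 1; ext v
    rw [smul_eq_mul]; congr 2
    have : (q:ℂ) ≠ 0 := by exact_mod_cast hq.ne'
    field_simp
  have hdec : (fun x => bump τ s (q * x)) =O[cocompact ℝ] fun x : ℝ => |x| ^ (-2 : ℝ) := by
    set C := Real.exp (1 / 4 - s / 2) + Real.exp (9 / 4 + 3 / 2 * s) with hC
    apply Asymptotics.IsBigO.of_bound C
    have : ({0}ᶜ : Set ℝ) ∈ cocompact ℝ := isCompact_singleton.compl_mem_cocompact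
    filter_upwards [this] with x hx
    have hx' : x ≠ 0 := hx
    refine (norm_bump_le τ s _).trans ?_
    rw [Real.norm_of_nonneg (by positivity)]
    have hx2 : 0 < x ^ 2 := by positivity
    gcongr
    rw [Real.rpow_neg (abs_nonneg _), Real.rpow_two, sq_abs]
    apply inv_anti₀ hx2
    have : (1:ℝ) ≤ q := by exact_mod_cast Nat.pos_of_ne_zero (NeZero.ne q)
    have : (1:ℝ) ≤ (q:ℝ)^2 := one_le_pow₀ this
    nlinarith
  have hs : Summable fun n : ℤ => 𝓕 (fun x => bump τ s (q * x)) (n:ℝ) := by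
    simp_rw [hF]; exact (summable_bumpF τ s).mul_left _
  have key := Real.tsum_eq_tsum_fourier_of_rpow_decay_of_summable
    (f := fun x => bump τ s (q * x)) ((continuous_bump τ s).comp (by fun_prop))
    (b := 2) (by norm_num) hdec hs x
  rw [key]
  congr 1; ext n
  rw [hF, fourier_coe_apply]; simp

/-- The smoothed Dirichlet series attached to `χ`. -/
noncomputable def DS (χ : DirichletCharacter ℂ q) (s τ : ℝ) : ℂ := ∑' n : ℕ, χ n * bump τ s n

lemma summable_DS (χ : DirichletCharacter ℂ q) (s τ : ℝ) :
    Summable fun n : ℕ => χ n * bump τ s n := by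
  set C := Real.exp (1 / 4 - s / 2) + Real.exp (9 / 4 + 3 / 2 * s) with hC
  have h : Summable fun n : ℕ => C * (1 / (n:ℝ) ^ 2) :=
    (Real.summable_one_div_nat_pow.2 (by norm_num)).mul_left _
  refine Summable.of_norm_bounded_eventually_nat h ?_
  filter_upwards [eventually_gt_atTop 0] with n hn
  have hn' : (0:ℝ) < n := by exact_mod_cast hn
  rw [norm_mul]
  refine (mul_le_of_le_one_left (norm_nonneg _) (χ.norm_le_one _)).trans ?_
  refine (norm_bump_le τ s _).trans ?_
  gcongr
  rw [one_div]
  gcongr; linarith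

lemma DS_eq [NeZero q] (χ : DirichletCharacter ℂ q) (hχ : χ.IsPrimitive) (s τ : ℝ) :
    DS χ s τ = (gaussSum χ ZMod.stdAddChar / q) *
      ∑' n : ℤ, χ⁻¹ (n : ZMod q) * bumpF τ s ((n : ℝ) / q) := by
  have hq : (0:ℝ) < q := by exact_mod_cast Nat.pos_of_ne_zero (NeZero.ne q)
  have hqc : (q:ℂ) ≠ 0 := by exact_mod_cast hq.ne'
  rw [DS, Nat.sumByResidueClasses (summable_DS χ s τ) q]
  have h1 : ∀ j : ZMod q, ∑' m : ℕ, χ ((j.val + q * m : ℕ) : ZMod q) *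
      bump τ s ((j.val + q * m : ℕ) : ℝ) = ∑' n : ℤ, ((1 / q : ℂ) * bumpF τ s ((n : ℝ) / q)) *
        (χ j * ZMod.stdAddChar ((n : ZMod q) * j)) := by
    intro j
    have e1 : ∀ m : ℕ, χ ((j.val + q * m : ℕ) : ZMod q) = χ j := by
      intro m; push_cast; simp
    simp_rw [e1, tsum_mul_left]
    have e2 : ∑' m : ℕ, bump τ s ((j.val + q * m : ℕ) : ℝ) =
        ∑' m : ℤ, bump τ s (q * ((j.val / q : ℝ) + m)) := by
      rw [← (Nat.cast_injective (R := ℤ)).tsum_eq]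
      · congr 1; ext m
        congr 1; push_cast; field_simp
      · intro m hm
        by_contra hcon
        apply hm
        have hneg : m ≤ -1 := by
          by_contra h; push Not at h
          exact hcon ⟨m.toNat, by simp; omega⟩
        change bump τ s (q * ((j.val / q : ℝ) + m)) = 0
        unfold bump
        rw [if_neg]
        rw [not_lt]
        apply mul_nonpos_of_nonneg_of_nonpos hq.le
        have h3 : (j.val / q : ℝ) < 1 := by
          rw [div_lt_one hq]; exact_mod_cast ZMod.val_lt j
        have : (m:ℝ) ≤ -1 := by exact_mod_cast hneg
        linarith
    rw [e2, bump_poisson, ← tsum_mul_left]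
    congr 1; ext n
    have e3 : ZMod.stdAddChar ((n : ZMod q) * j) = cexp (2 * Real.pi * I * n * (j.val / q : ℝ)) := by
      have : (n : ZMod q) * j = ((n * (j.val : ℤ) : ℤ) : ZMod q) := by
        push_cast; simp
      rw [this, ZMod.stdAddChar_coe]
      congr 1; push_cast; ring
    rw [e3]; push_cast; ring
  simp_rw [h1]
  have hs : ∀ j ∈ (Finset.univ : Finset (ZMod q)), Summable fun n : ℤ =>
      ((1 / q : ℂ) * bumpF τ s ((n : ℝ) / q)) * (χ j * ZMod.stdAddChar ((n : ZMod q) * j)) := by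
    intro j _
    refine Summable.of_norm_bounded ((summable_bumpF (q := q) τ s).norm.mul_left ‖(1 / q : ℂ)‖) ?_
    intro n
    rw [norm_mul, norm_mul]
    apply mul_le_of_le_one_right (by positivity)
    rw [norm_mul, AddChar.norm_apply, mul_one]
    exact χ.norm_le_one _
  rw [← Summable.tsum_finsetSum hs, ← tsum_mul_left]
  congr 1; ext n
  rw [← Finset.mul_sum, sum_char_stdAddChar hχ]
  field_simp

lemma DS_eq' [NeZero q] (χ : DirichletCharacter ℂ q) (hχ : χ.IsPrimitive) (hq1 : q ≠ 1) (s τ : ℝ) :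
    DS χ s τ = (gaussSum χ ZMod.stdAddChar / q) *
      (∑' n : ℕ, χ⁻¹ n * bumpF τ s (n * (1 / q)) +
        χ⁻¹ (-1) * ∑' n : ℕ, χ⁻¹ n * bumpF τ s (n * (-(1 / q)))) := by
  rw [DS_eq χ hχ]
  congr 1
  have hS : Summable fun n : ℤ => χ⁻¹ (n : ZMod q) * bumpF τ s ((n : ℝ) / q) := by
    refine Summable.of_norm_bounded (summable_bumpF (q := q) τ s).norm ?_
    intro n
    rw [norm_mul]
    exact mul_le_of_le_one_left (norm_nonneg _) (χ⁻¹.norm_le_one _)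
  have h1 := (hS.comp_injective (Nat.cast_injective (R := ℤ))).hasSum
  have h2 := (hS.comp_injective (i := fun n : ℕ => -(n:ℤ)) (by
    intro a b h; simpa using h)).hasSum
  have h3 := HasSum.of_nat_of_neg (f := fun n : ℤ => χ⁻¹ (n : ZMod q) * bumpF τ s ((n : ℝ) / q))
    h1 h2
  rw [h3.tsum_eq, ← tsum_mul_left]
  have hz : χ⁻¹ (((0:ℤ)) : ZMod q) = 0 := by
    have : Fact (1 < q) := ⟨by have := NeZero.ne q; omega⟩
    rw [Int.cast_zero, MulChar.map_nonunit _ not_isUnit_zero]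
  rw [hz, zero_mul, sub_zero]
  congr 1
  · congr 1; ext n
    simp [div_eq_mul_inv]
  · congr 1; ext n
    simp only [Function.comp]
    rw [← mul_assoc, ← map_mul]
    push_cast
    congr 2
    · ring_nf
    · ring

end Poisson
end

section
open Set Filter Topology

/-- The oscillating factor `n ^ (2πiτ)`. -/
noncomputable def osc (n : ℕ) (τ : ℝ) : ℂ := cexp (2 * Real.pi * τ * Real.log n * I)

lemma norm_osc (n : ℕ) (τ : ℝ) : ‖osc n τ‖ = 1 := by
  unfold osc
  rw [show (2 * Real.pi * τ * Real.log n * I : ℂ) = ((2 * Real.pi * τ * Real.log n : ℝ) : ℂ) * I by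
    push_cast; ring]
  exact Complex.norm_exp_ofReal_mul_I _

lemma continuous_osc (n : ℕ) : Continuous (osc n) := by unfold osc; fun_prop

lemma ker_nat (n : ℕ) (τ : ℝ) : ker n τ = Real.exp (-(Real.log n) / 2) * osc n τ := by
  unfold ker osc
  rw [Complex.ofReal_exp, ← Complex.exp_add]; congr 1; push_cast; ring

section
variable {q : ℕ}

/-- Dirichlet series with absolutely summable coefficients `b`, on the critical line. -/
noncomputable def E (χ : DirichletCharacter ℂ q) (b : ℕ → ℝ) (τ : ℝ) : ℂ :=
  ∑' n : ℕ, (b n : ℂ) * χ n * osc n τ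

lemma norm_E_term (χ : DirichletCharacter ℂ q) (b : ℕ → ℝ) (τ : ℝ) (n : ℕ) :
    ‖(b n : ℂ) * χ n * osc n τ‖ ≤ |b n| := by
  rw [norm_mul, norm_mul, norm_osc, mul_one, Complex.norm_real, Real.norm_eq_abs]
  exact mul_le_of_le_one_right (abs_nonneg _) (χ.norm_le_one _)

lemma summable_E (χ : DirichletCharacter ℂ q) {b : ℕ → ℝ} (hb : Summable fun n => |b n|) (τ : ℝ) :
    Summable fun n : ℕ => (b n : ℂ) * χ n * osc n τ :=
  Summable.of_norm_bounded hb fun n => norm_E_term χ b τ n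

lemma norm_E_le (χ : DirichletCharacter ℂ q) {b : ℕ → ℝ} (hb : Summable fun n => |b n|) (τ : ℝ) :
    ‖E χ b τ‖ ≤ ∑' n, |b n| :=
  tsum_of_norm_bounded hb.hasSum fun n => norm_E_term χ b τ n

lemma continuous_E (χ : DirichletCharacter ℂ q) {b : ℕ → ℝ} (hb : Summable fun n => |b n|) :
    Continuous (E χ b) :=
  continuous_tsum (fun n => continuous_const.mul (continuous_osc n)) hb
    fun n τ => norm_E_term χ b τ n

lemma gam_mul (a : ℝ) {n : ℕ} (hn : 0 < n) {w : ℝ} (hw : w ≠ 0) (u : ℝ) :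
    gam a (n * w) u = ((n : ℝ) ^ (-a) : ℝ) * (starRingEnd ℂ) (osc n (u / (2 * Real.pi))) *
      gam a w u := by
  have hn' : (0:ℝ) < n := by exact_mod_cast hn
  unfold gam osc
  have h1 : (2 * Real.pi * ((n * w : ℝ) : ℂ) * I : ℂ) = ((n:ℝ):ℂ) * (2 * Real.pi * w * I) := by
    push_cast; ring
  have h2 := twoPiI_ne hw
  rw [h1, Complex.cpow_def_of_ne_zero (mul_ne_zero (by exact_mod_cast hn'.ne') h2),
    Complex.cpow_def_of_ne_zero h2, Complex.log_ofReal_mul hn' h2, ← Complex.exp_conj,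
    Real.rpow_def_of_pos hn', Complex.ofReal_exp, add_mul, Complex.exp_add]
  have h3 : cexp (Real.log n * -(a + u * I)) = cexp ((Real.log n * -a : ℝ) : ℂ) *
      cexp ((starRingEnd ℂ) (2 * Real.pi * ((u / (2 * Real.pi) : ℝ) : ℂ) * Real.log n * I)) := by
    rw [← Complex.exp_add]; congr 1
    simp only [map_mul, Complex.conj_I, Complex.conj_ofReal, map_ofNat]
    push_cast
    have : (Real.pi : ℂ) ≠ 0 := by exact_mod_cast Real.pi_ne_zero
    field_simp
    ring
  rw [h3]; ring

lemma norm_gfac (c s v : ℝ) : ‖gfac c s v‖ = Real.exp (c ^ 2 + c * s) * Real.exp (-v ^ 2) :=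
  norm_gauss_factor c v s

lemma continuous_gfac (c s : ℝ) : Continuous (gfac c s) := by unfold gfac; fun_prop

lemma char_inv_apply (χ : DirichletCharacter ℂ q) (j : ZMod q) :
    χ⁻¹ j = (starRingEnd ℂ) (χ j) := (MulChar.star_apply' χ j).symm

/-- Termwise transformation of a portion of the dual sum. -/
lemma norm_dual_sum_le {a : ℝ} (ha : 0 < a) (χ : DirichletCharacter ℂ q) (hχ0 : χ 0 = 0)
    {A : Set ℕ}
    {b : ℕ → ℝ} (hb : Summable fun n => |b n|) (hbA : ∀ n, b n = if n ∈ A then (n:ℝ) ^ (-a) else 0)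
    (τ s : ℝ) {w : ℝ} (hw : w ≠ 0)
    (hI : Integrable fun v : ℝ => Real.exp (-v ^ 2) * ‖gam a w (2 * Real.pi * τ - v)‖) :
    ‖∑' n : ℕ, if n ∈ A then χ⁻¹ n * bumpF τ s (n * w) else 0‖ ≤
      Real.exp ((1 / 2 - a) ^ 2 + (1 / 2 - a) * s) * ∫ v : ℝ, Real.exp (-v ^ 2) *
        (‖gam a w (2 * Real.pi * τ - v)‖ * ‖E χ b (τ - v / (2 * Real.pi))‖) := by
  set c := 1 / 2 - a with hc
  have hca : 1 / 2 - c = a := by rw [hc]; ring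
  let F : ℕ → ℝ → ℂ := fun n v => gfac c s v * gam a w (2 * Real.pi * τ - v) *
    (starRingEnd ℂ) ((b n : ℂ) * χ n * osc n (τ - v / (2 * Real.pi)))
  have hcont : Continuous fun v => gfac c s v * gam a w (2 * Real.pi * τ - v) :=
    (continuous_gfac c s).mul ((continuous_gam ha hw).comp (by fun_prop))
  have hG : Integrable fun v => gfac c s v * gam a w (2 * Real.pi * τ - v) := by
    refine (hI.const_mul (Real.exp (c ^ 2 + c * s))).mono' hcont.aestronglyMeasurable
      (Eventually.of_forall fun v => le_of_eq ?_)
    rw [norm_mul, norm_gfac]; ring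
  have hFle : ∀ n v, ‖F n v‖ ≤ ‖gfac c s v * gam a w (2 * Real.pi * τ - v)‖ * |b n| := by
    intro n v
    simp only [F]
    rw [norm_mul, RCLike.norm_conj]
    exact mul_le_mul_of_nonneg_left (norm_E_term _ _ _ _) (norm_nonneg _)
  have hFc : ∀ n, Continuous (F n) := by
    intro n
    refine hcont.mul (continuous_conj.comp (continuous_const.mul ((continuous_osc n).comp ?_)))
    fun_prop
  have hFi : ∀ n, Integrable (F n) := fun n =>
    (hG.norm.mul_const _).mono' (hFc n).aestronglyMeasurable (Eventually.of_forall (hFle n))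
  have hFs : Summable fun n => ∫ v, ‖F n v‖ := by
    refine Summable.of_nonneg_of_le (fun n => integral_nonneg fun v => norm_nonneg _) (fun n => ?_)
      (hb.mul_left (∫ v, ‖gfac c s v * gam a w (2 * Real.pi * τ - v)‖))
    rw [← integral_mul_const]
    exact integral_mono (hFi n).norm (hG.norm.mul_const _) (hFle n)
  have hsum := hasSum_integral_of_summable_integral_norm hFi hFs
  have hterm : ∀ n : ℕ, (if n ∈ A then χ⁻¹ n * bumpF τ s (n * w) else 0)
      = (1 / (2 * Real.pi)) * ∫ v, F n v := by
    intro n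
    by_cases hn : n ∈ A
    · rcases Nat.eq_zero_or_pos n with rfl | hpos
      · simp [char_inv_apply, hχ0, F]
      · have hn' : (n:ℝ) ≠ 0 := by positivity
        rw [if_pos hn, bumpF_eq (c := c) (by linarith) τ s (mul_ne_zero hn' hw), ← mul_assoc,
          mul_comm (χ⁻¹ _), mul_assoc, ← integral_const_mul]
        congr 2; ext v
        simp only [F]
        rw [hca, gam_mul a hpos hw, char_inv_apply, hbA, if_pos hn]
        have e : (2 * Real.pi * τ - v) / (2 * Real.pi) = τ - v / (2 * Real.pi) := by
          field_simp
        rw [e]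
        simp only [map_mul, Complex.conj_ofReal]
        ring
    · simp [hn, F, hbA]
  simp_rw [hterm]
  rw [tsum_mul_left, hsum.tsum_eq, norm_mul]
  have h0 : ‖(1 / (2 * Real.pi) : ℂ)‖ ≤ 1 := by
    rw [norm_div, norm_mul]
    simp only [norm_one, Complex.norm_ofNat, Complex.norm_real, Real.norm_eq_abs,
      abs_of_pos Real.pi_pos]
    rw [div_le_one (by positivity)]; linarith [Real.pi_gt_three]
  refine (mul_le_of_le_one_left (norm_nonneg _) h0).trans ?_
  refine (norm_integral_le_integral_norm _).trans (le_of_eq ?_)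
  rw [← integral_const_mul]
  congr 1; ext v
  have : ∑' n, F n v = gfac c s v * gam a w (2 * Real.pi * τ - v) *
      (starRingEnd ℂ) (E χ b (τ - v / (2 * Real.pi))) := by
    simp only [F, E]
    rw [tsum_mul_left, Complex.conj_tsum]
  rw [this, norm_mul, norm_mul, norm_gfac, RCLike.norm_conj]
  ring

end
end

section
open Set Filter Topology

/-- Coefficients of the head of the dual sum. -/
noncomputable def headCoef (Y : ℝ) (n : ℕ) : ℝ := if (n:ℝ) ≤ Y then (n:ℝ) ^ (-(1 / 2) : ℝ) else 0

/-- Coefficients of the tail of the dual sum. -/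
noncomputable def tailCoef (Y : ℝ) (n : ℕ) : ℝ := if Y < (n:ℝ) then (n:ℝ) ^ (-(3 / 2) : ℝ) else 0

lemma headCoef_nonneg (Y : ℝ) (n : ℕ) : 0 ≤ headCoef Y n := by
  unfold headCoef; split_ifs <;> positivity

lemma tailCoef_nonneg (Y : ℝ) (n : ℕ) : 0 ≤ tailCoef Y n := by
  unfold tailCoef; split_ifs <;> positivity

lemma summable_headCoef (Y : ℝ) : Summable fun n => |headCoef Y n| := by
  apply summable_of_ne_finset_zero (s := Finset.range (⌊Y⌋₊ + 1))
  intro n hn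
  rw [Finset.mem_range, not_lt] at hn
  rw [headCoef, if_neg, abs_zero]
  rw [not_le]
  exact Nat.lt_of_floor_lt (by omega)

lemma summable_tailCoef (Y : ℝ) : Summable fun n => |tailCoef Y n| := by
  refine Summable.of_nonneg_of_le (fun n => abs_nonneg _) (fun n => ?_)
    (Real.summable_nat_rpow.2 (by norm_num : (-(3/2) : ℝ) < -1))
  rw [abs_of_nonneg (tailCoef_nonneg Y n), tailCoef]
  split_ifs
  · exact le_rfl
  · positivity

section
variable {q : ℕ}

/-- Functional equation in inequality form. -/
lemma norm_DS_le [NeZero q] (χ : DirichletCharacter ℂ q) (hχ : χ.IsPrimitive) (hq1 : q ≠ 1) (Y s τ : ℝ) :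
    ‖DS χ s τ‖ ≤
      2 * (∫ v : ℝ, Real.exp (-v ^ 2) * ‖E χ (headCoef Y) (τ - v / (2 * Real.pi))‖) +
      2 * Real.exp (1 - s) * q * ∫ v : ℝ, Real.exp (-v ^ 2) *
        ((1 + |2 * Real.pi * τ - v|) * ‖E χ (tailCoef Y) (τ - v / (2 * Real.pi))‖) := by
  have hq : (0:ℝ) < q := by exact_mod_cast Nat.pos_of_ne_zero (NeZero.ne q)
  have hχ0 : χ 0 = 0 := by
    have : Fact (1 < q) := ⟨by have := NeZero.ne q; omega⟩
    exact MulChar.map_nonunit _ not_isUnit_zero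
  set I1 := ∫ v : ℝ, Real.exp (-v ^ 2) * ‖E χ (headCoef Y) (τ - v / (2 * Real.pi))‖
  set I2 := ∫ v : ℝ, Real.exp (-v ^ 2) *
        ((1 + |2 * Real.pi * τ - v|) * ‖E χ (tailCoef Y) (τ - v / (2 * Real.pi))‖)
  have hlin : ∀ v : ℝ, |(1 + |2 * Real.pi * τ - v|)| ≤ (1 + |2 * Real.pi * τ|) * (1 + |v|) ^ 1 := by
    intro v
    rw [abs_of_nonneg (by positivity)]
    nlinarith [abs_sub (2 * Real.pi * τ) v, abs_nonneg v, abs_nonneg (2 * Real.pi * τ),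
      mul_nonneg (abs_nonneg v) (abs_nonneg (2 * Real.pi * τ))]
  have hE1 := continuous_E χ (summable_headCoef Y)
  have hE2 := continuous_E χ (summable_tailCoef Y)
  have hI1 : Integrable fun v : ℝ => Real.exp (-v ^ 2) *
      ‖E χ (headCoef Y) (τ - v / (2 * Real.pi))‖ := by
    apply integrable_gauss_mul (Continuous.measurable (by fun_prop))
      (C := ∑' n, |headCoef Y n|) (N := 0)
    intro v; simpa using norm_E_le χ (summable_headCoef Y) _
  have hI2 : Integrable fun v : ℝ => Real.exp (-v ^ 2) *
      ((1 + |2 * Real.pi * τ - v|) * ‖E χ (tailCoef Y) (τ - v / (2 * Real.pi))‖) := by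
    apply integrable_gauss_mul (Continuous.measurable (by fun_prop))
      (C := (1 + |2 * Real.pi * τ|) * ∑' n, |tailCoef Y n|) (N := 1)
    intro v
    rw [abs_mul, abs_norm]
    exact (mul_le_mul (hlin v) (norm_E_le χ (summable_tailCoef Y) _) (norm_nonneg _)
      (by positivity)).trans_eq (by ring)
  have main : ∀ w : ℝ, |w| = 1 / q → Summable (fun n : ℕ => χ⁻¹ n * bumpF τ s (n * w)) →
      ‖∑' n : ℕ, χ⁻¹ n * bumpF τ s (n * w)‖ ≤ √q * I1 + Real.exp (1 - s) * (q * √q) * I2 := by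
    intro w hw hS
    have hw0 : w ≠ 0 := by
      rw [← abs_pos, hw]; positivity
    have hw1 : |w| ^ (-(1 / 2) : ℝ) = √q := by
      rw [hw, Real.rpow_neg (by positivity), ← Real.inv_rpow (by positivity), one_div, inv_inv,
        Real.sqrt_eq_rpow, one_div]
    have hw2 : |w| ^ (-(3 / 2) : ℝ) = q * √q := by
      rw [show (-(3/2) : ℝ) = -(1/2) + -1 by norm_num, Real.rpow_add (abs_pos.2 hw0), hw1, hw,
        Real.rpow_neg_one, one_div, inv_inv, mul_comm]
    have g1 : ∀ v, ‖gam (1 / 2) w (2 * Real.pi * τ - v)‖ ≤ √q := by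
      intro v; rw [gam_half, ← hw1]; exact gamma_half_bound hw0 _
    have g2 : ∀ v, ‖gam (3 / 2) w (2 * Real.pi * τ - v)‖ ≤
        (1 + |2 * Real.pi * τ - v|) * (q * √q) := by
      intro v; rw [gam_three_halves, ← hw2]; exact gamma_three_halves_bound hw0 _
    have k1 : Integrable fun v : ℝ => Real.exp (-v ^ 2) * ‖gam (1 / 2) w (2 * Real.pi * τ - v)‖ := by
      apply integrable_gauss_mul (Continuous.measurable
        ((continuous_gam (by norm_num) hw0).comp (by fun_prop)).norm) (C := √q) (N := 0)
      intro v; simpa using g1 v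
    have k2 : Integrable fun v : ℝ => Real.exp (-v ^ 2) * ‖gam (3 / 2) w (2 * Real.pi * τ - v)‖ := by
      apply integrable_gauss_mul (Continuous.measurable
        ((continuous_gam (by norm_num) hw0).comp (by fun_prop)).norm)
        (C := (1 + |2 * Real.pi * τ|) * (q * √q)) (N := 1)
      intro v
      rw [abs_norm]
      exact ((g2 v).trans (mul_le_mul_of_nonneg_right ((le_abs_self _).trans (hlin v))
        (by positivity))).trans_eq (by ring)
    have p1 := norm_dual_sum_le (by norm_num) χ hχ0 (A := {n : ℕ | (n:ℝ) ≤ Y})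
      (summable_headCoef Y) (fun n => rfl) τ s hw0 k1
    have p2 := norm_dual_sum_le (by norm_num) χ hχ0 (A := {n : ℕ | Y < (n:ℝ)})
      (summable_tailCoef Y) (fun n => rfl) τ s hw0 k2
    have s1 : Summable fun n : ℕ => if n ∈ {n : ℕ | (n:ℝ) ≤ Y} then
        χ⁻¹ n * bumpF τ s (n * w) else 0 := by
      refine Summable.of_norm_bounded hS.norm fun n => ?_
      split_ifs
      · exact le_rfl
      · rw [norm_zero]; exact norm_nonneg _
    have s2 : Summable fun n : ℕ => if n ∈ {n : ℕ | Y < (n:ℝ)} then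
        χ⁻¹ n * bumpF τ s (n * w) else 0 := by
      refine Summable.of_norm_bounded hS.norm fun n => ?_
      split_ifs
      · exact le_rfl
      · rw [norm_zero]; exact norm_nonneg _
    have hsplit : ∑' n : ℕ, χ⁻¹ n * bumpF τ s (n * w) =
        (∑' n : ℕ, if n ∈ {n : ℕ | (n:ℝ) ≤ Y} then χ⁻¹ n * bumpF τ s (n * w) else 0) +
        ∑' n : ℕ, if n ∈ {n : ℕ | Y < (n:ℝ)} then χ⁻¹ n * bumpF τ s (n * w) else 0 := by
      rw [← s1.tsum_add s2]
      congr 1; ext n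
      by_cases h : (n:ℝ) ≤ Y
      · simp [h, h.not_gt]
      · simp [h, not_le.1 h]
    rw [hsplit]
    refine (norm_add_le _ _).trans (add_le_add (p1.trans ?_) (p2.trans ?_))
    · rw [sub_self, zero_mul, add_zero, zero_pow two_ne_zero, Real.exp_zero, one_mul,
        ← integral_const_mul]
      apply integral_mono_of_nonneg (Eventually.of_forall fun v => by positivity)
        (hI1.const_mul _) (Eventually.of_forall fun v => ?_)
      simp only
      exact (mul_le_mul_of_nonneg_left (mul_le_mul_of_nonneg_right (g1 v) (norm_nonneg _))
        (Real.exp_pos _).le).trans_eq (by ring)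
    · rw [show ((1 / 2 - 3 / 2 : ℝ) ^ 2 + (1 / 2 - 3 / 2) * s) = 1 - s by ring,
        mul_assoc (Real.exp _) (_ * _) I2]
      refine mul_le_mul_of_nonneg_left ?_ (Real.exp_pos _).le
      rw [← integral_const_mul]
      apply integral_mono_of_nonneg (Eventually.of_forall fun v => by positivity)
        (hI2.const_mul _) (Eventually.of_forall fun v => ?_)
      simp only
      exact (mul_le_mul_of_nonneg_left (mul_le_mul_of_nonneg_right (g2 v) (norm_nonneg _))
        (Real.exp_pos _).le).trans_eq (by ring)
  have hsum : ∀ σ : ℤ, (σ = 1 ∨ σ = -1) →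
      Summable (fun n : ℕ => χ⁻¹ n * bumpF τ s (n * (σ * (1 / q)))) := by
    intro σ hσ
    have h := (summable_bumpF (q := q) τ s).norm.comp_injective (i := fun n : ℕ => σ * (n:ℤ)) (by
      intro a b h
      have : σ ≠ 0 := by rcases hσ with rfl | rfl <;> norm_num
      simpa [this] using h)
    refine Summable.of_norm_bounded h fun n => ?_
    rw [norm_mul]
    refine (mul_le_of_le_one_left (norm_nonneg _) (χ⁻¹.norm_le_one _)).trans (le_of_eq ?_)
    simp only [Function.comp]
    congr 2; push_cast; ring
  have m1 := main (1 / q) (by rw [abs_of_pos (by positivity)]) (by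
    simpa using hsum 1 (Or.inl rfl))
  have m2 := main (-(1 / q)) (by rw [abs_neg, abs_of_pos (by positivity)]) (by
    simpa using hsum (-1) (Or.inr rfl))
  rw [DS_eq' χ hχ hq1, norm_mul, norm_div, norm_gaussSum hχ, Complex.norm_natCast]
  have hsq : √(q:ℝ) * √q = q := Real.mul_self_sqrt hq.le
  calc _ ≤ √q / q * ((√q * I1 + Real.exp (1 - s) * (q * √q) * I2) +
        (√q * I1 + Real.exp (1 - s) * (q * √q) * I2)) := by
        refine mul_le_mul_of_nonneg_left ((norm_add_le _ _).trans (add_le_add m1 ?_))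
          (by positivity)
        rw [norm_mul, norm_char_neg_one, one_mul]; exact m2
    _ = (√q * √q) / q * (2 * I1 + 2 * Real.exp (1 - s) * q * I2) := by ring
    _ = _ := by rw [hsq, div_self hq.ne', one_mul]

end
end

section
open Set Filter Topology

lemma bump_nat (τ s : ℝ) (n : ℕ) : bump τ s n =
    ((if 0 < n then (n:ℝ) ^ (-(1 / 2) : ℝ) * W (Real.log n - s) else 0 : ℝ) : ℂ) * osc n τ := by
  rcases Nat.eq_zero_or_pos n with rfl | hn
  · simp [bump]
  · have hn' : (0:ℝ) < n := by exact_mod_cast hn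
    rw [bump, if_pos hn', if_pos hn, ker_nat, Real.rpow_def_of_pos hn']
    push_cast
    rw [show (-(Complex.log n) / 2) = Complex.log n * -(1 / 2) by ring]
    ring

lemma W_nonneg (u : ℝ) : 0 ≤ W u := (W_pos u).le

lemma norm_bump_nat (τ s : ℝ) (n : ℕ) : ‖bump τ s n‖ =
    if 0 < n then (n:ℝ) ^ (-(1 / 2) : ℝ) * W (Real.log n - s) else 0 := by
  rw [bump_nat, norm_mul, norm_osc, mul_one, Complex.norm_real, Real.norm_of_nonneg]
  split_ifs
  · have := W_nonneg (Real.log n - s); positivity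
  · exact le_rfl

lemma continuous_bump_nat (n : ℕ) : Continuous fun p : ℝ × ℝ => bump p.2 p.1 n := by
  rcases Nat.eq_zero_or_pos n with rfl | hn
  · simp only [bump_nat, lt_irrefl, if_false, Complex.ofReal_zero, zero_mul]; exact continuous_const
  · simp only [bump_nat, if_pos hn]
    have := continuous_W
    have := continuous_osc n
    fun_prop

section
variable {q : ℕ}

lemma measurable_DS (χ : DirichletCharacter ℂ q) : Measurable fun p : ℝ × ℝ => DS χ p.1 p.2 := by
  refine measurable_of_tendsto_metrizable (f := fun (N : ℕ) (p : ℝ × ℝ) =>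
    ∑ n ∈ Finset.range N, χ n * bump p.2 p.1 n) (fun N => ?_) ?_
  · exact Finset.measurable_fun_sum _ fun n _ =>
      (continuous_const.mul (continuous_bump_nat n)).measurable
  · rw [tendsto_pi_nhds]
    intro p
    exact (summable_DS χ p.1 p.2).hasSum.tendsto_sum_nat

lemma norm_DS_le_exp (χ : DirichletCharacter ℂ q) (s τ : ℝ) :
    ‖DS χ s τ‖ ≤ Real.exp (1 + s) * ∑' n : ℕ, (n:ℝ) ^ (-(3 / 2) : ℝ) := by
  have hs := Real.summable_nat_rpow.2 (by norm_num : (-(3/2) : ℝ) < -1)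
  refine tsum_of_norm_bounded (hs.hasSum.mul_left _) fun n => ?_
  rcases Nat.eq_zero_or_pos n with rfl | hn
  · simp [bump]
  · rw [norm_mul]
    refine (mul_le_of_le_one_left (norm_nonneg _) (χ.norm_le_one _)).trans ?_
    have := norm_bump_le_exp τ s (x := n) (by exact_mod_cast hn) 1
    rwa [one_pow, one_mul, show (-1 - 1 / 2 : ℝ) = -(3 / 2) by norm_num] at this

/-- Two-sided exponential decay of `DS` in `s`. -/
lemma exists_norm_DS_le [NeZero q] (χ : DirichletCharacter ℂ q) (hχ : χ.IsPrimitive) (hq1 : q ≠ 1) :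
    ∃ A : ℝ, 0 ≤ A ∧ ∀ s τ, ‖DS χ s τ‖ ≤ A * Real.exp (-|s|) * (1 + |τ|) := by
  set Z := ∑' n : ℕ, (n:ℝ) ^ (-(3 / 2) : ℝ)
  have hZ : 0 ≤ Z := tsum_nonneg fun n => by positivity
  set Z2 := ∑' n : ℕ, |tailCoef 0 n| with hZ2d
  have hZ2 : 0 ≤ Z2 := tsum_nonneg fun n => by positivity
  set J := ∫ v : ℝ, Real.exp (-v ^ 2) * (8 * (1 + |v|))
  have hJi : Integrable fun v : ℝ => Real.exp (-v ^ 2) * (8 * (1 + |v|)) := by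
    apply integrable_gauss_mul (Continuous.measurable (by fun_prop)) (C := 8) (N := 1)
    intro v; rw [abs_of_nonneg (by positivity), pow_one]
  have hJ : 0 ≤ J := integral_nonneg fun v => by positivity
  refine ⟨Real.exp 1 * Z + 2 * Real.exp 1 * q * (J * Z2), by positivity, fun s τ => ?_⟩
  rcases le_total s 0 with hs | hs
  · refine (norm_DS_le_exp χ s τ).trans ?_
    rw [Real.exp_add, abs_of_nonpos hs, neg_neg]
    have h1 : (0:ℝ) ≤ |τ| := abs_nonneg τ
    calc _ = (Real.exp 1 * Z) * Real.exp s * 1 := by ring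
      _ ≤ _ := by
        gcongr
        · have : 0 ≤ 2 * Real.exp 1 * q * (J * Z2) := by positivity
          linarith
        · linarith
  · refine (norm_DS_le χ hχ hq1 0 s τ).trans ?_
    have e1 : ∀ t, E χ (headCoef 0) t = 0 := by
      intro t
      have : headCoef 0 = fun _ => 0 := by
        ext n; unfold headCoef
        rcases Nat.eq_zero_or_pos n with rfl | hn
        · simp
        · rw [if_neg]; simp; omega
      simp [E, this]
    simp only [e1, norm_zero, mul_zero, integral_zero, zero_add]
    have h2 : (∫ v : ℝ, Real.exp (-v ^ 2) * ((1 + |2 * Real.pi * τ - v|) *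
        ‖E χ (tailCoef 0) (τ - v / (2 * Real.pi))‖)) ≤ J * ((1 + |τ|) * Z2) := by
      rw [← integral_mul_const]
      apply integral_mono_of_nonneg (Eventually.of_forall fun v => by positivity)
        (hJi.mul_const _) (Eventually.of_forall fun v => ?_)
      simp only
      rw [mul_assoc (Real.exp _)]
      refine mul_le_mul_of_nonneg_left ?_ (Real.exp_pos _).le
      rw [← mul_assoc]
      refine mul_le_mul ?_ (norm_E_le χ (summable_tailCoef 0) _) (norm_nonneg _) (by positivity)
      have h3 := abs_sub (2 * Real.pi * τ) v
      rw [abs_mul, abs_of_pos (by positivity : 0 < 2 * Real.pi)] at h3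
      nlinarith [abs_nonneg v, abs_nonneg τ, mul_nonneg (abs_nonneg v) (abs_nonneg τ),
        Real.pi_lt_d2]
    rw [abs_of_nonneg hs]
    calc _ ≤ 2 * Real.exp (1 - s) * q * (J * ((1 + |τ|) * Z2)) := by gcongr
      _ = (2 * Real.exp 1 * q * (J * Z2)) * Real.exp (-s) * (1 + |τ|) := by
        rw [sub_eq_add_neg, Real.exp_add]; ring
      _ ≤ _ := by
        gcongr
        have : 0 ≤ Real.exp 1 * Z := by positivity
        linarith

/-- The Mellin multiplier attached to a primitive character. -/
noncomputable def LL (χ : DirichletCharacter ℂ q) (τ : ℝ) : ℂ := ∫ s : ℝ, DS χ s τ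

lemma measurable_LL (χ : DirichletCharacter ℂ q) : Measurable (LL χ) := by
  have h : StronglyMeasurable fun p : ℝ × ℝ => DS χ p.2 p.1 :=
    ((measurable_DS χ).comp measurable_swap).stronglyMeasurable
  exact h.integral_prod_right.measurable

lemma integrable_exp_neg_abs : Integrable fun s : ℝ => Real.exp (-|s|) := by
  have h1 : IntegrableOn (fun s : ℝ => Real.exp (-|s|)) (Ioi 0) := by
    refine (integrableOn_exp_neg_Ioi 0).congr_fun (fun x hx => ?_) measurableSet_Ioi
    simp only [abs_of_pos (mem_Ioi.1 hx)]
  have h2 : IntegrableOn (fun s : ℝ => Real.exp (-|s|)) (Iic 0) := by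
    refine (integrableOn_exp_Iic 0).congr_fun (fun x hx => ?_) measurableSet_Iic
    simp only [abs_of_nonpos (mem_Iic.1 hx), neg_neg]
  rw [← integrableOn_univ, ← Iic_union_Ioi (a := (0:ℝ))]
  exact h2.union h1

lemma integrable_DS [NeZero q] (χ : DirichletCharacter ℂ q) (hχ : χ.IsPrimitive) (hq1 : q ≠ 1) (τ : ℝ) :
    Integrable fun s => DS χ s τ := by
  obtain ⟨A, hA, h⟩ := exists_norm_DS_le χ hχ hq1
  refine ((integrable_exp_neg_abs.const_mul A).mul_const (1 + |τ|)).mono' ?_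
    (Eventually.of_forall fun s => h s τ)
  exact ((measurable_DS χ).comp (measurable_id.prodMk measurable_const)).aestronglyMeasurable

lemma exists_norm_LL_le [NeZero q] (χ : DirichletCharacter ℂ q) (hχ : χ.IsPrimitive) (hq1 : q ≠ 1) :
    ∃ A : ℝ, 0 ≤ A ∧ ∀ τ, ‖LL χ τ‖ ≤ A * (1 + |τ|) := by
  obtain ⟨A, hA, h⟩ := exists_norm_DS_le χ hχ hq1
  refine ⟨A * ∫ s : ℝ, Real.exp (-|s|), mul_nonneg hA (integral_nonneg fun s => by positivity),
    fun τ => ?_⟩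
  refine (norm_integral_le_integral_norm _).trans ?_
  rw [← integral_const_mul, ← integral_mul_const]
  exact integral_mono (integrable_DS χ hχ hq1 τ).norm
    ((integrable_exp_neg_abs.const_mul A).mul_const (1 + |τ|)) (fun s => h s τ)

end
end

section
open Set Filter Topology

/-- Majorant for all coefficient sequences of effective length `Y`. -/
noncomputable def majCoef (Y : ℝ) (n : ℕ) : ℝ := (n:ℝ) ^ (-(1 / 2) : ℝ) * min 1 (Y / n)

/-- Coefficients of the unreflected part of the multiplier. -/
noncomputable def lowCoef (Y : ℝ) (n : ℕ) : ℝ :=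
  (n:ℝ) ^ (-(1 / 2) : ℝ) * ∫ s in Iic (Real.log Y), W (Real.log n - s)

lemma majCoef_nonneg {Y : ℝ} (hY : 0 ≤ Y) (n : ℕ) : 0 ≤ majCoef Y n := by
  unfold majCoef; positivity

lemma rpow_three_halves {n : ℕ} : (n:ℝ) ^ (-(3 / 2) : ℝ) = (n:ℝ) ^ (-(1 / 2) : ℝ) * (1 / n) := by
  rcases Nat.eq_zero_or_pos n with rfl | hn
  · norm_num
  · have hn' : (0:ℝ) < n := by exact_mod_cast hn
    rw [one_div (n:ℝ), show (-(3/2) : ℝ) = -(1/2) + -1 by norm_num, Real.rpow_add hn',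
      Real.rpow_neg_one]

lemma summable_majCoef {Y : ℝ} (hY : 0 ≤ Y) : Summable (majCoef Y) := by
  refine Summable.of_nonneg_of_le (majCoef_nonneg hY) (fun n => ?_)
    ((Real.summable_nat_rpow.2 (by norm_num : (-(3/2) : ℝ) < -1)).mul_left Y)
  rw [rpow_three_halves, majCoef, mul_left_comm]
  refine mul_le_mul_of_nonneg_left ((min_le_right _ _).trans_eq (by ring)) (by positivity)

lemma summable_of_le_maj {Y K : ℝ} (hY : 0 ≤ Y) {b : ℕ → ℝ} (h : ∀ n, |b n| ≤ K * majCoef Y n) :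
    Summable fun n => |b n| :=
  Summable.of_nonneg_of_le (fun _ => abs_nonneg _) h ((summable_majCoef hY).mul_left K)

lemma integrable_W_sub (a : ℝ) : Integrable fun s => W (a - s) := integrable_W.comp_sub_left a

lemma lowCoef_nonneg (Y : ℝ) (n : ℕ) : 0 ≤ lowCoef Y n :=
  mul_nonneg (by positivity) (integral_nonneg fun s => W_nonneg _)

lemma lowCoef_le {Y : ℝ} (hY : 0 < Y) (n : ℕ) : |lowCoef Y n| ≤ 3 * majCoef Y n := by
  rw [abs_of_nonneg (lowCoef_nonneg Y n), lowCoef, majCoef, mul_left_comm]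
  rcases Nat.eq_zero_or_pos n with rfl | hn
  · norm_num
  have hn' : (0:ℝ) < n := by exact_mod_cast hn
  refine mul_le_mul_of_nonneg_left ?_ (by positivity)
  have h1 : ∫ s in Iic (Real.log Y), W (Real.log n - s) ≤ 1 := by
    refine (setIntegral_le_integral (integrable_W_sub _)
      (Eventually.of_forall fun s => W_nonneg _)).trans (le_of_eq ?_)
    rw [integral_sub_left_eq_self (fun s => W s) volume, integral_W]
  have h2 : ∫ s in Iic (Real.log Y), W (Real.log n - s) ≤ 3 * (Y / n) := by
    have h3 : ∫ s in Iic (Real.log Y), W (Real.log n - s) ≤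
        ∫ s in Iic (Real.log Y), Real.exp 1 / n * Real.exp s := by
      refine setIntegral_mono (integrable_W_sub _).integrableOn
        ((integrableOn_exp_Iic _).const_mul _) fun s => ?_
      refine (W_le 1 _).trans (le_of_eq ?_)
      rw [show (1:ℝ) ^ 2 - 1 * (Real.log n - s) = 1 + s - Real.log n by ring, Real.exp_sub,
        Real.exp_add, Real.exp_log hn']
      ring
    refine h3.trans ?_
    rw [integral_const_mul, integral_exp_Iic, Real.exp_log hY]
    have := Real.exp_one_lt_d9
    calc Real.exp 1 / n * Y = Real.exp 1 * (Y / n) := by ring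
      _ ≤ _ := by gcongr; linarith
  rcases min_cases (1:ℝ) (Y / n) with ⟨h, _⟩ | ⟨h, _⟩ <;> rw [h] <;> linarith

lemma headCoef_le {Y : ℝ} (hY : 0 ≤ Y) (n : ℕ) : |headCoef Y n| ≤ 1 * majCoef Y n := by
  rw [abs_of_nonneg (headCoef_nonneg Y n), headCoef, majCoef, one_mul]
  rcases Nat.eq_zero_or_pos n with rfl | hn
  · norm_num
  have hn' : (0:ℝ) < n := by exact_mod_cast hn
  split_ifs with h
  · rw [min_eq_left ((one_le_div hn').2 h), mul_one]
  · positivity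

lemma tailCoef_le {Y : ℝ} (hY : 0 ≤ Y) (n : ℕ) : |Y * tailCoef Y n| ≤ 1 * majCoef Y n := by
  rw [abs_of_nonneg (mul_nonneg hY (tailCoef_nonneg Y n)), tailCoef, one_mul]
  split_ifs with h
  · have hn' : (0:ℝ) < n := hY.trans_lt h
    rw [rpow_three_halves, majCoef, min_eq_right ((div_le_one hn').2 h.le)]
    apply le_of_eq; ring
  · rw [mul_zero]; exact majCoef_nonneg hY n

lemma tailCoef_zero_le {Y : ℝ} (hY : 1 ≤ Y) (n : ℕ) : |tailCoef 0 n| ≤ 1 * majCoef Y n := by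
  rw [abs_of_nonneg (tailCoef_nonneg 0 n), tailCoef, one_mul]
  split_ifs with h
  · rw [rpow_three_halves, majCoef]
    have h1 : (1:ℝ) ≤ n := by
      have : 0 < n := by exact_mod_cast h
      exact_mod_cast this
    refine mul_le_mul_of_nonneg_left (le_min ?_ ?_) (by positivity)
    · rw [div_le_one h]; exact h1
    · gcongr
  · exact majCoef_nonneg (by linarith) n

section
variable {q : ℕ}

lemma setIntegral_DS_low (χ : DirichletCharacter ℂ q) {Y : ℝ} (hY : 0 < Y) (τ : ℝ) :
    ∫ s in Iic (Real.log Y), DS χ s τ = E χ (lowCoef Y) τ := by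
  let F : ℕ → ℝ → ℂ := fun n s => χ n * bump τ s n
  have hFn : ∀ n s, ‖F n s‖ ≤ (n:ℝ) ^ (-(1 / 2) : ℝ) * W (Real.log n - s) := by
    intro n s
    simp only [F]
    rw [norm_mul, norm_bump_nat]
    refine (mul_le_of_le_one_left ?_ (χ.norm_le_one _)).trans ?_
    all_goals
      have := W_nonneg (Real.log n - s)
      split_ifs
      · first | positivity | exact le_rfl
      · positivity
  have hi : ∀ n : ℕ, IntegrableOn (fun s => (n:ℝ) ^ (-(1 / 2) : ℝ) * W (Real.log n - s))
      (Iic (Real.log Y)) := fun n => ((integrable_W_sub _).const_mul _).integrableOn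
  have hF : ∀ n, Integrable (F n) (volume.restrict (Iic (Real.log Y))) := by
    intro n
    refine (hi n).mono' ?_ (Eventually.of_forall (hFn n))
    exact (continuous_const.mul ((continuous_bump_nat n).comp (by fun_prop :
      Continuous fun s : ℝ => (s, τ)))).aestronglyMeasurable
  have hs : Summable fun n => ∫ s in Iic (Real.log Y), ‖F n s‖ := by
    refine Summable.of_nonneg_of_le (fun n => integral_nonneg fun s => norm_nonneg _) (fun n => ?_)
      (summable_of_le_maj hY.le (lowCoef_le hY))
    rw [abs_of_nonneg (lowCoef_nonneg Y n), lowCoef, ← integral_const_mul]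
    exact integral_mono (hF n).norm (hi n) (hFn n)
  have h := hasSum_integral_of_summable_integral_norm hF hs
  have h2 : ∫ s in Iic (Real.log Y), DS χ s τ = ∫ s in Iic (Real.log Y), ∑' n, F n s := rfl
  rw [h2, ← h.tsum_eq, E]
  congr 1; ext n
  simp only [F, bump_nat]
  rcases Nat.eq_zero_or_pos n with rfl | hn
  · simp [lowCoef]
  · simp only [if_pos hn, Complex.ofReal_mul, lowCoef]
    rw [integral_const_mul, integral_mul_const, integral_const_mul, integral_complex_ofReal]
    ring

/-- Weighted absolute value of a Dirichlet series. -/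
noncomputable def G (T : ℝ) (χ : DirichletCharacter ℂ q) (b : ℕ → ℝ) (τ : ℝ) : ℝ :=
  (1 + |τ| / T) * ‖E χ b τ‖

lemma G_nonneg {T : ℝ} (hT : 0 ≤ T) (χ : DirichletCharacter ℂ q) (b : ℕ → ℝ) (τ : ℝ) :
    0 ≤ G T χ b τ := by unfold G; positivity

/-- Gaussian average. -/
noncomputable def gav (f : ℝ → ℝ) (τ : ℝ) : ℝ :=
  ∫ v : ℝ, Real.exp (-v ^ 2) * f (τ - v / (2 * Real.pi))

lemma gav_nonneg {f : ℝ → ℝ} (hf : ∀ x, 0 ≤ f x) (τ : ℝ) : 0 ≤ gav f τ :=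
  integral_nonneg fun _ => mul_nonneg (Real.exp_pos _).le (hf _)

lemma one_add_shift_le {T : ℝ} (hT : 1 ≤ T) (τ v : ℝ) :
    1 + |τ - v / (2 * Real.pi)| / T ≤ (1 + |τ| / T) * (1 + |v|) := by
  have h1 : |τ - v / (2 * Real.pi)| ≤ |τ| + |v| := by
    refine (abs_sub _ _).trans ?_
    rw [abs_div, abs_of_pos (by positivity : 0 < 2 * Real.pi)]
    gcongr
    exact div_le_self (abs_nonneg _) (by linarith [Real.pi_gt_three])
  have h2 : |τ - v / (2 * Real.pi)| / T ≤ |τ| / T + |v| := by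
    calc _ ≤ (|τ| + |v|) / T := by gcongr
      _ = |τ| / T + |v| / T := by ring
      _ ≤ _ := by gcongr; exact div_le_self (abs_nonneg _) hT
  have h3 : 0 ≤ |τ| / T * |v| := by positivity
  linarith

lemma continuous_G {T : ℝ} (χ : DirichletCharacter ℂ q) {b : ℕ → ℝ}
    (hb : Summable fun n => |b n|) : Continuous (G T χ b) := by
  have := continuous_E χ hb
  unfold G; fun_prop

lemma integrable_gav_G {T : ℝ} (hT : 1 ≤ T) (χ : DirichletCharacter ℂ q) {b : ℕ → ℝ}
    (hb : Summable fun n => |b n|) (p : ℕ) (τ : ℝ) :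
    Integrable fun v => Real.exp (-v ^ 2) * G T χ b (τ - v / (2 * Real.pi)) ^ p := by
  have hc := continuous_G (T := T) χ hb
  apply integrable_gauss_mul (Continuous.measurable (by fun_prop))
    (C := ((1 + |τ| / T) * ∑' n, |b n|) ^ p) (N := p)
  intro v
  have hG := G_nonneg (by linarith : 0 ≤ T) χ b (τ - v / (2 * Real.pi))
  rw [abs_of_nonneg (by positivity), ← mul_pow]
  refine pow_le_pow_left₀ hG ?_ _
  rw [G]
  exact (mul_le_mul (one_add_shift_le hT τ v) (norm_E_le χ hb _) (norm_nonneg _)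
    (by positivity)).trans_eq (by ring)

end
end

section
open Set Filter Topology

lemma setIntegral_exp_neg_Ioi (a : ℝ) : ∫ s in Ioi a, Real.exp (-s) = Real.exp (-a) :=
  integral_exp_neg_Ioi a

section
variable {q : ℕ}

lemma reflected_le_gav {T : ℝ} (hT : 1 ≤ T) (χ : DirichletCharacter ℂ q) {b : ℕ → ℝ}
    (hb : Summable fun n => |b n|) (τ : ℝ) :
    T⁻¹ * ∫ v : ℝ, Real.exp (-v ^ 2) *
      ((1 + |2 * Real.pi * τ - v|) * ‖E χ b (τ - v / (2 * Real.pi))‖) ≤ 7 * gav (G T χ b) τ := by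
  have hT0 : 0 < T := by linarith
  rw [gav, ← integral_const_mul, ← integral_const_mul]
  have hi := integrable_gav_G hT χ hb 1 τ
  simp only [pow_one] at hi
  apply integral_mono_of_nonneg (Eventually.of_forall fun v => by positivity)
    (hi.const_mul _) (Eventually.of_forall fun v => ?_)
  simp only [G]
  have h1 : T⁻¹ * (1 + |2 * Real.pi * τ - v|) ≤ 7 * (1 + |τ - v / (2 * Real.pi)| / T) := by
    have e : 2 * Real.pi * τ - v = 2 * Real.pi * (τ - v / (2 * Real.pi)) := by
      field_simp
    rw [e, abs_mul, abs_of_pos (by positivity : 0 < 2 * Real.pi)]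
    have h2 : T⁻¹ ≤ 1 := inv_le_one_of_one_le₀ hT
    have h3 : 0 ≤ |τ - v / (2 * Real.pi)| / T := by positivity
    have h4 : T⁻¹ * (1 + 2 * Real.pi * |τ - v / (2 * Real.pi)|) =
      T⁻¹ + 2 * Real.pi * (|τ - v / (2 * Real.pi)| / T) := by ring
    rw [h4]
    nlinarith [Real.pi_lt_d2]
  calc _ = Real.exp (-v ^ 2) * ((T⁻¹ * (1 + |2 * Real.pi * τ - v|)) *
        ‖E χ b (τ - v / (2 * Real.pi))‖) := by ring
    _ ≤ Real.exp (-v ^ 2) * ((7 * (1 + |τ - v / (2 * Real.pi)| / T)) *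
        ‖E χ b (τ - v / (2 * Real.pi))‖) := by gcongr
    _ = _ := by ring

/-- Approximate functional equation, as an upper bound. -/
lemma norm_LL_le [NeZero q] (χ : DirichletCharacter ℂ q) (hχ : χ.IsPrimitive) (hq1 : q ≠ 1) {T : ℝ}
    (hT : 1 ≤ T) (τ : ℝ) :
    ‖LL χ τ‖ ≤ 50 * (1 + Real.log (q * T)) * (G T χ (lowCoef √(q * T)) τ +
      gav (G T χ (headCoef √(q * T))) τ +
      gav (G T χ (fun n => √(q * T) * tailCoef √(q * T) n)) τ + gav (G T χ (tailCoef 0)) τ) := by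
  have hq : (1:ℝ) ≤ q := by exact_mod_cast Nat.pos_of_ne_zero (NeZero.ne q)
  have hqT : 1 ≤ q * T := by nlinarith
  set Y := √(q * T) with hYdef
  have hY : 1 ≤ Y := Real.one_le_sqrt.2 hqT
  have hY0 : 0 < Y := by linarith
  have hYY : Y * Y = q * T := Real.mul_self_sqrt (by linarith)
  set S := Real.log Y with hSdef
  have hS0 : 0 ≤ S := Real.log_nonneg hY
  have hS1 : 2 * S = Real.log (q * T) := by
    rw [← hYY, Real.log_mul hY0.ne' hY0.ne', two_mul]
  have hExpS : Real.exp (-S) = Y⁻¹ := by rw [Real.exp_neg, Real.exp_log hY0]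
  have hDi := integrable_DS χ hχ hq1 τ
  have hsplit : LL χ τ = (∫ s in Iic S, DS χ s τ) + ((∫ s in Ioc S (2 * S), DS χ s τ) +
      ∫ s in Ioi (2 * S), DS χ s τ) := by
    rw [← setIntegral_union (by
      rw [Set.disjoint_left]; intro x hx; simp only [mem_Ioc, mem_Ioi, not_lt] at hx ⊢
      exact hx.2) measurableSet_Ioi hDi.integrableOn hDi.integrableOn,
      Ioc_union_Ioi_eq_Ioi (by linarith), intervalIntegral.integral_Iic_add_Ioi
        hDi.integrableOn hDi.integrableOn, LL]
  set J1 := ∫ v : ℝ, Real.exp (-v ^ 2) * ‖E χ (headCoef Y) (τ - v / (2 * Real.pi))‖ with hJ1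
  set J2 := ∫ v : ℝ, Real.exp (-v ^ 2) *
        ((1 + |2 * Real.pi * τ - v|) * ‖E χ (tailCoef Y) (τ - v / (2 * Real.pi))‖) with hJ2
  set J3 := ∫ v : ℝ, Real.exp (-v ^ 2) *
        ((1 + |2 * Real.pi * τ - v|) * ‖E χ (tailCoef 0) (τ - v / (2 * Real.pi))‖) with hJ3
  have hJ1n : 0 ≤ J1 := integral_nonneg fun v => by positivity
  have hJ2n : 0 ≤ J2 := integral_nonneg fun v => by positivity
  have hJ3n : 0 ≤ J3 := integral_nonneg fun v => by positivity
  have hmid : ‖∫ s in Ioc S (2 * S), DS χ s τ‖ ≤ S * (2 * J1) +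
      2 * Real.exp 1 * q * J2 * Real.exp (-S) := by
    have hi1 : IntegrableOn (fun _ : ℝ => 2 * J1) (Ioc S (2 * S)) :=
      continuous_const.integrableOn_Ioc
    have hi2 : IntegrableOn (fun s : ℝ => 2 * Real.exp 1 * q * J2 * Real.exp (-s)) (Ioi S) :=
      (integrableOn_exp_neg_Ioi S).const_mul _
    have hi2' := hi2.mono_set (Ioc_subset_Ioi_self : Ioc S (2 * S) ⊆ Ioi S)
    calc _ ≤ ∫ s in Ioc S (2 * S), ‖DS χ s τ‖ := norm_integral_le_integral_norm _
      _ ≤ ∫ s in Ioc S (2 * S), (2 * J1 + 2 * Real.exp 1 * q * J2 * Real.exp (-s)) := by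
        refine integral_mono hDi.norm.integrableOn (hi1.add hi2') fun s => ?_
        refine (norm_DS_le χ hχ hq1 Y s τ).trans (le_of_eq ?_)
        rw [sub_eq_add_neg, Real.exp_add]; ring
      _ = S * (2 * J1) + ∫ s in Ioc S (2 * S), 2 * Real.exp 1 * q * J2 * Real.exp (-s) := by
        rw [integral_add hi1 hi2', setIntegral_const, Real.volume_real_Ioc, smul_eq_mul,
          max_eq_left (by linarith)]
        congr 2; ring
      _ ≤ S * (2 * J1) + ∫ s in Ioi S, 2 * Real.exp 1 * q * J2 * Real.exp (-s) := by
        exact add_le_add le_rfl (setIntegral_mono_set hi2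
          (Eventually.of_forall fun s => by positivity)
          (LE.le.eventuallyLE (Ioc_subset_Ioi_self : Ioc S (2 * S) ⊆ Ioi S)))
      _ = _ := by rw [integral_const_mul, setIntegral_exp_neg_Ioi]
  have hhigh : ‖∫ s in Ioi (2 * S), DS χ s τ‖ ≤
      2 * Real.exp 1 * q * J3 * Real.exp (-(2 * S)) := by
    have hi2 : IntegrableOn (fun s : ℝ => 2 * Real.exp 1 * q * J3 * Real.exp (-s)) (Ioi (2 * S)) :=
      (integrableOn_exp_neg_Ioi (2 * S)).const_mul _
    rw [← setIntegral_exp_neg_Ioi, ← integral_const_mul]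
    refine (norm_integral_le_integral_norm _).trans ?_
    refine integral_mono hDi.norm.integrableOn hi2 fun s => ?_
    refine (norm_DS_le χ hχ hq1 0 s τ).trans (le_of_eq ?_)
    have e1 : ∀ t, E χ (headCoef 0) t = 0 := by
      intro t
      have : headCoef 0 = fun _ => 0 := by
        ext n; unfold headCoef
        rcases Nat.eq_zero_or_pos n with rfl | hn
        · simp
        · rw [if_neg]; simp; omega
      simp [E, this]
    simp only [e1, norm_zero, mul_zero, integral_zero, zero_add]
    rw [sub_eq_add_neg, Real.exp_add]; ring
  have g0 : ‖∫ s in Iic S, DS χ s τ‖ ≤ G T χ (lowCoef Y) τ := by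
    rw [setIntegral_DS_low χ hY0, G]
    exact le_mul_of_one_le_left (norm_nonneg _) (by
      have : 0 ≤ |τ| / T := by positivity
      linarith)
  have g1 : J1 ≤ gav (G T χ (headCoef Y)) τ := by
    have hi := integrable_gav_G hT χ (summable_headCoef Y) 1 τ
    simp only [pow_one] at hi
    apply integral_mono_of_nonneg (Eventually.of_forall fun v => by positivity)
      hi (Eventually.of_forall fun v => ?_)
    simp only [G]
    refine mul_le_mul_of_nonneg_left ?_ (by positivity)
    exact le_mul_of_one_le_left (norm_nonneg _) (by
      have : 0 ≤ |τ - v / (2 * Real.pi)| / T := by positivity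
      linarith)
  have g2 : q * J2 * Real.exp (-S) ≤ 7 * gav (G T χ (fun n => Y * tailCoef Y n)) τ := by
    refine le_trans (le_of_eq ?_) (reflected_le_gav hT χ
      (summable_of_le_maj hY0.le (tailCoef_le hY0.le)) τ)
    have hE : ∀ t, ‖E χ (fun n => Y * tailCoef Y n) t‖ = Y * ‖E χ (tailCoef Y) t‖ := by
      intro t
      rw [← abs_of_pos hY0, ← Real.norm_eq_abs, ← Complex.norm_real Y, ← norm_mul]
      congr 1
      simp only [E, ← tsum_mul_left]
      congr 1; ext n
      rw [Complex.norm_real, Real.norm_eq_abs, abs_of_pos hY0]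
      push_cast; ring
    simp only [hE]
    have : ∀ v, Real.exp (-v ^ 2) * ((1 + |2 * Real.pi * τ - v|) *
        (Y * ‖E χ (tailCoef Y) (τ - v / (2 * Real.pi))‖)) =
        Y * (Real.exp (-v ^ 2) * ((1 + |2 * Real.pi * τ - v|) *
        ‖E χ (tailCoef Y) (τ - v / (2 * Real.pi))‖)) := fun v => by ring
    simp only [this]
    rw [integral_const_mul, ← hJ2, hExpS]
    have : T ≠ 0 := by linarith
    field_simp
    nlinarith [hYY]
  have g3 : q * J3 * Real.exp (-(2 * S)) ≤ 7 * gav (G T χ (tailCoef 0)) τ := by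
    refine le_trans (le_of_eq ?_) (reflected_le_gav hT χ (summable_tailCoef 0) τ)
    rw [hS1, Real.exp_neg, Real.exp_log (by linarith), ← hJ3]
    have : T ≠ 0 := by linarith
    have : (q:ℝ) ≠ 0 := by linarith
    field_simp
  have n0 := G_nonneg (by linarith : 0 ≤ T) χ (lowCoef Y) τ
  have n1 := gav_nonneg (G_nonneg (by linarith : 0 ≤ T) χ (headCoef Y)) τ
  have n2 := gav_nonneg (G_nonneg (by linarith : 0 ≤ T) χ (fun n => Y * tailCoef Y n)) τ
  have n3 := gav_nonneg (G_nonneg (by linarith : 0 ≤ T) χ (tailCoef 0)) τ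
  have hexp := Real.exp_one_lt_d9
  rw [hsplit, ← hS1]
  generalize G T χ (lowCoef Y) τ = a0 at *
  generalize gav (G T χ (headCoef Y)) τ = a1 at *
  generalize gav (G T χ (fun n => Y * tailCoef Y n)) τ = a2 at *
  generalize gav (G T χ (tailCoef 0)) τ = a3 at *
  have t1 : S * (2 * J1) ≤ 2 * (S * a1) := by nlinarith
  have t2 : 2 * Real.exp 1 * q * J2 * Real.exp (-S) ≤ 42 * a2 := by
    have : 2 * Real.exp 1 * q * J2 * Real.exp (-S) = 2 * Real.exp 1 * (q * J2 * Real.exp (-S)) := by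
      ring
    rw [this]
    have := Real.exp_pos 1
    nlinarith
  have t3 : 2 * Real.exp 1 * q * J3 * Real.exp (-(2 * S)) ≤ 42 * a3 := by
    have : 2 * Real.exp 1 * q * J3 * Real.exp (-(2 * S)) =
      2 * Real.exp 1 * (q * J3 * Real.exp (-(2 * S))) := by ring
    rw [this]
    have := Real.exp_pos 1
    nlinarith
  have tri := (norm_add_le (∫ s in Iic S, DS χ s τ) ((∫ s in Ioc S (2 * S), DS χ s τ) +
      ∫ s in Ioi (2 * S), DS χ s τ)).trans (add_le_add le_rfl (norm_add_le _ _))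
  have p0 : 0 ≤ S * a0 := by positivity
  have p1 : 0 ≤ S * a1 := by positivity
  have p2 : 0 ≤ S * a2 := by positivity
  have p3 : 0 ≤ S * a3 := by positivity
  nlinarith

end
end

section

lemma succ_le_const_mul_rpow {ε : ℝ} (hε : 0 < ε) {p : ℕ} (hp : 2 ≤ p) (e : ℕ) :
    ((e + 1 : ℕ) : ℝ) ≤ (1 + 1 / (ε * Real.log 2)) * (p : ℝ) ^ (ε * e) := by
  have hl : 0 < Real.log 2 := Real.log_pos (by norm_num)
  have h1 : (2:ℝ) ^ (ε * e) ≤ (p : ℝ) ^ (ε * e) :=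
    Real.rpow_le_rpow (by norm_num) (by exact_mod_cast hp) (by positivity)
  have h2 : 1 + ε * e * Real.log 2 ≤ (2:ℝ) ^ (ε * e) := by
    rw [Real.rpow_def_of_pos (by norm_num)]
    have := Real.add_one_le_exp (Real.log 2 * (ε * e)); linarith
  have h3 : (1 + 1 / (ε * Real.log 2)) * (1 + ε * e * Real.log 2) =
    1 + ε * e * Real.log 2 + 1 / (ε * Real.log 2) + e := by field_simp; ring
  have : 0 < ε * Real.log 2 := by positivity
  have h4 : 0 ≤ ε * e * Real.log 2 + 1 / (ε * Real.log 2) := by positivity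
  calc ((e + 1 : ℕ) : ℝ) ≤ (1 + 1 / (ε * Real.log 2)) * (1 + ε * e * Real.log 2) := by
        rw [h3]; push_cast; linarith
    _ ≤ _ := by gcongr; exact h2.trans h1

lemma succ_le_rpow {ε : ℝ} (hε : 0 < ε) {p : ℕ} (hp : (2:ℝ) ^ (1 / ε) ≤ p) (e : ℕ) :
    ((e + 1 : ℕ) : ℝ) ≤ (p : ℝ) ^ (ε * e) := by
  have h1 : (2:ℝ) ≤ (p:ℝ) ^ ε := by
    calc (2:ℝ) = ((2:ℝ) ^ (1 / ε)) ^ ε := by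
          rw [← Real.rpow_mul (by norm_num), one_div_mul_cancel hε.ne', Real.rpow_one]
      _ ≤ _ := Real.rpow_le_rpow (by positivity) hp hε.le
  rw [Real.rpow_mul (by positivity), Real.rpow_natCast]
  calc ((e + 1 : ℕ) : ℝ) ≤ (2:ℝ) ^ e := by exact_mod_cast Nat.lt_two_pow_self (n := e)
    _ ≤ _ := by gcongr

lemma exists_card_divisors_le {ε : ℝ} (hε : 0 < ε) :
    ∃ C : ℝ, 1 ≤ C ∧ ∀ n : ℕ, n ≠ 0 → (n.divisors.card : ℝ) ≤ C * (n:ℝ) ^ ε := by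
  set K : ℝ := 1 + 1 / (ε * Real.log 2) with hK
  have hl : 0 < Real.log 2 := Real.log_pos (by norm_num)
  have hK1 : 1 ≤ K := by
    have : 0 ≤ 1 / (ε * Real.log 2) := by positivity
    linarith
  set P : ℕ := ⌈(2:ℝ) ^ (1 / ε)⌉₊
  refine ⟨K ^ P, one_le_pow₀ hK1, fun n hn => ?_⟩
  have hfac : (n:ℝ) ^ ε = ∏ p ∈ n.primeFactors, (p:ℝ) ^ (ε * n.factorization p) := by
    conv_lhs => rw [← Nat.prod_factorization_pow_eq_self hn]
    rw [Finsupp.prod, Nat.support_factorization]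
    push_cast
    rw [← Real.finsetProd_rpow _ _ (fun p _ => by positivity)]
    refine Finset.prod_congr rfl fun p _ => ?_
    rw [← Real.rpow_natCast, ← Real.rpow_mul (by positivity), mul_comm]
  rw [Nat.card_divisors hn, hfac]
  push_cast
  have h1 : ∀ p ∈ n.primeFactors, ((n.factorization p : ℝ) + 1) ≤
      (if p < P then K else 1) * (p:ℝ) ^ (ε * n.factorization p) := by
    intro p hp
    have hpp := Nat.prime_of_mem_primeFactors hp
    split_ifs with h
    · exact_mod_cast succ_le_const_mul_rpow hε hpp.two_le _
    · rw [one_mul]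
      exact_mod_cast succ_le_rpow hε (Nat.ceil_le.1 (not_lt.1 h)) _
  refine (Finset.prod_le_prod (fun p _ => by positivity) h1).trans ?_
  rw [Finset.prod_mul_distrib]
  refine mul_le_mul_of_nonneg_right ?_ (Finset.prod_nonneg fun p _ => by positivity)
  rw [← Finset.prod_filter, Finset.prod_const]
  refine pow_le_pow_right₀ hK1 ?_
  calc _ ≤ (Finset.range P).card := Finset.card_le_card fun p hp => by
        rw [Finset.mem_range]; exact (Finset.mem_filter.1 hp).2
    _ = P := Finset.card_range P

lemma card_divisors_dvd_le {a b : ℕ} (h : a ∣ b) (hb : b ≠ 0) :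
    a.divisors.card ≤ b.divisors.card :=
  Finset.card_le_card (Nat.divisors_subset_of_dvd hb h)

end

section
open Set Filter Topology FourierTransform

lemma integrable_exp_neg_mul_abs {c : ℝ} (hc : 0 < c) :
    Integrable fun x : ℝ => Real.exp (-(c * |x|)) := by
  have h := integrable_exp_neg_abs.comp_mul_left' hc.ne'
  refine h.congr (ae_of_all _ fun x => ?_)
  simp [abs_mul, abs_of_pos hc]

lemma inner_real_eq (x y : ℝ) : inner ℝ x y = y * x := rfl

lemma fourier_exp_neg_abs (ξ : ℝ) :
    𝓕 (fun x : ℝ => ((Real.exp (-(2 * Real.pi * |x|)) : ℝ) : ℂ)) ξ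
      = ((1 / Real.pi * (1 + ξ ^ 2)⁻¹ : ℝ) : ℂ) := by
  have hinteg : Integrable fun x : ℝ => cexp (((-2 * Real.pi * inner ℝ x ξ : ℝ) : ℂ) * I) •
      ((Real.exp (-(2 * Real.pi * |x|)) : ℝ) : ℂ) := by
    refine (integrable_exp_neg_mul_abs (c := 2 * Real.pi) (by positivity)).mono'
      (by fun_prop) (ae_of_all _ fun x => ?_)
    rw [norm_smul, Complex.norm_exp_ofReal_mul_I, one_mul, Complex.norm_real, Real.norm_eq_abs,
      abs_of_pos (Real.exp_pos _)]
  have hpi : (Real.pi : ℂ) ≠ 0 := by exact_mod_cast Real.pi_ne_zero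
  have h1 : (1 + (ξ:ℂ) * I) ≠ 0 := fun h => by simpa using congrArg Complex.re h
  have h2 : (1 - (ξ:ℂ) * I) ≠ 0 := fun h => by simpa using congrArg Complex.re h
  have h3 : (1 + (ξ:ℂ) ^ 2) ≠ 0 := by
    have : (1 + (ξ:ℂ)^2) = (1 + (ξ:ℂ) * I) * (1 - (ξ:ℂ) * I) := by ring_nf; rw [I_sq]; ring
    rw [this]; exact mul_ne_zero h1 h2
  rw [Real.fourier_eq', ← intervalIntegral.integral_Iic_add_Ioi (b := 0) hinteg.integrableOn
    hinteg.integrableOn]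
  have e1 : ∫ x in Iic (0:ℝ), cexp (((-2 * Real.pi * inner ℝ x ξ : ℝ) : ℂ) * I) •
      ((Real.exp (-(2 * Real.pi * |x|)) : ℝ) : ℂ)
      = ∫ x in Iic (0:ℝ), cexp ((2 * Real.pi * (1 - ξ * I)) * x) := by
    refine setIntegral_congr_fun measurableSet_Iic fun x hx => ?_
    simp only [smul_eq_mul, Complex.ofReal_exp]
    rw [← Complex.exp_add, abs_of_nonpos hx]
    congr 1
    rw [inner_real_eq]; push_cast; ring
  have e2 : ∫ x in Ioi (0:ℝ), cexp (((-2 * Real.pi * inner ℝ x ξ : ℝ) : ℂ) * I) •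
      ((Real.exp (-(2 * Real.pi * |x|)) : ℝ) : ℂ)
      = ∫ x in Ioi (0:ℝ), cexp ((-(2 * Real.pi * (1 + ξ * I))) * x) := by
    refine setIntegral_congr_fun measurableSet_Ioi fun x hx => ?_
    simp only [smul_eq_mul, Complex.ofReal_exp]
    rw [← Complex.exp_add, abs_of_pos hx]
    congr 1
    rw [inner_real_eq]; push_cast; ring
  rw [e1, e2, integral_exp_mul_complex_Iic (by simp [Real.pi_pos]),
    integral_exp_mul_complex_Ioi (by simp [Real.pi_pos])]
  push_cast
  simp only [mul_zero, Complex.exp_zero]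
  field_simp
  ring_nf; rw [I_sq]; ring

/-- The Poisson kernel as the Fourier transform of the Cauchy kernel. -/
lemma integral_cauchy_mul_exp (L : ℝ) :
    ∫ x : ℝ, ((1 + x ^ 2)⁻¹ : ℝ) * cexp (2 * Real.pi * x * L * I)
      = (Real.pi * Real.exp (-(2 * Real.pi * |L|)) : ℝ) := by
  have hf : 𝓕 (fun x : ℝ => ((Real.exp (-(2 * Real.pi * |x|)) : ℝ) : ℂ)) =
      fun ξ : ℝ => ((1 / Real.pi * (1 + ξ ^ 2)⁻¹ : ℝ) : ℂ) := funext fourier_exp_neg_abs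
  have h := Continuous.fourierInv_fourier_eq (f := fun x : ℝ =>
    ((Real.exp (-(2 * Real.pi * |x|)) : ℝ) : ℂ)) (by fun_prop)
    (integrable_exp_neg_mul_abs (by positivity)).ofReal
    (by rw [hf]; exact (integrable_inv_one_add_sq.const_mul _).ofReal)
  have h' := congrFun h L
  rw [hf, Real.fourierInv_eq'] at h'
  rw [Complex.ofReal_mul, ← h', ← integral_const_mul]
  congr 1; ext x
  have hpi : (Real.pi : ℂ) ≠ 0 := by exact_mod_cast Real.pi_ne_zero
  simp only [inner_real_eq, smul_eq_mul]
  push_cast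
  rw [show (2 * Real.pi * (L * x) * I : ℂ) = 2 * Real.pi * x * L * I by ring]
  field_simp

/-- The Cauchy weight at scale `T`. -/
noncomputable def cw (T τ : ℝ) : ℝ := (1 + (τ / T) ^ 2)⁻¹

lemma cw_pos (T τ : ℝ) : 0 < cw T τ := by unfold cw; positivity

lemma cw_le_one (T τ : ℝ) : cw T τ ≤ 1 := by
  unfold cw; exact inv_le_one_of_one_le₀ (by nlinarith [sq_nonneg (τ / T)])

lemma continuous_cw (T : ℝ) : Continuous (cw T) := by
  unfold cw
  exact Continuous.inv₀ (by fun_prop) fun x => by positivity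

lemma integrable_cw {T : ℝ} (hT : 0 < T) : Integrable (cw T) := by
  have := integrable_inv_one_add_sq.comp_div hT.ne'
  exact this

lemma integral_cw_mul_exp {T : ℝ} (hT : 0 < T) (L : ℝ) :
    ∫ τ : ℝ, (cw T τ : ℂ) * cexp (2 * Real.pi * τ * L * I)
      = (Real.pi * T * Real.exp (-(2 * Real.pi * T * |L|)) : ℝ) := by
  have h := integral_cauchy_mul_exp (T * L)
  have h2 := Measure.integral_comp_div (fun x : ℝ => (((1 + x ^ 2)⁻¹ : ℝ) : ℂ) *
    cexp (2 * Real.pi * x * (T * L : ℝ) * I)) T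
  rw [h, abs_of_pos hT] at h2
  have hTc : (T : ℂ) ≠ 0 := by exact_mod_cast hT.ne'
  refine Eq.trans ?_ (h2.trans ?_)
  rotate_left
  · rw [abs_mul, abs_of_pos hT, real_smul, ← mul_assoc (2 * Real.pi)]; push_cast; ring
  · congr 1; ext τ
    unfold cw
    congr 2
    push_cast; field_simp

end

section
open Set Filter Topology

variable {q : ℕ}

/-- Finite Dirichlet polynomial. -/
noncomputable def dpoly (χ : DirichletCharacter ℂ q) (c : ℕ → ℝ) (N : ℕ) (τ : ℝ) : ℂ :=
  ∑ n ∈ Finset.range N, (c n : ℂ) * χ n * osc n τ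

lemma continuous_dpoly (χ : DirichletCharacter ℂ q) (c : ℕ → ℝ) (N : ℕ) :
    Continuous (dpoly χ c N) := by
  unfold dpoly
  exact continuous_finsetSum _ fun n _ => continuous_const.mul (continuous_osc n)

lemma norm_dpoly_le (χ : DirichletCharacter ℂ q) (c : ℕ → ℝ) (N : ℕ) (τ : ℝ) :
    ‖dpoly χ c N τ‖ ≤ ∑ n ∈ Finset.range N, |c n| :=
  norm_sum_le_of_le _ fun n _ => norm_E_term χ c τ n

lemma osc_mul_conj (n m : ℕ) (τ : ℝ) : osc n τ * (starRingEnd ℂ) (osc m τ) =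
    cexp (2 * Real.pi * τ * (Real.log n - Real.log m : ℝ) * I) := by
  unfold osc
  rw [← Complex.exp_conj, ← Complex.exp_add]
  congr 1
  simp only [map_mul, Complex.conj_ofReal, Complex.conj_I, map_ofNat]
  push_cast; ring

lemma norm_sum_char_mul_conj_le [NeZero q] (n m : ℕ) :
    ‖∑ χ : DirichletCharacter ℂ q, χ n * (starRingEnd ℂ) (χ m)‖ ≤
      if (n : ZMod q) = m then (q.totient : ℝ) else 0 := by
  by_cases hm : IsUnit (m : ZMod q)
  · have h := DirichletCharacter.sum_char_inv_mul_char_eq ℂ hm (n : ZMod q)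
    have e : ∑ χ : DirichletCharacter ℂ q, χ n * (starRingEnd ℂ) (χ m) =
        ∑ χ : DirichletCharacter ℂ q, χ (m : ZMod q)⁻¹ * χ n := by
      refine Finset.sum_congr rfl fun χ _ => ?_
      have hc : (starRingEnd ℂ) (χ m) = χ (m : ZMod q)⁻¹ := by
        rw [← char_inv_apply, MulChar.inv_apply]
        congr 1
        obtain ⟨u, hu⟩ := hm
        rw [← hu, Ring.inverse_unit]
        exact (ZMod.inv_coe_unit u).symm
      rw [hc, mul_comm]
    rw [e, h]
    by_cases hnm : (n : ZMod q) = m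
    · simp [hnm]
    · rw [if_neg (Ne.symm hnm), if_neg hnm, norm_zero]
  · rw [Finset.sum_eq_zero fun χ _ => by rw [MulChar.map_nonunit χ hm]; simp, norm_zero]
    split_ifs <;> positivity

/-- Near-diagonal kernel. -/
noncomputable def nker (T : ℝ) (n m : ℕ) : ℝ :=
  Real.exp (-(2 * Real.pi * T * |Real.log n - Real.log m|))

lemma nker_comm (T : ℝ) (n m : ℕ) : nker T n m = nker T m n := by
  unfold nker; rw [abs_sub_comm]

lemma integral_cw_normSq_dpoly [NeZero q] {T : ℝ} (hT : 0 < T) (c : ℕ → ℝ) (N : ℕ) :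
    ((∑ χ : DirichletCharacter ℂ q, ∫ τ, cw T τ * ‖dpoly χ c N τ‖ ^ 2 : ℝ) : ℂ) =
      ∑ n ∈ Finset.range N, ∑ m ∈ Finset.range N, ((c n * c m * (Real.pi * T * nker T n m) : ℝ) : ℂ) *
        ∑ χ : DirichletCharacter ℂ q, χ n * (starRingEnd ℂ) (χ m) := by
  rw [Complex.ofReal_sum]
  have h : ∀ χ : DirichletCharacter ℂ q, ((∫ τ, cw T τ * ‖dpoly χ c N τ‖ ^ 2 : ℝ) : ℂ) =
      ∑ n ∈ Finset.range N, ∑ m ∈ Finset.range N,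
        ((c n * c m * (Real.pi * T * nker T n m) : ℝ) : ℂ) * (χ n * (starRingEnd ℂ) (χ m)) := by
    intro χ
    have e : ∀ τ, ((cw T τ * ‖dpoly χ c N τ‖ ^ 2 : ℝ) : ℂ) =
        ∑ n ∈ Finset.range N, ∑ m ∈ Finset.range N,
          (((c n * c m : ℝ) : ℂ) * (χ n * (starRingEnd ℂ) (χ m))) *
            ((cw T τ : ℂ) * cexp (2 * Real.pi * τ * (Real.log n - Real.log m : ℝ) * I)) := by
      intro τ
      simp_rw [← osc_mul_conj]
      push_cast
      rw [← Complex.mul_conj', dpoly, map_sum, Finset.sum_mul_sum, Finset.mul_sum]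
      refine Finset.sum_congr rfl fun n _ => ?_
      rw [Finset.mul_sum]
      refine Finset.sum_congr rfl fun m _ => ?_
      simp only [map_mul, Complex.conj_ofReal]; ring
    have hi : ∀ n m : ℕ, Integrable fun τ : ℝ => (((c n * c m : ℝ) : ℂ) *
        (χ n * (starRingEnd ℂ) (χ m))) *
            ((cw T τ : ℂ) * cexp (2 * Real.pi * τ * (Real.log n - Real.log m : ℝ) * I)) := by
      intro n m
      refine Integrable.const_mul ?_ _
      refine (integrable_cw hT).ofReal.mul_bdd (c := 1) (by fun_prop) (ae_of_all _ fun τ => ?_)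
      rw [← osc_mul_conj, norm_mul, RCLike.norm_conj, norm_osc, norm_osc, one_mul]
    rw [← integral_complex_ofReal]
    simp_rw [e]
    rw [integral_finsetSum _ fun n _ => integrable_finsetSum _ fun m _ => hi n m]
    refine Finset.sum_congr rfl fun n _ => ?_
    rw [integral_finsetSum _ fun m _ => hi n m]
    refine Finset.sum_congr rfl fun m _ => ?_
    rw [integral_const_mul, integral_cw_mul_exp hT]
    unfold nker
    push_cast; ring
  simp_rw [h, Finset.mul_sum]
  rw [Finset.sum_comm]
  refine Finset.sum_congr rfl fun n _ => ?_
  rw [Finset.sum_comm]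

lemma sum_inv_sq_le {a : ℝ} (ha : 0 < a) (S : Finset ℕ) :
    ∑ j ∈ S, 1 / (1 + a * j) ^ 2 ≤ 1 + 1 / a := by
  have h0 : ∀ n : ℕ, ∑ j ∈ Finset.range n, 1 / (1 + a * ((j + 1 : ℕ) : ℝ)) ^ 2 ≤
      1 / a - 1 / a * (1 / (1 + a * n)) := by
    intro n
    induction n with
    | zero => simp
    | succ n ih =>
      rw [Finset.sum_range_succ]
      have h1 : (0:ℝ) < 1 + a * n := by positivity
      have h2 : (0:ℝ) < 1 + a * ((n + 1 : ℕ) : ℝ) := by positivity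
      have h3 : 1 / (1 + a * ((n + 1 : ℕ) : ℝ)) ^ 2 ≤
          1 / a * (1 / (1 + a * n)) - 1 / a * (1 / (1 + a * ((n + 1 : ℕ) : ℝ))) := by
        have : 1 / a * (1 / (1 + a * n)) - 1 / a * (1 / (1 + a * ((n + 1 : ℕ) : ℝ))) =
            1 / ((1 + a * n) * (1 + a * ((n + 1 : ℕ) : ℝ))) := by
          field_simp; push_cast; ring
        rw [this]
        refine one_div_le_one_div_of_le (by positivity) ?_
        rw [sq]
        refine mul_le_mul_of_nonneg_right ?_ h2.le
        push_cast; nlinarith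
      linarith
  obtain ⟨n, hn⟩ : ∃ n, S ⊆ Finset.range (n + 1) := by
    obtain ⟨n, hn⟩ := S.exists_nat_subset_range
    exact ⟨n, hn.trans (Finset.range_mono (Nat.le_succ n))⟩
  calc ∑ j ∈ S, 1 / (1 + a * j) ^ 2 ≤ ∑ j ∈ Finset.range (n + 1), 1 / (1 + a * (j:ℝ)) ^ 2 :=
        Finset.sum_le_sum_of_subset_of_nonneg hn fun _ _ _ => by positivity
    _ ≤ _ := by
        rw [Finset.sum_range_succ']
        have := h0 n
        have h1 : 0 ≤ 1 / a * (1 / (1 + a * n)) := by positivity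
        norm_num at this ⊢
        norm_num at h1
        linarith

lemma nker_le {T : ℝ} (hT : 1 ≤ T) {n m : ℕ} (hm : 0 < m) (hn : 0 < n) :
    nker T n m ≤ 1 / (1 + T * |(n:ℝ) - m| / n) ^ 2 := by
  have hn' : (0:ℝ) < n := by exact_mod_cast hn
  have hm' : (0:ℝ) < m := by exact_mod_cast hm
  have key : ∀ x : ℝ, 0 ≤ x → Real.exp (-(2 * Real.pi * T * Real.log (1 + x))) ≤
      1 / (1 + T * x) ^ 2 := by
    intro x hx
    rw [Real.exp_neg, ← one_div]
    refine one_div_le_one_div_of_le (by positivity) ?_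
    calc (1 + T * x) ^ 2 ≤ ((1 + x) ^ T) ^ 2 := by
          gcongr
          exact one_add_mul_self_le_rpow_one_add (by linarith) hT
      _ = Real.exp (2 * T * Real.log (1 + x)) := by
          rw [Real.rpow_def_of_pos (by linarith), ← Real.exp_nat_mul]; congr 1; push_cast; ring
      _ ≤ _ := by
          have hl : 0 ≤ Real.log (1 + x) := Real.log_nonneg (by linarith)
          have hpi : 1 ≤ Real.pi := by linarith [Real.pi_gt_three]
          refine Real.exp_le_exp.2 (mul_le_mul_of_nonneg_right ?_ hl)
          nlinarith
  unfold nker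
  rcases le_total n m with h | h
  · have h' : (n:ℝ) ≤ m := by exact_mod_cast h
    have e : |Real.log n - Real.log m| = Real.log (1 + ((m:ℝ) - n) / n) := by
      rw [abs_sub_comm, abs_of_nonneg (sub_nonneg.2 (Real.log_le_log hn' h')), ← Real.log_div hm'.ne' hn'.ne']
      congr 1; field_simp; ring
    rw [e, abs_sub_comm, abs_of_nonneg (sub_nonneg.2 h'), mul_div_assoc]
    exact key _ (div_nonneg (sub_nonneg.2 h') hn'.le)
  · have h' : (m:ℝ) ≤ n := by exact_mod_cast h
    have e : |Real.log n - Real.log m| = Real.log (1 + ((n:ℝ) - m) / m) := by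
      rw [abs_of_nonneg (sub_nonneg.2 (Real.log_le_log hm' h')), ← Real.log_div hn'.ne' hm'.ne']
      congr 1; field_simp; ring
    have h0 : 0 ≤ (n:ℝ) - m := sub_nonneg.2 h'
    rw [e, abs_of_nonneg h0]
    refine (key _ (div_nonneg h0 hm'.le)).trans ?_
    rw [mul_div_assoc]
    have : ((n:ℝ) - m) / n ≤ ((n:ℝ) - m) / m := div_le_div_of_nonneg_left h0 hm' h'
    refine one_div_le_one_div_of_le ?_ ?_
    · have : 0 ≤ T * (((n:ℝ) - m) / n) := by positivity
      positivity
    · gcongr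

end

section
open Set Filter Topology

variable {q : ℕ}

lemma sum_nker_le [NeZero q] {T : ℝ} (hT : 1 ≤ T) {n : ℕ} (hn : 0 < n) (N : ℕ) :
    ∑ m ∈ Finset.filter (fun m : ℕ => 0 < m ∧ (n : ZMod q) = m) (Finset.range N), nker T n m ≤ 2 * (1 + n / (q * T)) := by
  have hn' : (0:ℝ) < n := by exact_mod_cast hn
  have hq : 0 < q := Nat.pos_of_ne_zero (NeZero.ne q)
  have hq' : (0:ℝ) < q := by exact_mod_cast hq
  set a : ℝ := q * T / n with ha
  have ha0 : 0 < a := by positivity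
  set S := Finset.filter (fun m : ℕ => 0 < m ∧ (n : ZMod q) = m) (Finset.range N) with hS
  have bound : ∀ (P : Finset ℕ) (j : ℕ → ℕ), P ⊆ S → Set.InjOn j P →
      (∀ m ∈ P, |(n:ℝ) - m| = q * j m) → ∑ m ∈ P, nker T n m ≤ 1 + 1 / a := by
    intro P j hP hj hjm
    calc ∑ m ∈ P, nker T n m ≤ ∑ m ∈ P, 1 / (1 + a * (j m : ℝ)) ^ 2 := by
          refine Finset.sum_le_sum fun m hm => ?_
          have h1 := (Finset.mem_filter.1 (hP hm)).2.1
          refine (nker_le hT h1 hn).trans_eq ?_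
          rw [hjm m hm, ha]; congr 3; ring
      _ = ∑ i ∈ P.image j, 1 / (1 + a * (i : ℝ)) ^ 2 := by
          rw [Finset.sum_image hj]
      _ ≤ _ := sum_inv_sq_le ha0 _
  have h1 := bound (S.filter fun m => n ≤ m) (fun m => (m - n) / q) (Finset.filter_subset _ _)
  have h2 := bound (S.filter fun m => ¬ n ≤ m) (fun m => (n - m) / q) (Finset.filter_subset _ _)
  have hdvd1 : ∀ m ∈ S.filter fun m => n ≤ m, q * ((m - n) / q) = m - n := by
    intro m hm
    obtain ⟨hm, hnm⟩ := Finset.mem_filter.1 hm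
    have := (Finset.mem_filter.1 hm).2.2
    refine Nat.mul_div_cancel' ?_
    exact (Nat.modEq_iff_dvd' hnm).1 ((ZMod.natCast_eq_natCast_iff _ _ _).1 this)
  have hdvd2 : ∀ m ∈ S.filter fun m => ¬ n ≤ m, q * ((n - m) / q) = n - m := by
    intro m hm
    obtain ⟨hm, hnm⟩ := Finset.mem_filter.1 hm
    have := (Finset.mem_filter.1 hm).2.2
    refine Nat.mul_div_cancel' ?_
    exact (Nat.modEq_iff_dvd' (by omega)).1 ((ZMod.natCast_eq_natCast_iff _ _ _).1 this.symm)
  have e1 := h1 (fun x hx y hy hxy => by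
    have hx1 := hdvd1 x hx
    have hy1 := hdvd1 y hy
    have hx2 := (Finset.mem_filter.1 hx).2
    have hy2 := (Finset.mem_filter.1 hy).2
    simp only at hxy
    rw [hxy] at hx1
    omega) (fun m hm => by
      have h := hdvd1 m hm
      have h3 := (Finset.mem_filter.1 hm).2
      have h4 : (n:ℝ) ≤ m := by exact_mod_cast h3
      rw [abs_sub_comm, abs_of_nonneg (sub_nonneg.2 h4), ← Nat.cast_sub h3, ← Nat.cast_mul, h])
  have e2 := h2 (fun x hx y hy hxy => by
    have hx1 := hdvd2 x hx
    have hy1 := hdvd2 y hy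
    have hx2 := (Finset.mem_filter.1 hx).2
    have hy2 := (Finset.mem_filter.1 hy).2
    simp only at hxy
    rw [hxy] at hx1
    omega) (fun m hm => by
      have h := hdvd2 m hm
      have h3 : m ≤ n := by have := (Finset.mem_filter.1 hm).2; omega
      have h4 : (m:ℝ) ≤ n := by exact_mod_cast h3
      rw [abs_of_nonneg (sub_nonneg.2 h4), ← Nat.cast_sub h3, ← Nat.cast_mul, h])
  rw [← Finset.sum_filter_add_sum_filter_not S (fun m => n ≤ m)]
  have : 1 / a = n / (q * T) := by rw [ha]; field_simp
  rw [← this]; linarith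

lemma large_sieve [NeZero q] {T : ℝ} (hT : 1 ≤ T) (c : ℕ → ℝ) (hc : c 0 = 0) (N : ℕ) :
    ∑ χ : DirichletCharacter ℂ q, ∫ τ, cw T τ * ‖dpoly χ c N τ‖ ^ 2 ≤
      2 * Real.pi * T * q.totient * ∑ n ∈ Finset.range N, c n ^ 2 * (1 + n / (q * T)) := by
  have h := integral_cw_normSq_dpoly (q := q) (T := T) (by linarith) c N
  have hT0 : 0 < T := by linarith
  have h0 : 0 ≤ ∑ χ : DirichletCharacter ℂ q, ∫ τ, cw T τ * ‖dpoly χ c N τ‖ ^ 2 :=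
    Finset.sum_nonneg fun χ _ => integral_nonneg fun τ => mul_nonneg (cw_pos _ _).le (by positivity)
  set K : ℕ → ℕ → ℝ := fun n m => if 0 < m ∧ 0 < n ∧ (n : ZMod q) = m then nker T n m else 0
    with hK
  have hKc : ∀ n m, K n m = K m n := by
    intro n m
    simp only [hK]
    rw [nker_comm]
    congr 1
    exact propext ⟨fun h => ⟨h.2.1, h.1, h.2.2.symm⟩, fun h => ⟨h.2.1, h.1, h.2.2.symm⟩⟩
  have hK0 : ∀ n m, 0 ≤ K n m := by
    intro n m; simp only [hK]; split_ifs
    · exact (Real.exp_pos _).le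
    · exact le_rfl
  set D : ℝ := Real.pi * T * q.totient with hD
  have hD0 : 0 ≤ D := by positivity
  calc _ = ‖((∑ χ : DirichletCharacter ℂ q, ∫ τ, cw T τ * ‖dpoly χ c N τ‖ ^ 2 : ℝ) : ℂ)‖ := by
        rw [Complex.norm_real, Real.norm_of_nonneg h0]
    _ ≤ ∑ n ∈ Finset.range N, ∑ m ∈ Finset.range N, D * ((c n ^ 2 / 2) * K n m + (c m ^ 2 / 2) * K m n) := by
        rw [h]
        refine norm_sum_le_of_le _ fun n _ => norm_sum_le_of_le _ fun m _ => ?_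
        rcases Nat.eq_zero_or_pos n with rfl | hn
        · rw [hc]; simp only [zero_mul, Complex.ofReal_zero, norm_zero]
          have := hK0 m 0; have := hK0 0 m; positivity
        rcases Nat.eq_zero_or_pos m with rfl | hm
        · rw [hc]; simp only [zero_mul, mul_zero, Complex.ofReal_zero, norm_zero]
          have := hK0 n 0; have := hK0 0 n; positivity
        rw [norm_mul, Complex.norm_real, Real.norm_eq_abs, hKc m n]
        refine (mul_le_mul_of_nonneg_left (norm_sum_char_mul_conj_le n m) (abs_nonneg _)).trans ?_
        simp only [hK, hm, hn, true_and]
        split_ifs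
        · have hn0 : 0 < nker T n m := Real.exp_pos _
          rw [abs_mul, abs_of_pos (a := Real.pi * T * nker T n m) (by positivity)]
          have h1 : |c n * c m| ≤ c n ^ 2 / 2 + c m ^ 2 / 2 := by
            rw [abs_mul]
            nlinarith [sq_nonneg (|c n| - |c m|), sq_abs (c n), sq_abs (c m)]
          calc _ = D * nker T n m * |c n * c m| := by rw [hD]; ring
            _ ≤ D * nker T n m * (c n ^ 2 / 2 + c m ^ 2 / 2) :=
              mul_le_mul_of_nonneg_left h1 (by positivity)
            _ = _ := by ring
        · simp
    _ = ∑ n ∈ Finset.range N, D * (c n ^ 2 * ∑ m ∈ Finset.range N, K n m) := by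
        simp_rw [mul_add, Finset.sum_add_distrib]
        rw [Finset.sum_comm (f := fun n m => D * (c m ^ 2 / 2 * K m n)), ← Finset.sum_add_distrib]
        refine Finset.sum_congr rfl fun n _ => ?_
        simp_rw [← Finset.mul_sum]; ring
    _ ≤ ∑ n ∈ Finset.range N, D * (c n ^ 2 * (2 * (1 + n / (q * T)))) := by
        refine Finset.sum_le_sum fun n _ => mul_le_mul_of_nonneg_left
          (mul_le_mul_of_nonneg_left ?_ (sq_nonneg _)) hD0
        rcases Nat.eq_zero_or_pos n with rfl | hn
        · simp [hK]
        · refine le_trans (le_of_eq ?_) (sum_nker_le (q := q) hT hn N)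
          rw [Finset.sum_filter]
          simp [hK, hn]
    _ = _ := by rw [Finset.mul_sum]; refine Finset.sum_congr rfl fun n _ => ?_; rw [hD]; ring

end

section
open Set Filter Topology

variable {q : ℕ}

lemma majCoef_zero (Y : ℝ) : majCoef Y 0 = 0 := by
  unfold majCoef
  rw [Nat.cast_zero, Real.zero_rpow (by norm_num), zero_mul]

lemma osc_mul {m n : ℕ} (hm : m ≠ 0) (hn : n ≠ 0) (τ : ℝ) : osc (m * n) τ = osc m τ * osc n τ := by
  unfold osc
  rw [← Complex.exp_add, Nat.cast_mul, Real.log_mul (by exact_mod_cast hm) (by exact_mod_cast hn)]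
  congr 1; push_cast; ring

/-- Truncated Dirichlet convolution square. -/
noncomputable def convSq (b : ℕ → ℝ) (N m : ℕ) : ℝ :=
  ∑ x ∈ (Finset.range N ×ˢ Finset.range N).filter (fun x => x.1 * x.2 = m), b x.1 * b x.2

lemma dpoly_sq (χ : DirichletCharacter ℂ q) {b : ℕ → ℝ} (hb : b 0 = 0) (N : ℕ) (τ : ℝ) :
    dpoly χ b N τ ^ 2 = dpoly χ (convSq b N) (N * N + 1) τ := by
  unfold dpoly convSq
  rw [sq, Finset.sum_mul_sum, ← Finset.sum_product',
    ← Finset.sum_fiberwise_of_maps_to (t := Finset.range (N * N + 1)) (g := fun x : ℕ × ℕ => x.1 * x.2)]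
  · refine Finset.sum_congr rfl fun m _ => ?_
    rw [Complex.ofReal_sum, Finset.sum_mul, Finset.sum_mul]
    refine Finset.sum_congr rfl fun x hx => ?_
    have hm := (Finset.mem_filter.1 hx).2
    by_cases h1 : x.1 = 0
    · simp [h1, hb]
    by_cases h2 : x.2 = 0
    · simp [h2, hb]
    rw [← hm, osc_mul h1 h2, Nat.cast_mul, map_mul]; push_cast; ring
  · intro x hx
    rw [Finset.mem_product, Finset.mem_range, Finset.mem_range] at hx
    exact Finset.mem_range.2 (Nat.lt_succ_of_le (Nat.mul_le_mul hx.1.le hx.2.le))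

lemma majCoef_mul_le {Y : ℝ} (hY : 0 ≤ Y) (m n : ℕ) :
    majCoef Y m * majCoef Y n ≤ ((m * n : ℕ) : ℝ) ^ (-(1/2) : ℝ) * min 1 (Y ^ 2 / (m * n : ℕ)) := by
  unfold majCoef
  have h1 : min 1 (Y / m) * min 1 (Y / n) ≤ min 1 (Y ^ 2 / (m * n : ℕ)) := by
    have a1 : 0 ≤ min 1 (Y / m) := le_min zero_le_one (by positivity)
    have a2 : 0 ≤ min 1 (Y / n) := le_min zero_le_one (by positivity)
    refine le_min (mul_le_one₀ (min_le_left _ _) a2 (min_le_left _ _)) ?_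
    calc _ ≤ Y / m * (Y / n) := mul_le_mul (min_le_right _ _) (min_le_right _ _) a2 (by positivity)
      _ = _ := by rw [div_mul_div_comm]; push_cast; ring
  calc _ = ((m:ℝ) ^ (-(1/2) : ℝ) * (n:ℝ) ^ (-(1/2) : ℝ)) * (min 1 (Y / m) * min 1 (Y / n)) := by ring
    _ ≤ _ := by
      rw [Nat.cast_mul, ← Real.mul_rpow (by positivity) (by positivity)]
      rw [Nat.cast_mul] at h1
      exact mul_le_mul_of_nonneg_left h1 (by positivity)

lemma convSq_zero {b : ℕ → ℝ} (hb : b 0 = 0) (N : ℕ) : convSq b N 0 = 0 := by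
  refine Finset.sum_eq_zero fun x hx => ?_
  rcases Nat.mul_eq_zero.1 (Finset.mem_filter.1 hx).2 with h | h <;> simp [h, hb]

lemma abs_convSq_le {Y K : ℝ} (hY : 0 ≤ Y) (hK : 0 ≤ K) {b : ℕ → ℝ}
    (hb : ∀ n, |b n| ≤ K * majCoef Y n) (N : ℕ) {m : ℕ} (hm : 0 < m) :
    |convSq b N m| ≤ K ^ 2 * m.divisors.card * ((m : ℝ) ^ (-(1/2) : ℝ) * min 1 (Y ^ 2 / m)) := by
  have h0 : 0 ≤ (m : ℝ) ^ (-(1/2) : ℝ) * min 1 (Y ^ 2 / m) :=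
    mul_nonneg (by positivity) (le_min zero_le_one (by positivity))
  unfold convSq
  set S := (Finset.range N ×ˢ Finset.range N).filter (fun x => x.1 * x.2 = m)
  have hS : S.card ≤ m.divisors.card := by
    refine Finset.card_le_card_of_injOn Prod.fst (fun x hx => ?_) ?_
    · have := (Finset.mem_filter.1 hx).2
      exact Finset.mem_coe.2 (Nat.mem_divisors.2 ⟨⟨x.2, this.symm⟩, hm.ne'⟩)
    · intro x hx y hy hxy
      have h1 := (Finset.mem_filter.1 hx).2
      have h2 := (Finset.mem_filter.1 hy).2
      refine Prod.ext hxy ?_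
      change x.1 = y.1 at hxy
      rw [← h2, ← hxy] at h1
      have : 0 < x.1 := Nat.pos_of_ne_zero fun h => by
        rw [← hxy, h, zero_mul] at h2; omega
      exact Nat.eq_of_mul_eq_mul_left this h1
  calc |∑ x ∈ S, b x.1 * b x.2| ≤ ∑ x ∈ S, K ^ 2 * ((m : ℝ) ^ (-(1/2) : ℝ) * min 1 (Y ^ 2 / m)) := by
        refine (Finset.abs_sum_le_sum_abs _ _).trans (Finset.sum_le_sum fun x hx => ?_)
        have hx2 := (Finset.mem_filter.1 hx).2
        rw [abs_mul]
        calc _ ≤ K * majCoef Y x.1 * (K * majCoef Y x.2) :=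
              mul_le_mul (hb _) (hb _) (abs_nonneg _) (mul_nonneg hK (majCoef_nonneg hY _))
          _ = K ^ 2 * (majCoef Y x.1 * majCoef Y x.2) := by ring
          _ ≤ _ := by
            refine mul_le_mul_of_nonneg_left ?_ (sq_nonneg K)
            have := majCoef_mul_le hY x.1 x.2
            rwa [hx2] at this
    _ = S.card * (K ^ 2 * ((m : ℝ) ^ (-(1/2) : ℝ) * min 1 (Y ^ 2 / m))) := by
        rw [Finset.sum_const, nsmul_eq_mul]
    _ ≤ m.divisors.card * (K ^ 2 * ((m : ℝ) ^ (-(1/2) : ℝ) * min 1 (Y ^ 2 / m))) :=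
        mul_le_mul_of_nonneg_right (by exact_mod_cast hS) (mul_nonneg (sq_nonneg _) h0)
    _ = _ := by ring

lemma min_one_le_rpow {x θ : ℝ} (hx : 0 < x) (h0 : 0 ≤ θ) (h1 : θ ≤ 1) : min 1 x ≤ x ^ θ := by
  rcases le_total 1 x with h | h
  · exact (min_le_left _ _).trans (Real.one_le_rpow h h0)
  · refine (min_le_right _ _).trans ?_
    calc x = x ^ (1:ℝ) := (Real.rpow_one x).symm
      _ ≤ _ := Real.rpow_le_rpow_of_exponent_ge hx h h1

lemma min_sq_mul_le {Z m : ℝ} (hZ : 0 < Z) (hm : 0 < m) :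
    min 1 (Z / m) ^ 2 * (1 + m / Z) ≤ 2 * min 1 (Z / m) := by
  rcases le_total m Z with h | h
  · rw [min_eq_left ((one_le_div hm).2 h)]
    have : m / Z ≤ 1 := (div_le_one hZ).2 h
    linarith
  · rw [min_eq_right ((div_le_one hm).2 h)]
    have h1 : Z / m ≤ 1 := (div_le_one hm).2 h
    have h2 : 0 < Z / m := by positivity
    have h3 : (Z / m) * (m / Z) = 1 := by field_simp
    nlinarith

lemma exists_sum_convSq_le {ε : ℝ} (hε : 0 < ε) : ∃ C : ℝ, 0 ≤ C ∧ ∀ (Z K : ℝ) (b : ℕ → ℝ), 1 ≤ Z → 0 ≤ K →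
    (∀ n, |b n| ≤ K * majCoef (√Z) n) → ∀ N M : ℕ,
    ∑ m ∈ Finset.range M, convSq b N m ^ 2 * (1 + m / Z) ≤ C * K ^ 4 * Z ^ ε := by
  set δ : ℝ := min (ε / 2) (1 / 2) with hδ
  have hδ0 : 0 < δ := lt_min (by positivity) (by norm_num)
  have hδ1 : 2 * δ ≤ 1 := by have := min_le_right (ε / 2) (1 / 2 : ℝ); linarith
  have hδ2 : 2 * δ ≤ ε := by have := min_le_left (ε / 2) (1 / 2 : ℝ); linarith
  obtain ⟨C, hC, hd⟩ := exists_card_divisors_le (ε := δ / 2) (by positivity)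
  have hsum : Summable fun m : ℕ => (m : ℝ) ^ (-1 - δ) :=
    Real.summable_nat_rpow.2 (by linarith)
  have hS0 : 0 ≤ ∑' m : ℕ, (m : ℝ) ^ (-1 - δ) := tsum_nonneg fun m => by positivity
  refine ⟨2 * C ^ 2 * ∑' m : ℕ, (m : ℝ) ^ (-1 - δ), by positivity, fun Z K b hZ hK hb N M => ?_⟩
  have hZ0 : 0 < Z := by linarith
  have hb0 : b 0 = 0 := by
    have := hb 0; rw [majCoef_zero, mul_zero] at this; exact abs_nonpos_iff.1 this
  have term : ∀ m : ℕ, convSq b N m ^ 2 * (1 + m / Z) ≤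
      2 * C ^ 2 * K ^ 4 * Z ^ (2 * δ) * (m : ℝ) ^ (-1 - δ) := by
    intro m
    rcases Nat.eq_zero_or_pos m with rfl | hm
    · rw [convSq_zero hb0]; norm_num; positivity
    have hm' : (0:ℝ) < m := by exact_mod_cast hm
    have h1 := abs_convSq_le (Real.sqrt_nonneg Z) hK hb N hm
    rw [Real.sq_sqrt hZ0.le] at h1
    have hmin : 0 ≤ min 1 (Z / m) := le_min zero_le_one (by positivity)
    have h2 : (m.divisors.card : ℝ) ^ 2 ≤ C ^ 2 * (m:ℝ) ^ δ := by
      calc (m.divisors.card : ℝ) ^ 2 ≤ (C * (m:ℝ) ^ (δ / 2)) ^ 2 :=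
            pow_le_pow_left₀ (by positivity) (hd m hm.ne') 2
        _ = _ := by
          rw [mul_pow, ← Real.rpow_mul_natCast (by positivity)]; congr 2; push_cast; ring
    have h3 : ((m : ℝ) ^ (-(1/2) : ℝ)) ^ 2 = (m : ℝ) ^ (-1 : ℝ) := by
      rw [← Real.rpow_mul_natCast (by positivity)]; norm_num
    calc convSq b N m ^ 2 * (1 + m / Z)
        = |convSq b N m| ^ 2 * (1 + m / Z) := by rw [sq_abs]
      _ ≤ (K ^ 2 * m.divisors.card * ((m : ℝ) ^ (-(1/2) : ℝ) * min 1 (Z / m))) ^ 2 * (1 + m / Z) := by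
          refine mul_le_mul_of_nonneg_right (pow_le_pow_left₀ (abs_nonneg _) h1 2) (by positivity)
      _ = K ^ 4 * (m.divisors.card : ℝ) ^ 2 * (m : ℝ) ^ (-1 : ℝ) * (min 1 (Z / m) ^ 2 * (1 + m / Z)) := by
          rw [← h3]; ring
      _ ≤ K ^ 4 * (C ^ 2 * (m:ℝ) ^ δ) * (m : ℝ) ^ (-1 : ℝ) * (2 * (Z / m) ^ (2 * δ)) := by
          refine mul_le_mul ?_ ?_ (by positivity) (by positivity)
          · exact mul_le_mul_of_nonneg_right (mul_le_mul_of_nonneg_left h2 (by positivity)) (by positivity)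
          · exact (min_sq_mul_le hZ0 hm').trans
              (mul_le_mul_of_nonneg_left (min_one_le_rpow (by positivity) (by linarith) hδ1) zero_le_two)
      _ = 2 * C ^ 2 * K ^ 4 * Z ^ (2 * δ) * ((m:ℝ) ^ δ * (m : ℝ) ^ (-1 : ℝ) * ((m:ℝ) ^ (2 * δ))⁻¹) := by
          rw [Real.div_rpow hZ0.le hm'.le]; ring
      _ = _ := by
          rw [← Real.rpow_neg hm'.le, ← Real.rpow_add hm', ← Real.rpow_add hm']; congr 2; ring
  calc _ ≤ ∑ m ∈ Finset.range M, 2 * C ^ 2 * K ^ 4 * Z ^ (2 * δ) * (m : ℝ) ^ (-1 - δ) :=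
        Finset.sum_le_sum fun m _ => term m
    _ ≤ 2 * C ^ 2 * K ^ 4 * Z ^ (2 * δ) * ∑' m : ℕ, (m : ℝ) ^ (-1 - δ) := by
        rw [← Finset.mul_sum]
        exact mul_le_mul_of_nonneg_left (hsum.sum_le_tsum _ fun m _ => by positivity) (by positivity)
    _ ≤ 2 * C ^ 2 * K ^ 4 * Z ^ ε * ∑' m : ℕ, (m : ℝ) ^ (-1 - δ) := by
        refine mul_le_mul_of_nonneg_right (mul_le_mul_of_nonneg_left
          (Real.rpow_le_rpow_of_exponent_le hZ hδ2) (by positivity)) hS0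
    _ = _ := by ring

lemma exists_fourth_moment_le {ε : ℝ} (hε : 0 < ε) : ∃ C : ℝ, 0 ≤ C ∧
    ∀ (q : ℕ) [NeZero q] (T K : ℝ) (b : ℕ → ℝ), 1 ≤ T → 0 ≤ K →
    (∀ n, |b n| ≤ K * majCoef (√(q * T)) n) →
    ∑ χ : DirichletCharacter ℂ q, ∫ τ, cw T τ * ‖E χ b τ‖ ^ 4 ≤
      C * K ^ 4 * q.totient * T * (q * T) ^ ε := by
  obtain ⟨C, hC, h⟩ := exists_sum_convSq_le hε
  refine ⟨2 * Real.pi * C, by positivity, fun q _ T K b hT hK hb => ?_⟩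
  have hq1 : (1:ℝ) ≤ q := by exact_mod_cast Nat.pos_of_ne_zero (NeZero.ne q)
  have hZ : 1 ≤ q * T := by nlinarith
  have hb0 : b 0 = 0 := by
    have := hb 0; rw [majCoef_zero, mul_zero] at this; exact abs_nonpos_iff.1 this
  have hbs : Summable fun n => |b n| := summable_of_le_maj (Real.sqrt_nonneg _) hb
  have hT0 : 0 < T := by linarith
  have lim : Tendsto (fun N => ∑ χ : DirichletCharacter ℂ q, ∫ τ, cw T τ * ‖dpoly χ b N τ‖ ^ 4) atTop
      (𝓝 (∑ χ : DirichletCharacter ℂ q, ∫ τ, cw T τ * ‖E χ b τ‖ ^ 4)) := by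
    refine tendsto_finsetSum _ fun χ _ => ?_
    refine tendsto_integral_of_dominated_convergence (fun τ => cw T τ * (∑' n, |b n|) ^ 4)
      (fun N => ?_) ((integrable_cw hT0).mul_const _) (fun N => ae_of_all _ fun τ => ?_)
      (ae_of_all _ fun τ => ?_)
    · exact ((continuous_cw T).mul ((continuous_dpoly χ b N).norm.pow 4)).aestronglyMeasurable
    · rw [Real.norm_of_nonneg (mul_nonneg (cw_pos _ _).le (by positivity))]
      refine mul_le_mul_of_nonneg_left (pow_le_pow_left₀ (norm_nonneg _) ?_ 4) (cw_pos _ _).le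
      exact (norm_dpoly_le χ b N τ).trans (hbs.sum_le_tsum _ fun n _ => abs_nonneg _)
    · exact (((summable_E χ hbs τ).hasSum.tendsto_sum_nat).norm.pow 4).const_mul _
  refine le_of_tendsto' lim fun N => ?_
  have e : ∀ (χ : DirichletCharacter ℂ q) τ, ‖dpoly χ b N τ‖ ^ 4 =
      ‖dpoly χ (convSq b N) (N * N + 1) τ‖ ^ 2 := by
    intro χ τ
    rw [← dpoly_sq χ hb0, norm_pow]; ring
  simp_rw [e]
  refine (large_sieve hT _ (convSq_zero hb0 N) _).trans ?_
  calc _ ≤ 2 * Real.pi * T * q.totient * (C * K ^ 4 * (q * T) ^ ε) :=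
        mul_le_mul_of_nonneg_left (h _ K b hZ hK hb N _) (by positivity)
    _ = _ := by ring

end

section
open Set Filter Topology

/-- Linear weight at scale `T`. -/
noncomputable def lw (T τ : ℝ) : ℝ := 1 + |τ| / T

lemma one_le_lw {T : ℝ} (hT : 0 ≤ T) (τ : ℝ) : 1 ≤ lw T τ := by
  unfold lw; have : 0 ≤ |τ| / T := by positivity
  linarith

lemma lw_pos {T : ℝ} (hT : 0 ≤ T) (τ : ℝ) : 0 < lw T τ := zero_lt_one.trans_le (one_le_lw hT τ)

lemma continuous_lw (T : ℝ) : Continuous (lw T) := by unfold lw; fun_prop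

lemma inv_lw_sq_le_cw {T : ℝ} (hT : 0 ≤ T) (τ : ℝ) : (lw T τ ^ 2)⁻¹ ≤ cw T τ := by
  unfold cw lw
  refine inv_anti₀ (by positivity) ?_
  have h1 : 0 ≤ |τ| / T := by positivity
  have h2 : (τ / T) ^ 2 = (|τ| / T) ^ 2 := by rw [div_pow, div_pow, sq_abs]
  rw [h2]; nlinarith

lemma exists_tsum_maj_le {ε : ℝ} (hε : 0 < ε) : ∃ C : ℝ, 0 ≤ C ∧ ∀ (Z K : ℝ) (b : ℕ → ℝ), 1 ≤ Z → 0 ≤ K →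
    (∀ n, |b n| ≤ K * majCoef (√Z) n) → ∑' n, |b n| ≤ C * K * Z ^ (1 / 4 + ε) := by
  set δ : ℝ := min (2 * ε) (1 / 2) with hδ
  have hδ0 : 0 < δ := lt_min (by positivity) (by norm_num)
  have hδ1 : δ ≤ 1 / 2 := min_le_right _ _
  have hδ2 : δ ≤ 2 * ε := min_le_left _ _
  have hsum : Summable fun m : ℕ => (m : ℝ) ^ (-1 - δ) :=
    Real.summable_nat_rpow.2 (by linarith)
  refine ⟨∑' m : ℕ, (m : ℝ) ^ (-1 - δ), tsum_nonneg fun m => by positivity, fun Z K b hZ hK hb => ?_⟩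
  have hZ0 : 0 < Z := by linarith
  have hs := Real.sqrt_pos.2 hZ0
  have hm : ∀ n : ℕ, majCoef (√Z) n ≤ Z ^ (1 / 4 + δ / 2) * (n : ℝ) ^ (-1 - δ) := by
    intro n
    rcases Nat.eq_zero_or_pos n with rfl | hn
    · rw [majCoef_zero]; positivity
    have hn' : (0:ℝ) < n := by exact_mod_cast hn
    unfold majCoef
    calc _ ≤ (n:ℝ) ^ (-(1/2) : ℝ) * (√Z / n) ^ (1 / 2 + δ) :=
          mul_le_mul_of_nonneg_left (min_one_le_rpow (by positivity) (by linarith) (by linarith))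
            (by positivity)
      _ = _ := by
        rw [Real.div_rpow hs.le hn'.le, Real.sqrt_eq_rpow, ← Real.rpow_mul hZ0.le,
          div_eq_mul_inv (_ ^ _ : ℝ), ← Real.rpow_neg hn'.le, mul_left_comm, ← Real.rpow_add hn']
        congr 2 <;> ring
  calc ∑' n, |b n| ≤ ∑' n : ℕ, K * (Z ^ (1 / 4 + δ / 2) * (n : ℝ) ^ (-1 - δ)) :=
        (summable_of_le_maj hs.le hb).tsum_le_tsum
          (fun n => (hb n).trans (mul_le_mul_of_nonneg_left (hm n) hK)) ((hsum.mul_left _).mul_left _)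
    _ = (∑' m : ℕ, (m : ℝ) ^ (-1 - δ)) * K * Z ^ (1 / 4 + δ / 2) := by
        rw [tsum_mul_left, tsum_mul_left]; ring
    _ ≤ _ := mul_le_mul_of_nonneg_left (Real.rpow_le_rpow_of_exponent_le hZ (by linarith))
        (mul_nonneg (tsum_nonneg fun m => by positivity) hK)

variable {q : ℕ}

/-- Total mass of the Gaussian moment used for shifts. -/
noncomputable def gaussMoment (p : ℕ) : ℝ := ∫ v : ℝ, Real.exp (-v ^ 2) * (1 + |v|) ^ p

lemma integrable_gaussMoment (p : ℕ) :
    Integrable fun v : ℝ => Real.exp (-v ^ 2) * (1 + |v|) ^ p := by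
  apply integrable_gauss_mul (Continuous.measurable (by fun_prop)) (C := 1) (N := p)
  intro v
  rw [one_mul, abs_of_nonneg (by positivity)]

lemma gaussMoment_nonneg (p : ℕ) : 0 ≤ gaussMoment p :=
  integral_nonneg fun v => by positivity

lemma G_le {T : ℝ} (hT : 1 ≤ T) (χ : DirichletCharacter ℂ q) {b : ℕ → ℝ}
    (hb : Summable fun n => |b n|) (τ : ℝ) : G T χ b τ ≤ lw T τ * ∑' n, |b n| :=
  mul_le_mul_of_nonneg_left (norm_E_le χ hb τ) (lw_pos (by linarith) τ).le

lemma gav_G_le {T : ℝ} (hT : 1 ≤ T) (χ : DirichletCharacter ℂ q) {b : ℕ → ℝ}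
    (hb : Summable fun n => |b n|) (τ : ℝ) :
    gav (G T χ b) τ ≤ gaussMoment 1 * (lw T τ * ∑' n, |b n|) := by
  have h0 : 0 ≤ ∑' n, |b n| := tsum_nonneg fun n => abs_nonneg _
  unfold gav gaussMoment
  rw [← integral_mul_const]
  refine integral_mono_of_nonneg (ae_of_all _ fun v => ?_)
    ((integrable_gaussMoment 1).mul_const _) (ae_of_all _ fun v => ?_)
  · exact mul_nonneg (Real.exp_pos _).le (G_nonneg (by linarith) _ _ _)
  · change _ * _ ≤ _ * _ * _
    rw [mul_assoc]
    refine mul_le_mul_of_nonneg_left ((G_le hT χ hb _).trans ?_) (Real.exp_pos _).le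
    calc _ ≤ (lw T τ * (1 + |v|)) * ∑' n, |b n| :=
          mul_le_mul_of_nonneg_right (one_add_shift_le hT τ v) h0
      _ = _ := by ring

lemma exists_norm_LL_le_rpow {ε : ℝ} (hε : 0 < ε) : ∃ C : ℝ, 0 ≤ C ∧
    ∀ (q : ℕ) [NeZero q] (χ : DirichletCharacter ℂ q) (T τ : ℝ), χ.IsPrimitive → q ≠ 1 → 1 ≤ T →
    ‖LL χ τ‖ ≤ C * (q * T) ^ (1 / 4 + ε) * lw T τ := by
  obtain ⟨C, hC, h⟩ := exists_tsum_maj_le (ε := ε / 2) (by positivity)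
  set M := gaussMoment 1
  have hM : 0 ≤ M := gaussMoment_nonneg 1
  refine ⟨50 * (1 + 1 / (ε / 2)) * (3 * C + 3 * M * C), by positivity, fun q _ χ T τ hχ hq hT => ?_⟩
  have hq1 : (1:ℝ) ≤ q := by exact_mod_cast Nat.pos_of_ne_zero (NeZero.ne q)
  have hT0 : 0 < T := by linarith
  have hZ : 1 ≤ q * T := by nlinarith
  have hZ0 : 0 < q * T := by linarith
  have hs : 1 ≤ √(q * T) := Real.one_le_sqrt.2 hZ
  have hs0 : 0 < √(q * T) := by linarith
  have hw := lw_pos hT0.le τ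
  set P : ℝ := (q * T) ^ (1 / 4 + ε / 2) with hP
  have hP0 : 0 ≤ P := by positivity
  have b0 := lowCoef_le hs0
  have b1 := headCoef_le hs0.le
  have b2 := tailCoef_le hs0.le
  have b3 := tailCoef_zero_le hs
  have s0 := h (q * T) 3 _ hZ (by norm_num) b0
  have s1 := h (q * T) 1 _ hZ (by norm_num) b1
  have s2 := h (q * T) 1 _ hZ (by norm_num) b2
  have s3 := h (q * T) 1 _ hZ (by norm_num) b3
  have g0 := (G_le hT χ (summable_of_le_maj hs0.le b0) τ).trans
    (mul_le_mul_of_nonneg_left s0 hw.le)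
  have g1 := (gav_G_le hT χ (summable_of_le_maj hs0.le b1) τ).trans
    (mul_le_mul_of_nonneg_left (mul_le_mul_of_nonneg_left s1 hw.le) hM)
  have g2 := (gav_G_le hT χ (summable_of_le_maj hs0.le b2) τ).trans
    (mul_le_mul_of_nonneg_left (mul_le_mul_of_nonneg_left s2 hw.le) hM)
  have g3 := (gav_G_le hT χ (summable_of_le_maj hs0.le b3) τ).trans
    (mul_le_mul_of_nonneg_left (mul_le_mul_of_nonneg_left s3 hw.le) hM)
  have hlog : 1 + Real.log (q * T) ≤ (1 + 1 / (ε / 2)) * (q * T) ^ (ε / 2) := by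
    have h1 := Real.log_le_rpow_div hZ0.le (by positivity : 0 < ε / 2)
    have h2 := Real.one_le_rpow hZ (by positivity : 0 ≤ ε / 2)
    rw [div_eq_mul_one_div] at h1; linarith
  have hl0 : 0 ≤ Real.log (q * T) := Real.log_nonneg hZ
  refine (norm_LL_le χ hχ hq hT τ).trans ?_
  calc _ ≤ 50 * ((1 + 1 / (ε / 2)) * (q * T) ^ (ε / 2)) * ((3 * C + 3 * M * C) * P * lw T τ) := by
        refine mul_le_mul (mul_le_mul_of_nonneg_left hlog (by norm_num)) ?_ ?_ (by positivity)
        · refine (add_le_add (add_le_add (add_le_add g0 g1) g2) g3).trans_eq ?_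
          rw [hP]; ring
        · have n0 := G_nonneg (by linarith : 0 ≤ T) χ (lowCoef (√(q * T))) τ
          have n1 := gav_nonneg (G_nonneg (by linarith : 0 ≤ T) χ (headCoef (√(q * T)))) τ
          have n2 := gav_nonneg (G_nonneg (by linarith : 0 ≤ T) χ (fun n => √(q * T) * tailCoef (√(q * T)) n)) τ
          have n3 := gav_nonneg (G_nonneg (by linarith : 0 ≤ T) χ (tailCoef 0)) τ
          positivity
    _ = 50 * (1 + 1 / (ε / 2)) * (3 * C + 3 * M * C) * ((q * T) ^ (ε / 2) * P) * lw T τ := by ring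
    _ = _ := by
        rw [hP, ← Real.rpow_add hZ0]; congr 3; ring

end

section
open Set Filter Topology

variable {q : ℕ}

lemma integral_gauss_conv (p : ℕ) {H : ℝ → ℝ} (hH : Integrable H) :
    Integrable (fun τ => ∫ v : ℝ, Real.exp (-v ^ 2) * (1 + |v|) ^ p * H (τ - v / (2 * Real.pi))) ∧
    ∫ τ, ∫ v : ℝ, Real.exp (-v ^ 2) * (1 + |v|) ^ p * H (τ - v / (2 * Real.pi)) =
      gaussMoment p * ∫ τ, H τ := by
  set g : ℝ → ℝ := fun v => Real.exp (-v ^ 2) * (1 + |v|) ^ p with hg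
  have hpi : 0 < 2 * Real.pi := by positivity
  have hgi : Integrable g := integrable_gaussMoment p
  have e : (fun τ => ∫ v : ℝ, g v * H (τ - v / (2 * Real.pi))) =
      fun τ => (2 * Real.pi) * convolution (fun u => g (2 * Real.pi * u)) H (ContinuousLinearMap.mul ℝ ℝ) volume τ := by
    funext τ
    have h := Measure.integral_comp_mul_left (fun v => g v * H (τ - v / (2 * Real.pi))) (2 * Real.pi)
    rw [convolution]
    simp only [ContinuousLinearMap.mul_apply']
    have h2 : ∀ x : ℝ, τ - 2 * Real.pi * x / (2 * Real.pi) = τ - x := fun x => by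
      rw [mul_div_cancel_left₀ _ hpi.ne']
    simp only [h2] at h
    rw [h, abs_of_pos (by positivity), smul_eq_mul, mul_inv_cancel_left₀ hpi.ne']
  have hgi' : Integrable fun u => g (2 * Real.pi * u) := hgi.comp_mul_left' hpi.ne'
  rw [e]
  refine ⟨(hgi'.integrable_convolution _ hH).const_mul _, ?_⟩
  rw [integral_const_mul, integral_convolution _ hgi' hH, Measure.integral_comp_mul_left g,
    abs_of_pos (by positivity)]
  simp only [ContinuousLinearMap.mul_apply', smul_eq_mul]
  rw [← mul_assoc, mul_inv_cancel_left₀ hpi.ne']; rfl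

lemma integral_gauss_pos : 0 < ∫ v : ℝ, Real.exp (-v ^ 2) := by
  have := integral_gaussian 1
  simp only [neg_mul, one_mul, div_one] at this
  rw [this]; positivity

lemma gav_pow_four_le {f : ℝ → ℝ} {τ : ℝ}
    (h1 : Integrable fun v => Real.exp (-v ^ 2) * f (τ - v / (2 * Real.pi)))
    (h4 : Integrable fun v => Real.exp (-v ^ 2) * f (τ - v / (2 * Real.pi)) ^ 4) :
    gav f τ ^ 4 ≤ (∫ v : ℝ, Real.exp (-v ^ 2)) ^ 3 * gav (fun x => f x ^ 4) τ := by
  set M : ℝ := ∫ v : ℝ, Real.exp (-v ^ 2) with hM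
  have hM0 : 0 < M := integral_gauss_pos
  set A : ℝ := gav f τ / M with hA
  have hA1 : gav f τ = A * M := by rw [hA]; field_simp
  have key : 4 * A ^ 3 * gav f τ - 3 * A ^ 4 * M ≤ gav (fun x => f x ^ 4) τ := by
    have e : 4 * A ^ 3 * gav f τ - 3 * A ^ 4 * M = ∫ v : ℝ,
        (4 * A ^ 3 * (Real.exp (-v ^ 2) * f (τ - v / (2 * Real.pi))) - 3 * A ^ 4 * Real.exp (-v ^ 2)) := by
      rw [integral_sub (h1.const_mul _) (integrable_exp_neg_sq.const_mul _), integral_const_mul,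
        integral_const_mul]; rfl
    rw [e]
    refine integral_mono ((h1.const_mul _).sub (integrable_exp_neg_sq.const_mul _)) h4 fun v => ?_
    change 4 * A ^ 3 * (_ * _) - _ ≤ _ * _
    have : 4 * A ^ 3 * f (τ - v / (2 * Real.pi)) - 3 * A ^ 4 ≤ f (τ - v / (2 * Real.pi)) ^ 4 := by
      generalize f (τ - v / (2 * Real.pi)) = y
      nlinarith [mul_nonneg (sq_nonneg (y - A)) (by positivity : 0 ≤ (y + A) ^ 2 + 2 * A ^ 2)]
    have := mul_le_mul_of_nonneg_left this (Real.exp_pos (-v ^ 2)).le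
    linarith
  rw [hA1] at key ⊢
  have : (A * M) ^ 4 = M ^ 3 * (A ^ 4 * M) := by ring
  rw [this]
  refine mul_le_mul_of_nonneg_left ?_ (by positivity)
  linarith

/-- Weighted fourth power of the Dirichlet series. -/
noncomputable def wE (T : ℝ) (χ : DirichletCharacter ℂ q) (b : ℕ → ℝ) (τ : ℝ) : ℝ :=
  cw T τ * ‖E χ b τ‖ ^ 4

lemma integrable_wE {T : ℝ} (hT : 1 ≤ T) (χ : DirichletCharacter ℂ q) {b : ℕ → ℝ}
    (hb : Summable fun n => |b n|) : Integrable (wE T χ b) := by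
  refine (integrable_cw (by linarith : 0 < T)).mul_bdd (c := (∑' n, |b n|) ^ 4)
    ((continuous_E χ hb).norm.pow 4).aestronglyMeasurable (ae_of_all _ fun τ => ?_)
  rw [norm_pow, norm_norm]
  exact pow_le_pow_left₀ (norm_nonneg _) (norm_E_le χ hb τ) 4

lemma G_pow_four_le {T : ℝ} (hT : 1 ≤ T) (χ : DirichletCharacter ℂ q) (b : ℕ → ℝ) (τ : ℝ) :
    (lw T τ ^ 6)⁻¹ * G T χ b τ ^ 4 ≤ wE T χ b τ := by
  have hw := lw_pos (by linarith : 0 ≤ T) τ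
  have : (lw T τ ^ 6)⁻¹ * G T χ b τ ^ 4 = (lw T τ ^ 2)⁻¹ * ‖E χ b τ‖ ^ 4 := by
    change _ * (lw T τ * _) ^ 4 = _
    field_simp
  rw [this]
  exact mul_le_mul_of_nonneg_right (inv_lw_sq_le_cw (by linarith) τ) (by positivity)

lemma gav_G_pow_four_le {T : ℝ} (hT : 1 ≤ T) (χ : DirichletCharacter ℂ q) {b : ℕ → ℝ}
    (hb : Summable fun n => |b n|) (τ : ℝ) :
    (lw T τ ^ 6)⁻¹ * gav (G T χ b) τ ^ 4 ≤ (∫ v : ℝ, Real.exp (-v ^ 2)) ^ 3 *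
      ∫ v : ℝ, Real.exp (-v ^ 2) * (1 + |v|) ^ 6 * wE T χ b (τ - v / (2 * Real.pi)) := by
  have hM0 := integral_gauss_pos
  have hw := lw_pos (by linarith : 0 ≤ T) τ
  have h1 : Integrable fun v => Real.exp (-v ^ 2) * G T χ b (τ - v / (2 * Real.pi)) := by
    simpa using integrable_gav_G hT χ hb 1 τ
  refine (mul_le_mul_of_nonneg_left (gav_pow_four_le h1 (integrable_gav_G hT χ hb 4 τ))
    (by positivity)).trans ?_
  rw [mul_left_comm]
  refine mul_le_mul_of_nonneg_left ?_ (by positivity)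
  unfold gav
  rw [← integral_const_mul]
  have hcE := continuous_E χ hb
  have hcw := continuous_cw T
  refine integral_mono_of_nonneg (ae_of_all _ fun v => ?_) ?_ (ae_of_all _ fun v => ?_)
  · have := G_nonneg (by linarith : 0 ≤ T) χ b (τ - v / (2 * Real.pi))
    change 0 ≤ _ * (_ * _)
    positivity
  · refine (integrable_gaussMoment 6).mul_bdd (c := (∑' n, |b n|) ^ 4)
      (Continuous.aestronglyMeasurable ?_) (ae_of_all _ fun v => ?_)
    · unfold wE; fun_prop
    · have h0 : 0 ≤ wE T χ b (τ - v / (2 * Real.pi)) := mul_nonneg (cw_pos _ _).le (by positivity)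
      rw [Real.norm_of_nonneg h0]
      calc _ ≤ 1 * ‖E χ b (τ - v / (2 * Real.pi))‖ ^ 4 :=
            mul_le_mul_of_nonneg_right (cw_le_one _ _) (by positivity)
        _ ≤ _ := by rw [one_mul]; exact pow_le_pow_left₀ (norm_nonneg _) (norm_E_le χ hb _) 4
  · change (lw T τ ^ 6)⁻¹ * (_ * _) ≤ _ * _ * _
    have hw' := lw_pos (by linarith : 0 ≤ T) (τ - v / (2 * Real.pi))
    have hsh : lw T (τ - v / (2 * Real.pi)) ≤ lw T τ * (1 + |v|) := one_add_shift_le hT τ v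
    have hinv : (lw T τ ^ 6)⁻¹ ≤ (1 + |v|) ^ 6 * (lw T (τ - v / (2 * Real.pi)) ^ 6)⁻¹ := by
      have hv : 0 < 1 + |v| := by positivity
      rw [← div_eq_mul_inv, le_div_iff₀ (by positivity), inv_mul_le_iff₀ (by positivity), ← mul_pow]
      exact pow_le_pow_left₀ hw'.le hsh 6
    have hG := G_nonneg (by linarith : 0 ≤ T) χ b (τ - v / (2 * Real.pi))
    calc _ ≤ ((1 + |v|) ^ 6 * (lw T (τ - v / (2 * Real.pi)) ^ 6)⁻¹) *
          (Real.exp (-v ^ 2) * G T χ b (τ - v / (2 * Real.pi)) ^ 4) :=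
          mul_le_mul_of_nonneg_right hinv (by positivity)
      _ = Real.exp (-v ^ 2) * (1 + |v|) ^ 6 * ((lw T (τ - v / (2 * Real.pi)) ^ 6)⁻¹ *
          G T χ b (τ - v / (2 * Real.pi)) ^ 4) := by ring
      _ ≤ _ := mul_le_mul_of_nonneg_left (G_pow_four_le hT χ b _) (by positivity)

lemma exists_moment_four_LL {ε : ℝ} (hε : 0 < ε) : ∃ C : ℝ, 0 ≤ C ∧
    ∀ (q : ℕ) [NeZero q] (T : ℝ), q ≠ 1 → 1 ≤ T →
    ∑ χ : DirichletCharacter ℂ q with χ.IsPrimitive, ∫ τ, (lw T τ ^ 6)⁻¹ * ‖LL χ τ‖ ^ 4 ≤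
      C * q.totient * T * (q * T) ^ ε := by
  obtain ⟨C, hC, h⟩ := exists_fourth_moment_le (ε := ε / 2) (by positivity)
  set M : ℝ := ∫ v : ℝ, Real.exp (-v ^ 2) with hM
  have hM0 : 0 < M := integral_gauss_pos
  set m6 := gaussMoment 6
  have hm6 : 0 ≤ m6 := gaussMoment_nonneg 6
  set B : ℝ := (50 * (1 + 1 / (ε / 8))) ^ 4 * 64 with hB
  have hB0 : 0 ≤ B := by positivity
  refine ⟨B * (81 * C + 3 * (M ^ 3 * m6 * C)), by positivity, fun q _ T hq hT => ?_⟩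
  have hq1 : (1:ℝ) ≤ q := by exact_mod_cast Nat.pos_of_ne_zero (NeZero.ne q)
  have hT0 : 0 < T := by linarith
  have hZ : 1 ≤ q * T := by nlinarith
  have hZ0 : 0 < q * T := by linarith
  have hs : 1 ≤ √(q * T) := Real.one_le_sqrt.2 hZ
  have hs0 : 0 < √(q * T) := by linarith
  have b0 := lowCoef_le hs0
  have b1 := headCoef_le hs0.le
  have b2 := tailCoef_le hs0.le
  have b3 := tailCoef_zero_le hs
  have S0 := summable_of_le_maj hs0.le b0
  have S1 := summable_of_le_maj hs0.le b1
  have S2 := summable_of_le_maj hs0.le b2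
  have S3 := summable_of_le_maj hs0.le b3
  have m0 := h q T 3 _ hT (by norm_num) b0
  have m1 := h q T 1 _ hT (by norm_num) b1
  have m2 := h q T 1 _ hT (by norm_num) b2
  have m3 := h q T 1 _ hT (by norm_num) b3
  set c0 := lowCoef (√(q * T))
  set c1 := headCoef (√(q * T))
  set c2 : ℕ → ℝ := fun n => √(q * T) * tailCoef (√(q * T)) n
  set c3 := tailCoef 0
  have hlog : (50 * (1 + Real.log (q * T))) ^ 4 ≤
      (50 * (1 + 1 / (ε / 8))) ^ 4 * (q * T) ^ (ε / 2) := by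
    have h1 := Real.log_le_rpow_div hZ0.le (by positivity : 0 < ε / 8)
    have h2 := Real.one_le_rpow hZ (by positivity : 0 ≤ ε / 8)
    rw [div_eq_mul_one_div] at h1
    have hl0 : 0 ≤ Real.log (q * T) := Real.log_nonneg hZ
    calc _ ≤ (50 * (1 + 1 / (ε / 8)) * (q * T) ^ (ε / 8)) ^ 4 :=
          pow_le_pow_left₀ (by positivity) (by linarith) 4
      _ = _ := by
        rw [mul_pow _ ((_ : ℝ) ^ (_ : ℝ)), ← Real.rpow_mul_natCast (by positivity)]; congr 2; push_cast; ring
  let F : DirichletCharacter ℂ q → (ℕ → ℝ) → ℝ → ℝ := fun χ b τ =>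
    M ^ 3 * ∫ v : ℝ, Real.exp (-v ^ 2) * (1 + |v|) ^ 6 * wE T χ b (τ - v / (2 * Real.pi))
  have hF : ∀ χ b, Summable (fun n => |b n|) → Integrable (F χ b) ∧
      ∫ τ, F χ b τ = M ^ 3 * (m6 * ∫ τ, wE T χ b τ) := by
    intro χ b hb
    have := integral_gauss_conv 6 (integrable_wE hT χ hb)
    refine ⟨this.1.const_mul _, ?_⟩
    simp only [F]
    rw [integral_const_mul, this.2]
  set D : ℝ := B * (q * T) ^ (ε / 2) with hD
  have hD0 : 0 ≤ D := by positivity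
  have hpt : ∀ χ : DirichletCharacter ℂ q, χ.IsPrimitive → ∀ τ, (lw T τ ^ 6)⁻¹ * ‖LL χ τ‖ ^ 4 ≤
      D * (wE T χ c0 τ + F χ c1 τ + F χ c2 τ + F χ c3 τ) := by
    intro χ hχ τ
    have hw := lw_pos hT0.le τ
    have a0 := G_pow_four_le hT χ c0 τ
    have a1 := gav_G_pow_four_le hT χ S1 τ
    have a2 := gav_G_pow_four_le hT χ S2 τ
    have a3 := gav_G_pow_four_le hT χ S3 τ
    have n0 := G_nonneg hT0.le χ c0 τ
    have n1 := gav_nonneg (G_nonneg hT0.le χ c1) τ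
    have n2 := gav_nonneg (G_nonneg hT0.le χ c2) τ
    have n3 := gav_nonneg (G_nonneg hT0.le χ c3) τ
    have hl0 : 0 ≤ Real.log (q * T) := Real.log_nonneg hZ
    have hL := norm_LL_le χ hχ hq hT τ
    have p4 : ∀ x y z t : ℝ, 0 ≤ x → 0 ≤ y → 0 ≤ z → 0 ≤ t →
        (x + y + z + t) ^ 4 ≤ 64 * (x ^ 4 + y ^ 4 + z ^ 4 + t ^ 4) := by
      intro x y z t hx hy hz ht
      have e1 := add_pow_le (add_nonneg hx hy) (add_nonneg hz ht) 4
      have e2 := add_pow_le hx hy 4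
      have e3 := add_pow_le hz ht 4
      norm_num at e1 e2 e3
      rw [← add_assoc] at e1
      linarith
    set x0 := G T χ c0 τ
    set x1 := gav (G T χ c1) τ
    set x2 := gav (G T χ c2) τ
    set x3 := gav (G T χ c3) τ
    have h4 : ‖LL χ τ‖ ^ 4 ≤ D * (x0 ^ 4 + x1 ^ 4 + x2 ^ 4 + x3 ^ 4) := by
      calc ‖LL χ τ‖ ^ 4 ≤ (50 * (1 + Real.log (q * T)) * (x0 + x1 + x2 + x3)) ^ 4 :=
            pow_le_pow_left₀ (norm_nonneg _) hL 4
        _ = (50 * (1 + Real.log (q * T))) ^ 4 * (x0 + x1 + x2 + x3) ^ 4 := mul_pow _ _ _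
        _ ≤ ((50 * (1 + 1 / (ε / 8))) ^ 4 * (q * T) ^ (ε / 2)) *
            (64 * (x0 ^ 4 + x1 ^ 4 + x2 ^ 4 + x3 ^ 4)) :=
            mul_le_mul hlog (p4 _ _ _ _ n0 n1 n2 n3) (by positivity) (by positivity)
        _ = _ := by rw [hD, hB]; ring
    calc _ ≤ (lw T τ ^ 6)⁻¹ * (D * (x0 ^ 4 + x1 ^ 4 + x2 ^ 4 + x3 ^ 4)) :=
          mul_le_mul_of_nonneg_left h4 (by positivity)
      _ = D * ((lw T τ ^ 6)⁻¹ * x0 ^ 4 + (lw T τ ^ 6)⁻¹ * x1 ^ 4 + (lw T τ ^ 6)⁻¹ * x2 ^ 4 +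
          (lw T τ ^ 6)⁻¹ * x3 ^ 4) := by ring
      _ ≤ _ := mul_le_mul_of_nonneg_left (add_le_add (add_le_add (add_le_add a0 a1) a2) a3) hD0
  have hwE0 : ∀ (χ : DirichletCharacter ℂ q) b τ, 0 ≤ wE T χ b τ := fun χ b τ =>
    mul_nonneg (cw_pos _ _).le (by positivity)
  have hI : ∀ χ : DirichletCharacter ℂ q, χ.IsPrimitive →
      ∫ τ, (lw T τ ^ 6)⁻¹ * ‖LL χ τ‖ ^ 4 ≤ D * ((∫ τ, wE T χ c0 τ) + M ^ 3 * (m6 * ∫ τ, wE T χ c1 τ)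
        + M ^ 3 * (m6 * ∫ τ, wE T χ c2 τ) + M ^ 3 * (m6 * ∫ τ, wE T χ c3 τ)) := by
    intro χ hχ
    have i0 := integrable_wE hT χ S0
    have i1 := hF χ c1 S1
    have i2 := hF χ c2 S2
    have i3 := hF χ c3 S3
    have i01 : Integrable fun τ => wE T χ c0 τ + F χ c1 τ := i0.add i1.1
    have i02 : Integrable fun τ => wE T χ c0 τ + F χ c1 τ + F χ c2 τ := i01.add i2.1
    have i03 : Integrable fun τ => wE T χ c0 τ + F χ c1 τ + F χ c2 τ + F χ c3 τ := i02.add i3.1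
    refine (integral_mono_of_nonneg (ae_of_all _ fun τ => ?_) (i03.const_mul D)
      (ae_of_all _ (hpt χ hχ))).trans_eq ?_
    · have := lw_pos hT0.le τ
      change 0 ≤ _ * _
      positivity
    · rw [integral_const_mul, integral_add i02 i3.1, integral_add i01 i2.1, integral_add i0 i1.1,
        i1.2, i2.2, i3.2]
  have hI0 : ∀ (χ : DirichletCharacter ℂ q) b, 0 ≤ ∫ τ, wE T χ b τ := fun χ b =>
    integral_nonneg (hwE0 χ b)
  set U : ℝ := C * q.totient * T * (q * T) ^ (ε / 2) with hU
  calc _ ≤ ∑ χ : DirichletCharacter ℂ q with χ.IsPrimitive,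
        D * ((∫ τ, wE T χ c0 τ) + M ^ 3 * (m6 * ∫ τ, wE T χ c1 τ)
        + M ^ 3 * (m6 * ∫ τ, wE T χ c2 τ) + M ^ 3 * (m6 * ∫ τ, wE T χ c3 τ)) :=
        Finset.sum_le_sum fun χ hχ => hI χ (Finset.mem_filter.1 hχ).2
    _ ≤ ∑ χ : DirichletCharacter ℂ q,
        D * ((∫ τ, wE T χ c0 τ) + M ^ 3 * (m6 * ∫ τ, wE T χ c1 τ)
        + M ^ 3 * (m6 * ∫ τ, wE T χ c2 τ) + M ^ 3 * (m6 * ∫ τ, wE T χ c3 τ)) :=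
        Finset.sum_le_sum_of_subset_of_nonneg (Finset.filter_subset _ _) fun χ _ _ => by
          have := hI0 χ c0; have := hI0 χ c1; have := hI0 χ c2; have := hI0 χ c3
          positivity
    _ = D * ((∑ χ : DirichletCharacter ℂ q, ∫ τ, wE T χ c0 τ)
        + M ^ 3 * m6 * (∑ χ : DirichletCharacter ℂ q, ∫ τ, wE T χ c1 τ)
        + M ^ 3 * m6 * (∑ χ : DirichletCharacter ℂ q, ∫ τ, wE T χ c2 τ)
        + M ^ 3 * m6 * (∑ χ : DirichletCharacter ℂ q, ∫ τ, wE T χ c3 τ)) := by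
        simp_rw [← Finset.mul_sum, Finset.sum_add_distrib, ← Finset.mul_sum]; ring
    _ ≤ D * (81 * U + M ^ 3 * m6 * U + M ^ 3 * m6 * U + M ^ 3 * m6 * U) := by
        refine mul_le_mul_of_nonneg_left ?_ hD0
        have hMm : 0 ≤ M ^ 3 * m6 := by positivity
        refine add_le_add (add_le_add (add_le_add ?_ ?_) ?_) ?_
        · refine m0.trans_eq ?_; rw [hU]; ring
        · refine mul_le_mul_of_nonneg_left (m1.trans_eq ?_) hMm; rw [hU]; ring
        · refine mul_le_mul_of_nonneg_left (m2.trans_eq ?_) hMm; rw [hU]; ring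
        · refine mul_le_mul_of_nonneg_left (m3.trans_eq ?_) hMm; rw [hU]; ring
    _ = B * (81 * C + 3 * (M ^ 3 * m6 * C)) * q.totient * T * ((q * T) ^ (ε / 2) * (q * T) ^ (ε / 2)) := by
        rw [hD, hU]; ring
    _ = _ := by rw [← Real.rpow_add hZ0]; congr 2; ring

end

section
open Set Filter Topology

lemma integrable_moment_LL (k : ℕ) {q : ℕ} [NeZero q] (χ : DirichletCharacter ℂ q)
    (hχ : χ.IsPrimitive) (hq : q ≠ 1) {T : ℝ} (hT : 1 ≤ T) :
    Integrable fun τ => (lw T τ ^ (2 * k + 2))⁻¹ * ‖LL χ τ‖ ^ (2 * k) := by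
  obtain ⟨C, hC, h⟩ := exists_norm_LL_le_rpow (ε := 1) one_pos
  set A : ℝ := C * (q * T) ^ (1 / 4 + 1 : ℝ) with hA
  have hT0 : 0 < T := by linarith
  have hA0 : 0 ≤ A := by positivity
  refine ((integrable_cw hT0).mul_const (A ^ (2 * k))).mono' ?_ (ae_of_all _ fun τ => ?_)
  · have := (continuous_lw T).measurable
    have := measurable_LL χ
    exact Measurable.aestronglyMeasurable (by fun_prop)
  · have hw := lw_pos hT0.le τ
    rw [Real.norm_of_nonneg (by positivity)]
    calc _ ≤ (lw T τ ^ (2 * k + 2))⁻¹ * (A * lw T τ) ^ (2 * k) :=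
          mul_le_mul_of_nonneg_left (pow_le_pow_left₀ (norm_nonneg _) (h q χ T τ hχ hq hT) _)
            (by positivity)
      _ = (lw T τ ^ 2)⁻¹ * A ^ (2 * k) := by
          rw [mul_pow, pow_add]; field_simp
      _ ≤ _ := mul_le_mul_of_nonneg_right (inv_lw_sq_le_cw hT0.le τ) (by positivity)

lemma exists_moment_LL {k : ℕ} (hk : 2 ≤ k) {ε : ℝ} (hε : 0 < ε) : ∃ C : ℝ, 0 ≤ C ∧
    ∀ (q : ℕ) [NeZero q] (T : ℝ), q ≠ 1 → 1 ≤ T →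
    ∑ χ : DirichletCharacter ℂ q with χ.IsPrimitive,
      ∫ τ, (lw T τ ^ (2 * k + 2))⁻¹ * ‖LL χ τ‖ ^ (2 * k) ≤
      C * q.totient * T * (q * T) ^ ((k : ℝ) / 2 - 1 + ε) := by
  obtain ⟨j, rfl⟩ := Nat.exists_eq_add_of_le hk
  obtain ⟨C1, hC1, h1⟩ := exists_moment_four_LL (ε := ε / 2) (by positivity)
  obtain ⟨C2, hC2, h2⟩ := exists_norm_LL_le_rpow (ε := ε / (4 * (j + 1))) (by positivity)
  refine ⟨C2 ^ (2 * j) * C1, by positivity, fun q _ T hq hT => ?_⟩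
  have hq1 : (1:ℝ) ≤ q := by exact_mod_cast Nat.pos_of_ne_zero (NeZero.ne q)
  have hT0 : 0 < T := by linarith
  have hZ : 1 ≤ q * T := by nlinarith
  have hZ0 : 0 < q * T := by linarith
  set P : ℝ := C2 * (q * T) ^ (1 / 4 + ε / (4 * (j + 1))) with hP
  have hP0 : 0 ≤ P := by positivity
  have hexp : P ^ (2 * j) ≤ C2 ^ (2 * j) * (q * T) ^ ((j:ℝ) / 2 + ε / 2) := by
    rw [hP, mul_pow, ← Real.rpow_mul_natCast hZ0.le]
    refine mul_le_mul_of_nonneg_left (Real.rpow_le_rpow_of_exponent_le hZ ?_) (by positivity)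
    push_cast
    have : ε / (4 * ((j:ℝ) + 1)) * (2 * j) ≤ ε / 2 := by
      rw [div_mul_eq_mul_div, div_le_div_iff₀ (by positivity) (by norm_num)]
      nlinarith
    linarith
  calc _ ≤ ∑ χ : DirichletCharacter ℂ q with χ.IsPrimitive,
        ∫ τ, P ^ (2 * j) * ((lw T τ ^ 6)⁻¹ * ‖LL χ τ‖ ^ 4) := by
        refine Finset.sum_le_sum fun χ hχ => ?_
        have hχ' := (Finset.mem_filter.1 hχ).2
        refine integral_mono (integrable_moment_LL _ χ hχ' hq hT)
          ((integrable_moment_LL 2 χ hχ' hq hT).const_mul _) fun τ => ?_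
        have hw := lw_pos hT0.le τ
        change _ * _ ≤ _
        calc _ = (lw T τ ^ (6 + 2 * j))⁻¹ * (‖LL χ τ‖ ^ (2 * j) * ‖LL χ τ‖ ^ 4) := by
              rw [← pow_add]; congr 2 <;> ring
          _ ≤ (lw T τ ^ (6 + 2 * j))⁻¹ * ((P * lw T τ) ^ (2 * j) * ‖LL χ τ‖ ^ 4) := by
              refine mul_le_mul_of_nonneg_left (mul_le_mul_of_nonneg_right ?_ (by positivity))
                (by positivity)
              exact pow_le_pow_left₀ (norm_nonneg _) (h2 q χ T τ hχ' hq hT) _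
          _ = _ := by rw [mul_pow, pow_add]; field_simp
    _ = P ^ (2 * j) * ∑ χ : DirichletCharacter ℂ q with χ.IsPrimitive,
        ∫ τ, (lw T τ ^ 6)⁻¹ * ‖LL χ τ‖ ^ 4 := by
        rw [Finset.mul_sum]; simp_rw [integral_const_mul]
    _ ≤ (C2 ^ (2 * j) * (q * T) ^ ((j:ℝ) / 2 + ε / 2)) * (C1 * q.totient * T * (q * T) ^ (ε / 2)) := by
        refine mul_le_mul hexp (h1 q T hq hT) (Finset.sum_nonneg fun χ _ => integral_nonneg fun τ => ?_)
          (by positivity)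
        have hw := lw_pos hT0.le τ
        change 0 ≤ _ * _
        positivity
    _ = C2 ^ (2 * j) * C1 * q.totient * T * ((q * T) ^ ((j:ℝ) / 2 + ε / 2) * (q * T) ^ (ε / 2)) := by
        ring
    _ = _ := by
        rw [← Real.rpow_add hZ0]; congr 2; push_cast; ring

end

section
open Set Filter Topology

/-- `h` vanishes beyond `C` and is given on the positive reals by a rapidly decaying Mellin
transform `g` on the critical line. -/
structure Nice (C : ℝ) (h g : ℝ → ℂ) : Prop where
  pos : 0 < C
  vanish : ∀ y, C ≤ y → h y = 0
  integrable : ∀ N : ℕ, Integrable fun τ => (((1 + |τ|) ^ N : ℝ) : ℂ) * g τ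
  eq : ∀ x, 0 < x → h x = ∫ τ, g τ * ker x τ

/-- Summation against the coefficients `c` acts on Mellin transforms as multiplication by `P`. -/
structure IsMultiplier (c : ArithmeticFunction ℂ) (P : ℝ → ℂ) : Prop where
  measurable : Measurable P
  bound : ∃ (A : ℝ) (N : ℕ), ∀ τ, ‖P τ‖ ≤ A * (1 + |τ|) ^ N
  eq : ∀ (C : ℝ) (h g : ℝ → ℂ), Nice C h g → ∀ (x : ℝ), 0 < x → ∀ K : ℕ, C ≤ K * x →
    ∑ n ∈ Finset.Ioc 0 K, c n * h (n * x) = ∫ τ, g τ * P τ * ker x τ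

lemma Nice.integrable_self {C : ℝ} {h g : ℝ → ℂ} (H : Nice C h g) : Integrable g := by
  simpa using H.integrable 0

lemma Nice.integrable_norm {C : ℝ} {h g : ℝ → ℂ} (H : Nice C h g) (N : ℕ) :
    Integrable fun τ => (1 + |τ|) ^ N * ‖g τ‖ := by
  refine (H.integrable N).norm.congr (Eventually.of_forall fun τ => ?_)
  simp only [norm_mul, norm_real]
  rw [Real.norm_of_nonneg (by positivity)]

lemma IsMultiplier.integrable_mul {c : ArithmeticFunction ℂ} {P : ℝ → ℂ} (hP : IsMultiplier c P)
    {C : ℝ} {h g : ℝ → ℂ} (H : Nice C h g) (N : ℕ) :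
    Integrable fun τ => (((1 + |τ|) ^ N : ℝ) : ℂ) * (g τ * P τ) := by
  obtain ⟨A, M, hb⟩ := hP.bound
  refine ((H.integrable_norm (N + M)).const_mul A).mono' ?_ (Eventually.of_forall fun τ => ?_)
  · exact Continuous.aestronglyMeasurable (by fun_prop) |>.mul
      (H.integrable_self.aestronglyMeasurable.mul hP.measurable.aestronglyMeasurable)
  · rw [norm_mul, norm_mul, norm_real, Real.norm_of_nonneg (by positivity)]
    calc _ ≤ (1 + |τ|) ^ N * (‖g τ‖ * (A * (1 + |τ|) ^ M)) := by
            gcongr; exact hb τ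
      _ = _ := by rw [pow_add]; ring

lemma IsMultiplier.nice {c : ArithmeticFunction ℂ} {P : ℝ → ℂ} (hP : IsMultiplier c P)
    {C : ℝ} {h g : ℝ → ℂ} (H : Nice C h g) :
    Nice C (fun y => ∫ τ, g τ * P τ * ker y τ) (fun τ => g τ * P τ) where
  pos := H.pos
  vanish y hy := by
    have h1 := hP.eq C h g H y (H.pos.trans_le hy) 1 (by simpa using hy)
    change (∫ τ, g τ * P τ * ker y τ) = 0
    rw [← h1]
    simp [H.vanish y hy]
  integrable := hP.integrable_mul H
  eq _ _ := rfl

lemma integrable_mul_ker {f : ℝ → ℂ} (hf : Integrable f) (x : ℝ) :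
    Integrable fun τ => f τ * ker x τ := by
  refine (hf.norm.mul_const (Real.exp (-(Real.log x) / 2))).mono'
    (hf.aestronglyMeasurable.mul (continuous_ker x).aestronglyMeasurable)
    (Eventually.of_forall fun τ => ?_)
  rw [norm_mul, norm_ker]

lemma IsMultiplier.integrable_ker {c : ArithmeticFunction ℂ} {P : ℝ → ℂ} (hP : IsMultiplier c P)
    {C : ℝ} {h g : ℝ → ℂ} (H : Nice C h g) (x : ℝ) :
    Integrable fun τ => g τ * P τ * ker x τ :=
  integrable_mul_ker (hP.nice H).integrable_self x

lemma IsMultiplier.mul {c d : ArithmeticFunction ℂ} {P R : ℝ → ℂ} (hP : IsMultiplier c P)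
    (hR : IsMultiplier d R) : IsMultiplier (c * d) (fun τ => R τ * P τ) where
  measurable := hR.measurable.mul hP.measurable
  bound := by
    obtain ⟨A, N, h1⟩ := hR.bound
    obtain ⟨B, M, h2⟩ := hP.bound
    refine ⟨A * B, N + M, fun τ => ?_⟩
    rw [norm_mul, pow_add]
    calc _ ≤ (A * (1 + |τ|) ^ N) * (B * (1 + |τ|) ^ M) :=
          mul_le_mul (h1 τ) (h2 τ) (norm_nonneg _) ((norm_nonneg _).trans (h1 τ))
      _ = _ := by ring
  eq C h g H x hx K hK := by
    have key := hP.eq C _ _ (hR.nice H) x hx K hK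
    have e : (∫ τ, g τ * (R τ * P τ) * ker x τ) = ∫ τ, g τ * R τ * P τ * ker x τ := by
      congr 1; ext τ; ring
    rw [e, ← key]
    have h1 : ∀ a ∈ Finset.Ioc 0 K, c a * ∫ τ, g τ * R τ * ker (a * x) τ
        = ∑ b ∈ Finset.Ioc 0 K, c a * (d b * h (a * b * x)) := by
      intro a ha
      have ha1 : (1:ℝ) ≤ a := by exact_mod_cast (Finset.mem_Ioc.1 ha).1
      rw [← hR.eq C h g H (a * x) (by positivity) K, Finset.mul_sum]
      · refine Finset.sum_congr rfl fun b _ => ?_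
        rw [show (a:ℝ) * b * x = b * (a * x) by ring]
      · refine hK.trans ?_
        nlinarith [mul_nonneg (Nat.cast_nonneg (α := ℝ) K) hx.le]
    rw [Finset.sum_congr rfl h1, ← Finset.sum_product' (f := fun a b : ℕ => c a * (d b * h (a * b * x)))]
    have h2 : ∀ n ∈ Finset.Ioc 0 K, (c * d) n * h (n * x) =
        ∑ p ∈ (Finset.Ioc 0 K ×ˢ Finset.Ioc 0 K) with p.1 * p.2 = n,
          c p.1 * (d p.2 * h (p.1 * p.2 * x)) := by
      intro n hn
      rw [ArithmeticFunction.mul_apply, Finset.sum_mul]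
      have hn' := Finset.mem_Ioc.1 hn
      refine Finset.sum_congr ?_ ?_
      · ext p
        simp only [Nat.mem_divisorsAntidiagonal, Finset.mem_filter, Finset.mem_product,
          Finset.mem_Ioc]
        constructor
        · rintro ⟨h1, h2⟩
          have hp1 : 0 < p.1 := Nat.pos_of_ne_zero fun h => by simp [h] at h1; omega
          have hp2 : 0 < p.2 := Nat.pos_of_ne_zero fun h => by simp [h] at h1; omega
          refine ⟨⟨⟨hp1, ?_⟩, ⟨hp2, ?_⟩⟩, h1⟩ <;> nlinarith
        · rintro ⟨_, h⟩; exact ⟨h, by omega⟩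
      · intro p hp
        have : p.1 * p.2 = n := (Finset.mem_filter.1 hp).2
        rw [← this]; push_cast; ring
    rw [Finset.sum_congr rfl h2]
    rw [Finset.sum_fiberwise_eq_sum_filter]
    refine Finset.sum_filter_of_ne fun p hp hne => ?_
    have hp' := Finset.mem_product.1 hp
    refine Finset.mem_Ioc.2 ⟨Nat.mul_pos (Finset.mem_Ioc.1 hp'.1).1 (Finset.mem_Ioc.1 hp'.2).1, ?_⟩
    by_contra hlt
    apply hne
    rw [H.vanish, mul_zero, mul_zero]
    have : (K:ℝ) ≤ p.1 * p.2 := by exact_mod_cast (not_le.1 hlt).le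
    exact hK.trans (mul_le_mul_of_nonneg_right this hx.le)

lemma IsMultiplier.zero : IsMultiplier 0 (fun _ => 0) where
  measurable := measurable_const
  bound := ⟨0, 0, by simp⟩
  eq := by simp

lemma IsMultiplier.add {c d : ArithmeticFunction ℂ} {P R : ℝ → ℂ} (hP : IsMultiplier c P)
    (hR : IsMultiplier d R) : IsMultiplier (c + d) (fun τ => P τ + R τ) where
  measurable := hP.measurable.add hR.measurable
  bound := by
    obtain ⟨A, N, h1⟩ := hP.bound
    obtain ⟨B, M, h2⟩ := hR.bound
    refine ⟨|A| + |B|, N + M, fun τ => (norm_add_le _ _).trans ?_⟩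
    have hb : (1:ℝ) ≤ 1 + |τ| := by linarith [abs_nonneg τ]
    rw [add_mul]
    refine add_le_add ((h1 τ).trans ?_) ((h2 τ).trans ?_)
    · exact mul_le_mul (le_abs_self A) (pow_le_pow_right₀ hb (by omega)) (by positivity)
        (abs_nonneg _)
    · exact mul_le_mul (le_abs_self B) (pow_le_pow_right₀ hb (by omega)) (by positivity)
        (abs_nonneg _)
  eq C h g H x hx K hK := by
    have e : (∫ τ, g τ * (P τ + R τ) * ker x τ) =
        ∫ τ, (g τ * P τ * ker x τ + g τ * R τ * ker x τ) := by
      congr 1; ext τ; ring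
    rw [e, integral_add (hP.integrable_ker H x) (hR.integrable_ker H x), ← hP.eq C h g H x hx K hK,
      ← hR.eq C h g H x hx K hK, ← Finset.sum_add_distrib]
    refine Finset.sum_congr rfl fun n _ => ?_
    rw [ArithmeticFunction.add_apply, add_mul]

lemma IsMultiplier.sum {ι : Type*} (s : Finset ι) {c : ι → ArithmeticFunction ℂ} {P : ι → ℝ → ℂ}
    (hP : ∀ i ∈ s, IsMultiplier (c i) (P i)) :
    IsMultiplier (∑ i ∈ s, c i) (fun τ => ∑ i ∈ s, P i τ) := by
  induction s using Finset.induction_on with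
  | empty => simpa using IsMultiplier.zero
  | insert a s ha ih =>
    simp only [Finset.sum_insert ha]
    exact (hP a (Finset.mem_insert_self _ _)).add
      (ih fun i hi => hP i (Finset.mem_insert_of_mem hi))

/-- The arithmetic function supported at `e ≠ 0` with value `v`. -/
noncomputable def pointFn (e : ℕ) (v : ℂ) : ArithmeticFunction ℂ :=
  ⟨fun n => if n = e ∧ n ≠ 0 then v else 0, by simp⟩

lemma pointFn_apply (e : ℕ) (v : ℂ) (n : ℕ) :
    pointFn e v n = if n = e ∧ n ≠ 0 then v else 0 := rfl

lemma IsMultiplier.pointFn {e : ℕ} (he : 0 < e) (v : ℂ) :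
    IsMultiplier (pointFn e v) (fun τ => v * ker e τ) where
  measurable := ((continuous_ker e).measurable.const_mul v)
  bound := ⟨‖v‖ * Real.exp (-(Real.log e) / 2), 0, fun τ => by
    rw [norm_mul, norm_ker, pow_zero, mul_one]⟩
  eq C h g H x hx K hK := by
    have he' : (0:ℝ) < e := by exact_mod_cast he
    have e1 : (∫ τ, g τ * (v * ker e τ) * ker x τ) = v * h (e * x) := by
      rw [H.eq _ (by positivity), ← integral_const_mul]
      congr 1; ext τ; rw [ker_mul he' hx]; ring
    rw [e1]
    by_cases hK' : e ≤ K
    · rw [Finset.sum_eq_single e]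
      · simp [pointFn_apply, he.ne']
      · intro b _ hb; simp [pointFn_apply, hb]
      · intro hn; exact absurd (Finset.mem_Ioc.2 ⟨he, hK'⟩) hn
    · rw [H.vanish (e * x), mul_zero]
      · refine Finset.sum_eq_zero fun n hn => ?_
        have := (Finset.mem_Ioc.1 hn).2
        rw [pointFn_apply, if_neg (by omega), zero_mul]
      · refine hK.trans (mul_le_mul_of_nonneg_right ?_ hx.le)
        exact_mod_cast (not_le.1 hK').le

end

section
open Set Filter Topology

/-- A Dirichlet character as an arithmetic function. -/
noncomputable def charFn {q : ℕ} (χ : DirichletCharacter ℂ q) : ArithmeticFunction ℂ :=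
  ⟨fun n => if n = 0 then 0 else χ n, by simp⟩

lemma charFn_apply {q : ℕ} (χ : DirichletCharacter ℂ q) {n : ℕ} (hn : n ≠ 0) :
    charFn χ n = χ n := if_neg hn

section
variable {q : ℕ}

lemma integral_mul_DS (χ : DirichletCharacter ℂ q) {C : ℝ} {h g : ℝ → ℂ} (H : Nice C h g)
    {x : ℝ} (hx : 0 < x) {K : ℕ} (hK : C ≤ K * x) (s : ℝ) :
    ∫ τ, g τ * DS χ s τ * ker x τ =
      ∑ n ∈ Finset.Ioc 0 K, χ n * W (Real.log n - s) * h (n * x) := by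
  set B : ℝ := Real.exp (-(Real.log x) / 2) with hB
  obtain ⟨F, hF⟩ : ∃ F : ℕ → ℝ → ℂ, F = fun (n : ℕ) τ => g τ * (χ n * bump τ s n) * ker x τ := ⟨_, rfl⟩
  have hbn : ∀ (n : ℕ) (τ : ℝ), ‖χ n * bump τ s n‖ = ‖χ n * bump 0 s n‖ := fun n τ => by
    rw [norm_mul, norm_mul, norm_bump_nat, norm_bump_nat]
  have hFn : ∀ (n : ℕ) (τ : ℝ), ‖F n τ‖ = ‖χ n * bump 0 s n‖ * (‖g τ‖ * B) := fun n τ => by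
    rw [hF]; simp only []; rw [norm_mul, norm_mul, hbn, norm_ker]; ring
  have hgi := H.integrable_self
  have hFi : ∀ n, Integrable (F n) := by
    intro n
    refine Integrable.mono' (g := fun τ => ‖χ n * bump 0 s n‖ * (‖g τ‖ * B))
      ((hgi.norm.mul_const B).const_mul _) ?_ (Eventually.of_forall fun τ => (hFn n τ).le)
    have h0 : Continuous fun τ : ℝ => ((s, τ) : ℝ × ℝ) := by fun_prop
    have h1 := (continuous_bump_nat n).comp h0
    simp only [Function.comp_def] at h1
    have h2 : Continuous fun τ : ℝ => χ n * bump τ s (n : ℝ) := h1.const_mul _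
    rw [hF]
    exact (hgi.aestronglyMeasurable.mul h2.aestronglyMeasurable).mul
      (continuous_ker x).aestronglyMeasurable
  have hsum : Summable fun n => ∫ τ, ‖F n τ‖ := by
    simp_rw [hFn, integral_const_mul]
    exact (summable_DS χ s 0).norm.mul_right _
  have key := integral_tsum_of_summable_integral_norm hFi hsum
  have e1 : ∀ τ, ∑' n, F n τ = g τ * DS χ s τ * ker x τ := fun τ => by
    simp only [hF]; rw [tsum_mul_right, tsum_mul_left]; rfl
  simp_rw [e1] at key
  rw [← key]
  have e2 : ∀ n : ℕ, 0 < n → ∫ τ, F n τ = χ n * W (Real.log n - s) * h (n * x) := by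
    intro n hn
    have hn' : (0:ℝ) < n := by exact_mod_cast hn
    rw [H.eq _ (by positivity), ← integral_const_mul]
    congr 1; ext τ
    simp only [hF, bump, if_pos hn']
    rw [ker_mul hn' hx]; ring
  rw [tsum_eq_sum (s := Finset.Ioc 0 K)]
  · exact Finset.sum_congr rfl fun n hn => e2 n (Finset.mem_Ioc.1 hn).1
  · intro n hn
    rcases Nat.eq_zero_or_pos n with rfl | h0
    · simp [hF, bump]
    · rw [e2 n h0, H.vanish, mul_zero]
      refine hK.trans (mul_le_mul_of_nonneg_right ?_ hx.le)
      have : ¬ n ≤ K := fun h => hn (Finset.mem_Ioc.2 ⟨h0, h⟩)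
      exact_mod_cast (not_le.1 this).le

lemma isMultiplier_LL [NeZero q] (χ : DirichletCharacter ℂ q) (hχ : χ.IsPrimitive) (hq1 : q ≠ 1) :
    IsMultiplier (charFn χ) (LL χ) where
  measurable := measurable_LL χ
  bound := by
    obtain ⟨A, _, h⟩ := exists_norm_LL_le χ hχ hq1
    exact ⟨A, 1, fun τ => by simpa using h τ⟩
  eq C h g H x hx K hK := by
    obtain ⟨A, hA, hD⟩ := exists_norm_DS_le χ hχ hq1
    set B : ℝ := Real.exp (-(Real.log x) / 2) with hB
    have hinteg : Integrable (Function.uncurry fun τ s => g τ * DS χ s τ * ker x τ)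
        (volume.prod volume) := by
      have h1 : Integrable (fun p : ℝ × ℝ => ((1 + |p.1|) ^ 1 * ‖g p.1‖) *
          (B * A * Real.exp (-|p.2|))) (volume.prod volume) :=
        (H.integrable_norm 1).mul_prod (integrable_exp_neg_abs.const_mul (B * A))
      refine h1.mono' ?_ (Eventually.of_forall fun p => ?_)
      · refine (AEStronglyMeasurable.mul ?_ ?_).mul ?_
        · exact H.integrable_self.aestronglyMeasurable.comp_fst
        · exact ((measurable_DS χ).comp measurable_swap).aestronglyMeasurable
        · exact ((continuous_ker x).comp continuous_fst).aestronglyMeasurable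
      · simp only [Function.uncurry]
        rw [norm_mul, norm_mul, norm_ker]
        have h2 := hD p.2 p.1
        calc ‖g p.1‖ * ‖DS χ p.2 p.1‖ * B ≤
            ‖g p.1‖ * (A * Real.exp (-|p.2|) * (1 + |p.1|)) * B := by
              gcongr
          _ = _ := by ring
    have e1 : ∀ τ, g τ * LL χ τ * ker x τ = ∫ s, g τ * DS χ s τ * ker x τ := by
      intro τ
      rw [integral_mul_const, integral_const_mul]; rfl
    simp_rw [e1]
    rw [integral_integral_swap hinteg]
    simp_rw [integral_mul_DS χ H hx hK]
    have hWi : ∀ n : ℕ, Integrable fun s => W (Real.log n - s) := fun n =>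
      integrable_W.comp_sub_left (Real.log n)
    rw [integral_finsetSum]
    · refine Finset.sum_congr rfl fun n hn => ?_
      rw [integral_mul_const, integral_const_mul, charFn_apply χ (Finset.mem_Ioc.1 hn).1.ne',
        integral_complex_ofReal, integral_sub_left_eq_self W volume (Real.log n), integral_W]
      simp
    · intro n _
      exact ((hWi n).ofReal.const_mul _).mul_const _

end

/-- The restriction of an arithmetic function to integers coprime to `m`. -/
noncomputable def coprimePart (m : ℕ) (c : ArithmeticFunction ℂ) : ArithmeticFunction ℂ :=
  ⟨fun n => if n.Coprime m then c n else 0, by simp⟩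

lemma coprimePart_apply (m : ℕ) (c : ArithmeticFunction ℂ) (n : ℕ) :
    coprimePart m c n = if n.Coprime m then c n else 0 := rfl

lemma sum_moebius_gcd {n m : ℕ} (hn : n ≠ 0) (hm : m ≠ 0) :
    ∑ e ∈ m.divisors with e ∣ n, ((ArithmeticFunction.moebius e : ℤ) : ℂ) =
      if n.Coprime m then 1 else 0 := by
  have h1 : (m.divisors.filter (· ∣ n)) = (n.gcd m).divisors := by
    ext e
    simp only [Finset.mem_filter, Nat.mem_divisors, Nat.dvd_gcd_iff, ne_eq, Nat.gcd_eq_zero_iff]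
    tauto
  rw [h1]
  have h2 := congrArg (fun f : ArithmeticFunction ℤ => f (n.gcd m))
    ArithmeticFunction.moebius_mul_coe_zeta
  simp only [ArithmeticFunction.coe_mul_zeta_apply, ArithmeticFunction.one_apply] at h2
  have h3 := congrArg (Int.cast : ℤ → ℂ) h2
  push_cast at h3
  exact h3

lemma sum_arith_apply {ι : Type*} (s : Finset ι) (f : ι → ArithmeticFunction ℂ) (n : ℕ) :
    (∑ i ∈ s, f i) n = ∑ i ∈ s, f i n := by
  induction s using Finset.induction_on with
  | empty => simp
  | insert a s ha ih => rw [Finset.sum_insert ha, Finset.sum_insert ha,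
      ArithmeticFunction.add_apply, ih]

lemma coprimePart_charFn {q : ℕ} (χ : DirichletCharacter ℂ q) {m : ℕ} (hm : m ≠ 0) :
    coprimePart m (charFn χ) = charFn χ *
      ∑ e ∈ m.divisors, pointFn e ((ArithmeticFunction.moebius e : ℤ) * χ e) := by
  ext n
  rcases eq_or_ne n 0 with rfl | hn
  · simp
  rw [Finset.mul_sum, sum_arith_apply, coprimePart_apply, charFn_apply χ hn]
  have h1 : ∀ e ∈ m.divisors,
      (charFn χ * pointFn e ((ArithmeticFunction.moebius e : ℤ) * χ e)) n =
      if e ∣ n then ((ArithmeticFunction.moebius e : ℤ) : ℂ) * χ n else 0 := by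
    intro e he
    have he0 : e ≠ 0 := (Nat.pos_of_mem_divisors he).ne'
    rw [ArithmeticFunction.mul_apply]
    split_ifs with hd
    · obtain ⟨b, rfl⟩ := hd
      have hb : b ≠ 0 := fun h => hn (by simp [h])
      rw [Finset.sum_eq_single (b, e)]
      · rw [charFn_apply χ hb, pointFn_apply, if_pos ⟨rfl, he0⟩]
        push_cast; rw [map_mul]; ring
      · rintro ⟨x, y⟩ hxy hne
        rw [pointFn_apply, if_neg, mul_zero]
        rintro ⟨h, h'⟩
        have h2 := (Nat.mem_divisorsAntidiagonal.1 hxy).1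
        simp only at h h2
        subst h
        apply hne
        rw [Nat.eq_of_mul_eq_mul_right (Nat.pos_of_ne_zero he0) (h2.trans (mul_comm _ _))]
      · intro hh; exact absurd (Nat.mem_divisorsAntidiagonal.2 ⟨mul_comm _ _, hn⟩) hh
    · refine Finset.sum_eq_zero fun p hp => ?_
      rw [pointFn_apply, if_neg, mul_zero]
      rintro ⟨h, -⟩
      exact hd ⟨p.1, by rw [← (Nat.mem_divisorsAntidiagonal.1 hp).1, h, mul_comm]⟩
  rw [Finset.sum_congr rfl h1, ← Finset.sum_filter, ← Finset.sum_mul, sum_moebius_gcd hn hm]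
  split_ifs <;> simp

end

section
open Set Filter Topology

lemma finite_dk (k : ℕ) {n : ℕ} (hn : 0 < n) :
    Finite {f : Fin k → ℕ // (∀ i, 0 < f i) ∧ ∏ i, f i = n} := by
  let g : {f : Fin k → ℕ // (∀ i, 0 < f i) ∧ ∏ i, f i = n} → (Fin k → n.divisors) :=
    fun f i => ⟨f.1 i, Nat.mem_divisors.2 ⟨by
      have h := Finset.dvd_prod_of_mem f.1 (Finset.mem_univ i)
      rwa [f.2.2] at h, hn.ne'⟩⟩
  refine Finite.of_injective g fun f1 f2 h => ?_
  ext i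
  exact congrArg Subtype.val (congrFun h i)

lemma dk_zero (n : ℕ) : dk 0 n = if n = 1 then 1 else 0 := by
  unfold dk
  split_ifs with h
  · subst h
    rw [Nat.card_eq_one_iff_unique]
    exact ⟨⟨fun a b => Subsingleton.elim _ _⟩, ⟨⟨fun _ => 1, by simp⟩⟩⟩
  · have : IsEmpty {f : Fin 0 → ℕ // (∀ i, 0 < f i) ∧ ∏ i, f i = n} :=
      ⟨fun f => h (by simpa using f.2.2.symm)⟩
    exact Nat.card_of_isEmpty

lemma dk_succ (k : ℕ) {n : ℕ} (hn : 0 < n) : dk (k + 1) n = ∑ d ∈ n.divisors, dk k d := by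
  have : ∀ d : n.divisors, Finite {f : Fin k → ℕ // (∀ i, 0 < f i) ∧ ∏ i, f i = d.1} :=
    fun d => finite_dk k (Nat.pos_of_mem_divisors d.2)
  rw [← Finset.sum_coe_sort]
  unfold dk
  rw [← Nat.card_sigma]
  refine Nat.card_congr
    { toFun := fun f => ⟨⟨∏ i, f.1 (Fin.succ i), Nat.mem_divisors.2 ⟨?_, hn.ne'⟩⟩,
        ⟨fun i => f.1 (Fin.succ i), fun i => f.2.1 _, rfl⟩⟩
      invFun := fun p => ⟨Fin.cons (n / p.1.1) p.2.1, ?_, ?_⟩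
      left_inv := ?_
      right_inv := ?_ }
  · have h := f.2.2
    rw [Fin.prod_univ_succ] at h
    exact ⟨f.1 0, by rw [mul_comm]; exact h.symm⟩
  · intro i
    refine Fin.cases ?_ (fun j => ?_) i
    · exact Nat.div_pos (Nat.divisor_le p.1.2) (Nat.pos_of_mem_divisors p.1.2)
    · exact p.2.2.1 j
  · rw [Fin.prod_univ_succ]
    simp only [Fin.cons_zero, Fin.cons_succ]
    rw [p.2.2.2, Nat.div_mul_cancel (Nat.dvd_of_mem_divisors p.1.2)]
  · rintro ⟨f, hf, hp⟩
    ext i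
    refine Fin.cases ?_ (fun j => ?_) i
    · simp only [Fin.cons_zero]
      rw [Fin.prod_univ_succ] at hp
      rw [← hp]
      exact Nat.mul_div_cancel _ (Finset.prod_pos fun i _ => hf _)
    · rfl
  · rintro ⟨⟨d, hd⟩, ⟨f, hf, hp⟩⟩
    simp only [Fin.cons_succ] at hp ⊢
    subst hp
    rfl

lemma dk_succ_mul (k : ℕ) {G M : ℕ} (hG : 0 < G) (hM : 0 < M) :
    dk (k + 1) (G * M) = ∑ g ∈ G.divisors, ∑ p ∈ M.divisorsAntidiagonal with p.1.Coprime g,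
      dk k (g * p.2) := by
  rw [dk_succ k (Nat.mul_pos hG hM), Finset.sum_sigma' (s := G.divisors)
    (t := fun g => M.divisorsAntidiagonal.filter fun p => p.1.Coprime g)
    (f := fun g p => dk k (g * p.2))]
  symm
  refine Finset.sum_bij (fun x _ => x.1 * x.2.2) ?_ ?_ ?_ (fun _ _ => rfl)
  · rintro ⟨g, a, b⟩ hx
    simp only [Finset.mem_sigma, Nat.mem_divisors, Finset.mem_filter,
      Nat.mem_divisorsAntidiagonal] at hx ⊢
    exact ⟨Nat.mul_dvd_mul hx.1.1 ⟨a, by rw [← hx.2.1.1, mul_comm]⟩, (Nat.mul_pos hG hM).ne'⟩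
  · rintro ⟨g, a, b⟩ hx ⟨g', a', b'⟩ hx' h
    simp only [Finset.mem_sigma, Nat.mem_divisors, Finset.mem_filter,
      Nat.mem_divisorsAntidiagonal] at hx hx' h
    obtain ⟨⟨⟨u, hu⟩, -⟩, ⟨hab, -⟩, hc⟩ := hx
    obtain ⟨⟨⟨u', hu'⟩, -⟩, ⟨hab', -⟩, hc'⟩ := hx'
    have hD : 0 < g * b := by
      refine Nat.pos_of_ne_zero fun h0 => ?_
      rcases Nat.mul_eq_zero.1 h0 with rfl | rfl
      · simp at hu; omega
      · simp at hab; omega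
    have h1 : u * a = u' * a' := by
      refine Nat.eq_of_mul_eq_mul_right hD ?_
      calc u * a * (g * b) = (g * u) * (a * b) := by ring
        _ = (g' * u') * (a' * b') := by rw [← hu, ← hu', hab, hab']
        _ = u' * a' * (g * b) := by rw [h]; ring
    have h2 : u = u' := by
      have e1 : Nat.gcd (u * a) G = u := by
        rw [hu, mul_comm g u, Nat.gcd_mul_left, hc.gcd_eq_one, mul_one]
      have e2 : Nat.gcd (u' * a') G = u' := by
        rw [hu', mul_comm g' u', Nat.gcd_mul_left, hc'.gcd_eq_one, mul_one]
      rw [← e1, h1, e2]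
    subst h2
    have hu0 : 0 < u := Nat.pos_of_ne_zero fun h0 => by simp [h0] at hu; omega
    have h3 : a = a' := Nat.eq_of_mul_eq_mul_left hu0 h1
    subst h3
    have ha0 : 0 < a := Nat.pos_of_ne_zero fun h0 => by simp [h0] at hab; omega
    have h4 : b = b' := Nat.eq_of_mul_eq_mul_left ha0 (hab.trans hab'.symm)
    have h5 : g = g' := Nat.eq_of_mul_eq_mul_right hu0 (hu.symm.trans hu')
    rw [h4, h5]
  · intro D hD
    obtain ⟨⟨d, hd⟩, -⟩ := Nat.mem_divisors.1 hD
    have hu0 : 0 < Nat.gcd d G := Nat.gcd_pos_of_pos_right _ hG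
    obtain ⟨a, ha⟩ := Nat.gcd_dvd_left d G
    obtain ⟨g, hg⟩ := Nat.gcd_dvd_right d G
    set u := Nat.gcd d G with hu
    have hc : a.Coprime g := by
      have : u * Nat.gcd a g = u * 1 := by
        rw [← Nat.gcd_mul_left, ← ha, ← hg, mul_one]
      exact Nat.eq_of_mul_eq_mul_left hu0 this
    have h1 : g * M = D * a := by
      refine Nat.eq_of_mul_eq_mul_left hu0 ?_
      calc u * (g * M) = G * M := by rw [hg]; ring
        _ = D * d := hd
        _ = u * (D * a) := by rw [ha]; ring
    have h2 : a ∣ M := hc.dvd_of_dvd_mul_left ⟨D, by rw [h1, mul_comm]⟩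
    obtain ⟨b, hb⟩ := h2
    have ha0 : 0 < a := Nat.pos_of_ne_zero fun h0 => by simp [h0] at hb; omega
    refine ⟨⟨g, a, b⟩, ?_, ?_⟩
    · simp only [Finset.mem_sigma, Nat.mem_divisors, Finset.mem_filter,
        Nat.mem_divisorsAntidiagonal]
      exact ⟨⟨⟨u, by rw [hg]; ring⟩, hG.ne'⟩, ⟨hb.symm, hM.ne'⟩, hc⟩
    · refine Nat.eq_of_mul_eq_mul_left ha0 ?_
      calc a * (g * b) = g * (a * b) := by ring
        _ = g * M := by rw [hb]
        _ = a * D := by rw [h1, mul_comm]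

/-- The arithmetic function `n ↦ d_k (G n) χ n`. -/
noncomputable def dkFn (k G : ℕ) {q : ℕ} (χ : DirichletCharacter ℂ q) : ArithmeticFunction ℂ :=
  ⟨fun n => if n = 0 then 0 else dk k (G * n) * χ n, by simp⟩

lemma dkFn_apply (k G : ℕ) {q : ℕ} (χ : DirichletCharacter ℂ q) {n : ℕ} (hn : n ≠ 0) :
    dkFn k G χ n = dk k (G * n) * χ n := if_neg hn

lemma dkFn_succ (k : ℕ) {G : ℕ} (hG : 0 < G) {q : ℕ} (χ : DirichletCharacter ℂ q) :
    dkFn (k + 1) G χ = ∑ g ∈ G.divisors, coprimePart g (charFn χ) * dkFn k g χ := by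
  ext n
  rcases eq_or_ne n 0 with rfl | hn
  · simp
  rw [sum_arith_apply, dkFn_apply _ _ _ hn, dk_succ_mul k hG (Nat.pos_of_ne_zero hn)]
  push_cast
  rw [Finset.sum_mul]
  refine Finset.sum_congr rfl fun g _ => ?_
  rw [ArithmeticFunction.mul_apply, Finset.sum_filter, Finset.sum_mul]
  refine Finset.sum_congr rfl fun p hp => ?_
  obtain ⟨h1, -⟩ := Nat.mem_divisorsAntidiagonal.1 hp
  have hp1 : p.1 ≠ 0 := fun h => by simp [h] at h1; omega
  have hp2 : p.2 ≠ 0 := fun h => by simp [h] at h1; omega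
  rw [coprimePart_apply, charFn_apply χ hp1, dkFn_apply _ _ _ hp2, ← h1]
  push_cast
  rw [map_mul]
  split_ifs <;> ring

lemma norm_ker_nat_le_one {e : ℕ} (he : 0 < e) (τ : ℝ) : ‖ker e τ‖ ≤ 1 := by
  rw [norm_ker_eq (by exact_mod_cast he)]
  exact Real.rpow_le_one_of_one_le_of_nonpos (by exact_mod_cast he) (by norm_num)

lemma exists_isMultiplier_coprimePart {q : ℕ} (χ : DirichletCharacter ℂ q) {P : ℝ → ℂ}
    (hP : IsMultiplier (charFn χ) P) {m : ℕ} (hm : m ≠ 0) :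
    ∃ R : ℝ → ℂ, IsMultiplier (coprimePart m (charFn χ)) R ∧
      ∀ τ, ‖R τ‖ ≤ m.divisors.card * ‖P τ‖ := by
  have h := hP.mul (IsMultiplier.sum m.divisors fun e he => IsMultiplier.pointFn
    (Nat.pos_of_mem_divisors he) ((ArithmeticFunction.moebius e : ℤ) * χ e))
  rw [← coprimePart_charFn χ hm] at h
  refine ⟨_, h, fun τ => ?_⟩
  rw [norm_mul]
  refine mul_le_mul_of_nonneg_right ?_ (norm_nonneg _)
  refine (norm_sum_le_of_le _ (n := fun _ => (1:ℝ)) fun e he => ?_).trans (by simp)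
  have he' := Nat.pos_of_mem_divisors he
  rw [norm_mul, norm_mul]
  have h1 : ‖((ArithmeticFunction.moebius e : ℤ) : ℂ)‖ ≤ 1 := by
    rw [Complex.norm_intCast]
    exact_mod_cast ArithmeticFunction.abs_moebius_le_one
  exact mul_le_one₀ (mul_le_one₀ h1 (norm_nonneg _) (DirichletCharacter.norm_le_one χ _))
    (norm_nonneg _) (norm_ker_nat_le_one he' τ)

section
variable {q : ℕ}

lemma charFn_eq_coprimePart (χ : DirichletCharacter ℂ q) :
    charFn χ = coprimePart q (charFn χ.primitiveCharacter) := by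
  ext n
  rcases eq_or_ne n 0 with rfl | hn
  · simp
  rw [coprimePart_apply, charFn_apply _ hn, charFn_apply _ hn]
  split_ifs with h
  · have := χ.primitiveCharacter_apply_of_isCoprime (a := (n:ℤ)) (Nat.isCoprime_iff_coprime.2 h)
    push_cast at this
    exact this.symm
  · exact χ.map_nonunit fun hu => h ((ZMod.isUnit_iff_coprime n q).1 hu)

lemma exists_isMultiplier_charFn [NeZero q] (χ : DirichletCharacter ℂ q) (hχ : χ ≠ 1) :
    ∃ R : ℝ → ℂ, IsMultiplier (charFn χ) R ∧
      ∀ τ, ‖R τ‖ ≤ q.divisors.card * ‖LL χ.primitiveCharacter τ‖ := by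
  have : NeZero χ.conductor := ⟨χ.conductor_ne_zero⟩
  have h1 : χ.conductor ≠ 1 := fun h => hχ (DirichletCharacter.eq_one_iff_conductor_eq_one.2 h)
  rw [charFn_eq_coprimePart]
  exact exists_isMultiplier_coprimePart _
    (isMultiplier_LL _ χ.primitiveCharacter_isPrimitive h1) (NeZero.ne q)

lemma exists_isMultiplier_dkFn [NeZero q] (χ : DirichletCharacter ℂ q) (hχ : χ ≠ 1) (k : ℕ) {D : ℕ} :
    ∀ G : ℕ, 0 < G → G.divisors.card ≤ D → ∃ P : ℝ → ℂ, IsMultiplier (dkFn k G χ) P ∧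
      ∀ τ, ‖P τ‖ ≤ (D ^ 2 * q.divisors.card * ‖LL χ.primitiveCharacter τ‖) ^ k := by
  obtain ⟨R, hR, hRb⟩ := exists_isMultiplier_charFn χ hχ
  induction k with
  | zero =>
    intro G hG _
    rcases eq_or_ne G 1 with rfl | h1
    · have : dkFn 0 1 χ = pointFn 1 1 := by
        ext n
        rcases eq_or_ne n 0 with rfl | hn
        · simp
        rw [dkFn_apply _ _ _ hn, pointFn_apply, dk_zero, one_mul]
        by_cases h : n = 1 <;> simp [h]
      refine ⟨_, this ▸ IsMultiplier.pointFn one_pos 1, fun τ => ?_⟩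
      simpa using norm_ker_nat_le_one one_pos τ
    · have : dkFn 0 G χ = 0 := by
        ext n
        rcases eq_or_ne n 0 with rfl | hn
        · simp
        rw [dkFn_apply _ _ _ hn, dk_zero, if_neg fun h => h1 (Nat.eq_one_of_mul_eq_one_right h)]
        simp
      exact ⟨_, this ▸ IsMultiplier.zero, fun τ => by simp⟩
  | succ k ih =>
    intro G hG hD
    have hstep : ∀ g ∈ G.divisors, ∃ P : ℝ → ℂ,
        IsMultiplier (coprimePart g (charFn χ) * dkFn k g χ) P ∧
        ∀ τ, ‖P τ‖ ≤ D * q.divisors.card * ‖LL χ.primitiveCharacter τ‖ *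
          (D ^ 2 * q.divisors.card * ‖LL χ.primitiveCharacter τ‖) ^ k := by
      intro g hg
      have hg0 := Nat.pos_of_mem_divisors hg
      have hgD : g.divisors.card ≤ D :=
        (card_divisors_dvd_le (Nat.dvd_of_mem_divisors hg) hG.ne').trans hD
      obtain ⟨P1, h1, h2⟩ := exists_isMultiplier_coprimePart χ hR hg0.ne'
      obtain ⟨P2, h3, h4⟩ := ih g hg0 hgD
      refine ⟨_, h1.mul h3, fun τ => ?_⟩
      rw [norm_mul, mul_comm]
      refine mul_le_mul ((h2 τ).trans ?_) (h4 τ) (norm_nonneg _) (by positivity)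
      rw [mul_assoc]
      exact mul_le_mul (by exact_mod_cast hgD) (hRb τ) (norm_nonneg _) (by positivity)
    choose! P hP hPb using hstep
    refine ⟨fun τ => ∑ g ∈ G.divisors, P g τ, ?_, fun τ => ?_⟩
    · rw [dkFn_succ k hG]
      exact IsMultiplier.sum _ hP
    · refine (norm_sum_le_of_le _ fun g hg => hPb g hg τ).trans ?_
      rw [Finset.sum_const, nsmul_eq_mul]
      have hD' : (G.divisors.card : ℝ) ≤ D := by exact_mod_cast hD
      refine (mul_le_mul_of_nonneg_right hD' (by positivity)).trans (le_of_eq ?_)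
      rw [pow_succ]; ring

end

end

section
open Set Filter Topology FourierTransform

lemma fourier_ae_eq_toLp {f : ℝ → ℂ} (hf : Integrable f) (hf2 : MemLp f 2) :
    (𝓕 (hf2.toLp f) : Lp ℂ 2 (volume : Measure ℝ)) =ᵐ[volume] 𝓕 f := by
  have hcont : Continuous (𝓕 f) :=
    VectorFourier.fourierIntegral_continuous Real.continuous_fourierChar continuous_inner hf
  refine ae_eq_of_integral_contDiff_smul_eq ((Lp.memLp _).locallyIntegrable one_le_two)
    hcont.locallyIntegrable fun g hg hgc => ?_
  have hg₁ : HasCompactSupport (Complex.ofRealCLM ∘ g) := hgc.comp_left rfl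
  have hg₂ : ContDiff ℝ (⊤ : ℕ∞) (Complex.ofRealCLM ∘ g) := by fun_prop
  set G := hg₁.toSchwartzMap hg₂ with hG
  have hGg : ∀ x, G x = g x := fun x => by simp [hG]
  have h1 : (∫ x, g x • (𝓕 (hf2.toLp f) : Lp ℂ 2 (volume : Measure ℝ)) x) =
      ((𝓕 (hf2.toLp f) : Lp ℂ 2 (volume : Measure ℝ)) : TemperedDistribution ℝ ℂ) G := by
    rw [Lp.toTemperedDistribution_apply]
    simp [hGg]
  rw [h1, ← Lp.fourier_toTemperedDistribution_eq, TemperedDistribution.fourier_apply,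
    Lp.toTemperedDistribution_apply]
  have h2 : (∫ x, g x • 𝓕 f x) = ∫ x, 𝓕 f x • G x := by
    congr 1; ext x; rw [hGg, smul_eq_mul, mul_comm]; rfl
  have h3 : (∫ x, 𝓕 f x • G x) = ∫ x, f x • 𝓕 (G : ℝ → ℂ) x := by
    simpa using! VectorFourier.integral_fourierIntegral_smul_eq_flip (L := innerₗ ℝ)
      (μ := volume) (ν := volume) Real.continuous_fourierChar continuous_inner hf
      (G.integrable (μ := volume))
  rw [h2]
  refine Eq.trans ?_ h3.symm
  refine integral_congr_ae ?_
  filter_upwards [hf2.coeFn_toLp] with x hx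
  rw [hx, smul_eq_mul, smul_eq_mul, mul_comm]
  rfl

lemma lintegral_fourier_sq {f : ℝ → ℂ} (hf : Integrable f) (hf2 : MemLp f 2) :
    ∫⁻ ξ, ‖𝓕 f ξ‖ₑ ^ 2 = ∫⁻ x, ‖f x‖ₑ ^ 2 := by
  have h1 : eLpNorm (𝓕 f) 2 volume = eLpNorm f 2 volume := by
    rw [← eLpNorm_congr_ae (fourier_ae_eq_toLp hf hf2), ← eLpNorm_congr_ae hf2.coeFn_toLp]
    have := Lp.norm_fourier_eq (hf2.toLp f)
    rw [Lp.norm_def, Lp.norm_def] at this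
    exact (ENNReal.toReal_eq_toReal_iff' (Lp.eLpNorm_ne_top _) (Lp.eLpNorm_ne_top _)).1 this
  have h2 : ∀ g : ℝ → ℂ, ∫⁻ x, ‖g x‖ₑ ^ 2 = eLpNorm g 2 volume ^ 2 := by
    intro g
    have := eLpNorm_nnreal_pow_eq_lintegral (μ := volume) (f := g) (p := 2) (by norm_num)
    simpa using this.symm
  rw [h2, h2, h1]

end

section
open Set Filter Topology FourierTransform

/-- Smooth compactly supported functions. -/
structure IsTest (f : ℝ → ℂ) : Prop where
  smooth : ContDiff ℝ (⊤ : ℕ∞) f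
  supp : HasCompactSupport f

/-- The oscillating factor `u ↦ e(ζ eᵘ)`. -/
noncomputable def expPhase (ζ u : ℝ) : ℂ := cexp (2 * Real.pi * ζ * Real.exp u * I)

lemma contDiff_expPhase (ζ : ℝ) : ContDiff ℝ (⊤ : ℕ∞) (expPhase ζ) := by
  have h : expPhase ζ = fun u : ℝ => cexp (((2 * Real.pi * ζ * Real.exp u : ℝ) : ℂ) * I) := by
    ext u; unfold expPhase; push_cast; rfl
  rw [h]
  have h0 : ContDiff ℝ (⊤ : ℕ∞) fun u : ℝ => 2 * Real.pi * ζ * Real.exp u := by fun_prop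
  exact ((Complex.ofRealCLM.contDiff.comp h0).mul contDiff_const).cexp

lemma hasDerivAt_expPhase (ζ u : ℝ) :
    HasDerivAt (expPhase ζ) (2 * Real.pi * ζ * Real.exp u * I * expPhase ζ u) u := by
  have h1 : HasDerivAt (fun u : ℝ => (Real.exp u : ℂ)) (Real.exp u : ℂ) u :=
    (Real.hasDerivAt_exp u).ofReal_comp
  have h2 := ((h1.const_mul (2 * Real.pi * ζ : ℂ)).mul_const I).cexp
  refine h2.congr_deriv ?_
  unfold expPhase; ring

namespace IsTest

variable {f : ℝ → ℂ}

lemma mul_left (hf : IsTest f) {g : ℝ → ℂ} (hg : ContDiff ℝ (⊤ : ℕ∞) g) :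
    IsTest fun u => f u * g u :=
  ⟨hf.smooth.mul hg, hf.supp.mul_right⟩

lemma continuous (hf : IsTest f) : Continuous f := hf.smooth.continuous

lemma integrable (hf : IsTest f) : Integrable f :=
  hf.continuous.integrable_of_hasCompactSupport hf.supp

lemma deriv (hf : IsTest f) : IsTest (deriv f) :=
  ⟨(contDiff_infty_iff_deriv.1 hf.smooth).2, hf.supp.deriv⟩

lemma differentiable (hf : IsTest f) : Differentiable ℝ f :=
  (contDiff_infty_iff_deriv.1 hf.smooth).1

lemma bounded (hf : IsTest f) : ∃ C, 0 ≤ C ∧ ∀ u, ‖f u‖ ≤ C := by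
  obtain ⟨C, hC⟩ := hf.supp.exists_bound_of_continuous hf.continuous
  exact ⟨C, (norm_nonneg _).trans (hC 0), hC⟩

lemma exists_abs_le (hf : IsTest f) : ∃ A, 0 ≤ A ∧ ∀ u, f u ≠ 0 → |u| ≤ A := by
  obtain ⟨A, hA⟩ := hf.supp.isCompact.isBounded.subset_closedBall (0 : ℝ)
  refine ⟨max A 0, le_max_right _ _, fun u hu => ?_⟩
  have := hA (subset_tsupport f hu)
  rw [mem_closedBall_zero_iff, Real.norm_eq_abs] at this
  exact this.trans (le_max_left _ _)

/-- The Schwartz function attached to a test function. -/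
noncomputable def schwartz (hf : IsTest f) : SchwartzMap ℝ ℂ := hf.supp.toSchwartzMap hf.smooth

lemma coe_schwartz (hf : IsTest f) : ⇑hf.schwartz = f := by
  ext x; simp [schwartz]

lemma fourier_eq (hf : IsTest f) : 𝓕 f = ((𝓕 hf.schwartz : SchwartzMap ℝ ℂ) : ℝ → ℂ) := by
  rw [SchwartzMap.fourier_coe, coe_schwartz]

lemma continuous_fourier (hf : IsTest f) : Continuous (𝓕 f) := by
  rw [hf.fourier_eq]; exact (𝓕 hf.schwartz : SchwartzMap ℝ ℂ).continuous

lemma fourier_decay (hf : IsTest f) (N : ℕ) :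
    ∃ C, 0 ≤ C ∧ ∀ τ, (1 + |τ|) ^ N * ‖𝓕 f τ‖ ≤ C := by
  have h := SchwartzMap.one_add_le_sup_seminorm_apply (𝕜 := ℂ) (m := (N, 0)) le_rfl le_rfl
    (𝓕 hf.schwartz : SchwartzMap ℝ ℂ)
  simp only [norm_iteratedFDeriv_zero, ← hf.fourier_eq, Real.norm_eq_abs] at h
  exact ⟨_, le_trans (by positivity) (h 0), h⟩

lemma integrable_pow_fourier (hf : IsTest f) (N : ℕ) :
    Integrable fun τ => (((1 + |τ|) ^ N : ℝ) : ℂ) * 𝓕 f τ := by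
  obtain ⟨C, -, hC⟩ := hf.fourier_decay (N + 2)
  have h1 : Integrable fun τ : ℝ => C * (1 + τ ^ 2)⁻¹ := integrable_inv_one_add_sq.const_mul C
  refine h1.mono' ((Continuous.aestronglyMeasurable (by fun_prop)).mul
    hf.continuous_fourier.aestronglyMeasurable) (Eventually.of_forall fun τ => ?_)
  rw [norm_mul, norm_real, Real.norm_of_nonneg (by positivity), ← div_eq_mul_inv,
    le_div_iff₀ (by positivity)]
  refine le_trans ?_ (hC τ)
  have : 1 + τ ^ 2 ≤ (1 + |τ|) ^ 2 := by nlinarith [sq_abs τ, abs_nonneg τ]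
  calc (1 + |τ|) ^ N * ‖𝓕 f τ‖ * (1 + τ ^ 2)
      ≤ (1 + |τ|) ^ N * ‖𝓕 f τ‖ * (1 + |τ|) ^ 2 := by gcongr
    _ = _ := by ring

lemma integrable_fourier (hf : IsTest f) : Integrable (𝓕 f) := by
  simpa using hf.integrable_pow_fourier 0

lemma inversion (hf : IsTest f) (u : ℝ) :
    f u = ∫ τ, 𝓕 f τ * cexp (2 * Real.pi * τ * u * I) := by
  have h := hf.continuous.fourierInv_fourier_eq hf.integrable hf.integrable_fourier
  have h1 := congrFun h u
  rw [Real.fourierInv_eq'] at h1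
  rw [← h1]
  refine integral_congr_ae (Eventually.of_forall fun τ => ?_)
  simp only [smul_eq_mul]
  rw [mul_comm]
  congr 2
  simp
  ring

end IsTest

/-- The Mellin transform of `ψ(u) e(ζ eᵘ)`, in logarithmic coordinates. -/
noncomputable def phaseMellin (ψ : ℝ → ℂ) (ζ : ℝ) : ℝ → ℂ := 𝓕 fun u => ψ u * expPhase ζ u

lemma IsTest.mul_expPhase {ψ : ℝ → ℂ} (hψ : IsTest ψ) (ζ : ℝ) :
    IsTest fun u => ψ u * expPhase ζ u :=
  hψ.mul_left (contDiff_expPhase ζ)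

lemma IsTest.mul_exp {ψ : ℝ → ℂ} (hψ : IsTest ψ) :
    IsTest fun u => ψ u * (2 * Real.pi * Real.exp u * I) := by
  refine hψ.mul_left ?_
  have h0 : ContDiff ℝ (⊤ : ℕ∞) fun u : ℝ => 2 * Real.pi * Real.exp u := by fun_prop
  have h2 : (fun u : ℝ => (2 * Real.pi * Real.exp u * I : ℂ)) =
      fun u : ℝ => ((2 * Real.pi * Real.exp u : ℝ) : ℂ) * I := by
    ext u; push_cast; rfl
  rw [h2]
  exact (Complex.ofRealCLM.contDiff.comp h0).mul contDiff_const

lemma phaseMellin_recursion {ψ : ℝ → ℂ} (hψ : IsTest ψ) {η : ℝ} (hη : η ≠ 0) (ξ τ : ℝ) :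
    (1 + 2 * Real.pi * η * τ * I) * phaseMellin ψ (ξ / η) τ =
      phaseMellin ψ (ξ / η) τ + η * phaseMellin (deriv ψ) (ξ / η) τ +
        ξ * phaseMellin (fun u => ψ u * (2 * Real.pi * Real.exp u * I)) (ξ / η) τ := by
  have hf := hψ.mul_expPhase (ξ / η)
  have h := congrFun (Real.fourier_deriv hf.integrable hf.differentiable hf.deriv.integrable) τ
  have hd : deriv (fun u => ψ u * expPhase (ξ / η) u) = fun u =>
      deriv ψ u * expPhase (ξ / η) u +
        ((ξ / η : ℝ) : ℂ) * (ψ u * (2 * Real.pi * Real.exp u * I) * expPhase (ξ / η) u) := by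
    ext u
    have hh := ((hψ.differentiable u).hasDerivAt.mul (hasDerivAt_expPhase (ξ / η) u)).deriv
    change deriv (ψ * expPhase (ξ / η)) u = _
    rw [hh]
    push_cast; ring
  have h1 : 𝓕 (deriv (fun u => ψ u * expPhase (ξ / η) u)) τ =
      phaseMellin (deriv ψ) (ξ / η) τ + ((ξ / η : ℝ) : ℂ) *
        phaseMellin (fun u => ψ u * (2 * Real.pi * Real.exp u * I)) (ξ / η) τ := by
    rw [hd]
    unfold phaseMellin
    simp only [Real.fourier_real_eq_integral_exp_smul, smul_eq_mul]
    rw [← integral_const_mul, ← integral_add]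
    · congr 1; ext u; ring
    · refine (hψ.deriv.mul_expPhase (ξ / η)).integrable.bdd_mul (c := 1)
        (Continuous.aestronglyMeasurable (by fun_prop)) (Eventually.of_forall fun u => ?_)
      rw [norm_exp_ofReal_mul_I]
    · refine Integrable.const_mul ?_ _
      refine (hψ.mul_exp.mul_expPhase (ξ / η)).integrable.bdd_mul (c := 1)
        (Continuous.aestronglyMeasurable (by fun_prop)) (Eventually.of_forall fun u => ?_)
      rw [norm_exp_ofReal_mul_I]
  have hη' : (η : ℂ) ≠ 0 := by exact_mod_cast hη
  have h2 : phaseMellin ψ (ξ / η) τ = 𝓕 (fun u => ψ u * expPhase (ξ / η) u) τ := rfl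
  rw [h1, smul_eq_mul, ← h2] at h
  have h3 : (ξ : ℂ) = η * ((ξ / η : ℝ) : ℂ) := by push_cast; field_simp
  rw [h3]
  linear_combination (-(η : ℂ)) * h

lemma measurable_phaseMellin {ψ : ℝ → ℂ} (hψ : IsTest ψ) (η : ℝ) :
    StronglyMeasurable fun p : ℝ × ℝ => phaseMellin ψ (p.1 / η) p.2 := by
  unfold phaseMellin
  simp only [Real.fourier_real_eq_integral_exp_smul, smul_eq_mul]
  refine StronglyMeasurable.integral_prod_right (f := fun (p : ℝ × ℝ) (v : ℝ) =>
    cexp (((-2 * Real.pi * v * p.2 : ℝ) : ℂ) * I) * (ψ v * expPhase (p.1 / η) v)) ?_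
  refine Continuous.stronglyMeasurable ?_
  unfold expPhase
  have := hψ.continuous
  have h2 : Continuous fun p : (ℝ × ℝ) × ℝ => p.1.1 / η := by fun_prop
  have h3 := Complex.continuous_ofReal.comp h2
  simp only [Function.comp_def] at h3
  simp only [Function.uncurry_def]
  fun_prop

lemma continuous_phaseMellin {ψ : ℝ → ℂ} (hψ : IsTest ψ) (ζ : ℝ) :
    Continuous (phaseMellin ψ ζ) := (hψ.mul_expPhase ζ).continuous_fourier

end

section
open Set Filter Topology FourierTransform

lemma image_exp_univ : Real.exp '' univ = Ioi 0 := by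
  rw [image_univ, Real.range_exp]

lemma integral_Ioi_eq_integral_exp (g : ℝ → ℂ) :
    ∫ y in Ioi (0 : ℝ), g y = ∫ u : ℝ, (Real.exp u : ℂ) * g (Real.exp u) := by
  have h := integral_image_eq_integral_abs_deriv_smul (s := univ) (f := Real.exp)
    (f' := Real.exp) MeasurableSet.univ (fun x _ => (Real.hasDerivAt_exp x).hasDerivWithinAt)
    Real.exp_injective.injOn g
  rw [image_exp_univ] at h
  rw [h, setIntegral_univ]
  simp [Real.abs_exp]

lemma lintegral_Ioi_eq_lintegral_exp (g : ℝ → ENNReal) :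
    ∫⁻ y in Ioi (0 : ℝ), g y = ∫⁻ u : ℝ, ENNReal.ofReal (Real.exp u) * g (Real.exp u) := by
  have h := lintegral_image_eq_lintegral_abs_deriv_mul (s := univ) (f := Real.exp)
    (f' := Real.exp) MeasurableSet.univ (fun x _ => (Real.hasDerivAt_exp x).hasDerivWithinAt)
    Real.exp_injective.injOn g
  rw [image_exp_univ] at h
  rw [h, setLIntegral_univ]
  simp [Real.abs_exp]

lemma lintegral_comp_mul_real {a : ℝ} (ha : a ≠ 0) {f : ℝ → ENNReal} (hf : Measurable f) :
    ∫⁻ x, f (a * x) = ENNReal.ofReal |a⁻¹| * ∫⁻ x, f x := by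
  have h := lintegral_map (μ := volume) hf (measurable_const_mul a)
  rw [Real.map_volume_mul_left ha, lintegral_smul_measure] at h
  rw [← h, smul_eq_mul]

/-- The function `(ψ q)(log y) / y` on the positive reals. -/
noncomputable def logPull (p : ℝ → ℂ) (y : ℝ) : ℂ :=
  (Ioi (0 : ℝ)).indicator (fun y => p (Real.log y) / y) y

lemma fourier_logPull (p : ℝ → ℂ) (ζ : ℝ) :
    𝓕 (logPull p) (-ζ) = ∫ u, p u * expPhase ζ u := by
  rw [Real.fourier_real_eq_integral_exp_smul]
  have h1 : (fun v : ℝ => cexp (((-2 * Real.pi * v * -ζ : ℝ) : ℂ) * I) • logPull p v) =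
      (Ioi (0 : ℝ)).indicator fun v : ℝ =>
        cexp (((-2 * Real.pi * v * -ζ : ℝ) : ℂ) * I) * (p (Real.log v) / v) := by
    ext v
    unfold logPull
    by_cases hv : v ∈ Ioi (0 : ℝ)
    · simp [indicator_of_mem hv]
    · simp [indicator_of_notMem hv]
  rw [h1, integral_indicator measurableSet_Ioi, integral_Ioi_eq_integral_exp]
  refine integral_congr_ae (Eventually.of_forall fun u => ?_)
  have h2 : (Real.exp u : ℂ) ≠ 0 := by exact_mod_cast (Real.exp_pos u).ne'
  simp only [Real.log_exp, expPhase]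
  rw [show (((-2 * Real.pi * Real.exp u * -ζ : ℝ) : ℂ) * I) = 2 * Real.pi * ζ * Real.exp u * I by
    push_cast; ring]
  field_simp

lemma lintegral_logPull_sq {p : ℝ → ℂ} :
    ∫⁻ y, ‖logPull p y‖ₑ ^ 2 = ∫⁻ u, ENNReal.ofReal (Real.exp (-u)) * ‖p u‖ₑ ^ 2 := by
  have h1 : (fun y => ‖logPull p y‖ₑ ^ 2) = (Ioi (0 : ℝ)).indicator fun y =>
      ‖p (Real.log y) / y‖ₑ ^ 2 := by
    ext v
    unfold logPull
    by_cases hv : v ∈ Ioi (0 : ℝ)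
    · simp [indicator_of_mem hv]
    · simp [indicator_of_notMem hv]
  rw [h1, lintegral_indicator measurableSet_Ioi, lintegral_Ioi_eq_lintegral_exp]
  refine lintegral_congr fun u => ?_
  rw [Real.log_exp]
  simp only [← ofReal_norm]
  rw [← ENNReal.ofReal_pow (norm_nonneg _), ← ENNReal.ofReal_pow (norm_nonneg _),
    ← ENNReal.ofReal_mul (Real.exp_pos u).le, ← ENNReal.ofReal_mul (Real.exp_pos _).le]
  congr 1
  rw [norm_div, norm_real, Real.norm_of_nonneg (Real.exp_pos u).le, Real.exp_neg]
  field_simp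

lemma memLp_logPull {p : ℝ → ℂ} (hp : Continuous p) (hpc : HasCompactSupport p) (r : ENNReal) :
    MemLp (logPull p) r := by
  obtain ⟨A, hA⟩ := hpc.isCompact.isBounded.subset_closedBall (0 : ℝ)
  obtain ⟨B, hB⟩ := hpc.exists_bound_of_continuous hp
  have hlog : ∀ y, 0 < y → p (Real.log y) ≠ 0 → Real.exp (-A) ≤ y ∧ y ≤ Real.exp A := by
    intro y hy h
    have := hA (subset_tsupport p h)
    rw [mem_closedBall_zero_iff, Real.norm_eq_abs, abs_le] at this
    exact ⟨(Real.le_log_iff_exp_le hy).1 this.1, (Real.log_le_iff_le_exp hy).1 this.2⟩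
  have h1 : logPull p = (Icc (Real.exp (-A)) (Real.exp A)).indicator (logPull p) := by
    ext y
    by_cases hy : y ∈ Icc (Real.exp (-A)) (Real.exp A)
    · rw [indicator_of_mem hy]
    · rw [indicator_of_notMem hy]
      unfold logPull
      by_cases hy0 : y ∈ Ioi (0 : ℝ)
      · rw [indicator_of_mem hy0]
        by_contra h
        have h2 : p (Real.log y) ≠ 0 := fun h3 => h (by simp [h3])
        exact hy (hlog y hy0 h2)
      · rw [indicator_of_notMem hy0]
  have hmeas : Measurable (logPull p) := by
    unfold logPull
    exact ((hp.measurable.comp Real.measurable_log).div Complex.measurable_ofReal).indicator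
      measurableSet_Ioi
  rw [h1, memLp_indicator_iff_restrict measurableSet_Icc]
  have hB0 : 0 ≤ B := (norm_nonneg _).trans (hB 0)
  refine MemLp.of_bound hmeas.aestronglyMeasurable (B * Real.exp A) ?_
  refine (ae_restrict_mem measurableSet_Icc).mono fun y hy => ?_
  have hy0 : y ∈ Ioi (0 : ℝ) := (Real.exp_pos _).trans_le hy.1
  unfold logPull
  rw [indicator_of_mem hy0, norm_div, norm_real, Real.norm_of_nonneg (le_of_lt hy0),
    div_le_iff₀ hy0]
  refine (hB _).trans ?_
  rw [mul_assoc]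
  refine le_mul_of_one_le_right hB0 ?_
  calc 1 = Real.exp A * Real.exp (-A) := by rw [← Real.exp_add]; simp
    _ ≤ Real.exp A * y := by gcongr; exact hy.1

lemma exists_phase_l2_bound {ψ : ℝ → ℂ} (hψ : IsTest ψ) : ∃ C, 0 ≤ C ∧ ∀ η, 0 < η →
    ∀ Q : ℝ → ℂ, Integrable Q → MemLp Q 2 →
      ∫⁻ ξ, ‖∫ τ, phaseMellin ψ (ξ / η) τ * Q τ‖ₑ ^ 2 ≤
        ENNReal.ofReal (C * η) * ∫⁻ τ, ‖Q τ‖ₑ ^ 2 := by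
  obtain ⟨A, hA0, hA⟩ := hψ.exists_abs_le
  obtain ⟨B, hB0, hB⟩ := hψ.bounded
  refine ⟨Real.exp A * B ^ 2, by positivity, fun η hη Q hQ hQ2 => ?_⟩
  have hq : Continuous (𝓕 Q) :=
    VectorFourier.fourierIntegral_continuous Real.continuous_fourierChar continuous_inner hQ
  have hp : Continuous fun u => ψ u * 𝓕 Q u := hψ.continuous.mul hq
  have hpc : HasCompactSupport fun u => ψ u * 𝓕 Q u := hψ.supp.mul_right
  have h1 : ∀ ξ, ∫ τ, phaseMellin ψ (ξ / η) τ * Q τ =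
      𝓕 (logPull fun u => ψ u * 𝓕 Q u) ((-η⁻¹) * ξ) := by
    intro ξ
    rw [show (-η⁻¹) * ξ = -(ξ / η) by field_simp, fourier_logPull]
    have h3 : (∫ x, 𝓕 (fun u => ψ u * expPhase (ξ / η) u) x • Q x) =
        ∫ x, (ψ x * expPhase (ξ / η) x) • 𝓕 Q x := by
      simpa using! VectorFourier.integral_fourierIntegral_smul_eq_flip (L := innerₗ ℝ)
        (μ := volume) (ν := volume) Real.continuous_fourierChar continuous_inner
        (hψ.mul_expPhase (ξ / η)).integrable hQ
    simp only [smul_eq_mul] at h3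
    unfold phaseMellin
    rw [h3]
    congr 1; ext u; ring
  simp only [h1]
  have hw1 : Integrable (logPull fun u => ψ u * 𝓕 Q u) :=
    memLp_one_iff_integrable.1 (memLp_logPull hp hpc 1)
  have hwc : Continuous (𝓕 (logPull fun u => ψ u * 𝓕 Q u)) :=
    VectorFourier.fourierIntegral_continuous Real.continuous_fourierChar continuous_inner hw1
  rw [lintegral_comp_mul_real (f := fun x => ‖𝓕 (logPull fun u => ψ u * 𝓕 Q u) x‖ₑ ^ 2)
    (by simpa using hη.ne') (hwc.measurable.enorm.pow_const 2),
    lintegral_fourier_sq hw1 (memLp_logPull hp hpc 2), lintegral_logPull_sq,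
    ← lintegral_fourier_sq hQ hQ2]
  rw [show |(-η⁻¹)⁻¹| = η by simp [abs_of_pos hη], mul_comm _ η,
    ENNReal.ofReal_mul hη.le, mul_assoc]
  gcongr
  rw [← lintegral_const_mul _ (hq.measurable.enorm.pow_const 2)]
  refine lintegral_mono fun u => ?_
  simp only [← ofReal_norm]
  rw [← ENNReal.ofReal_pow (norm_nonneg _), ← ENNReal.ofReal_pow (norm_nonneg _),
    ← ENNReal.ofReal_mul (by positivity), ← ENNReal.ofReal_mul (by positivity)]
  refine ENNReal.ofReal_le_ofReal ?_
  by_cases hu : ψ u = 0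
  · rw [hu, zero_mul, norm_zero, zero_pow two_ne_zero, mul_zero]; positivity
  rw [norm_mul, mul_pow, mul_assoc, ← mul_assoc, ← mul_assoc]
  have h4 : Real.exp (-u) ≤ Real.exp A := by
    gcongr; exact (neg_le_abs u).trans (hA u hu)
  have h5 := hB u
  gcongr

end

section
open Set Filter Topology FourierTransform

/-- The integral of `Q` against the weighted phase transform. -/
noncomputable def phaseOp (ψ : ℝ → ℂ) (η : ℝ) (j : ℕ) (Q : ℝ → ℂ) (ξ : ℝ) : ℂ :=
  ∫ τ, (1 + 2 * Real.pi * η * τ * I) ^ j * phaseMellin ψ (ξ / η) τ * Q τ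

lemma measurable_phaseOp {ψ : ℝ → ℂ} (hψ : IsTest ψ) (η : ℝ) (j : ℕ) {Q : ℝ → ℂ}
    (hQ : Measurable Q) : Measurable (phaseOp ψ η j Q) := by
  unfold phaseOp
  refine (StronglyMeasurable.integral_prod_right (f := fun (ξ τ : ℝ) =>
    (1 + 2 * Real.pi * η * τ * I) ^ j * phaseMellin ψ (ξ / η) τ * Q τ) ?_).measurable
  simp only [Function.uncurry_def]
  refine (StronglyMeasurable.mul ?_ (measurable_phaseMellin hψ η)).mul
    (hQ.comp measurable_snd).stronglyMeasurable
  exact Continuous.stronglyMeasurable (by fun_prop)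

lemma integrable_phase_mul {ψ : ℝ → ℂ} (hψ : IsTest ψ) (η : ℝ) (j : ℕ) {Q : ℝ → ℂ}
    (hQ : Integrable Q) (ζ : ℝ) :
    Integrable fun τ : ℝ => (1 + 2 * Real.pi * η * τ * I) ^ j * phaseMellin ψ ζ τ * Q τ := by
  obtain ⟨C, hC0, hC⟩ := (hψ.mul_expPhase ζ).fourier_decay j
  refine hQ.bdd_mul (c := (1 + 2 * Real.pi * |η|) ^ j * C)
    (Continuous.aestronglyMeasurable ?_) (Eventually.of_forall fun τ => ?_)
  · have := continuous_phaseMellin hψ ζ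
    fun_prop
  · rw [norm_mul, norm_pow]
    have h1 : ‖(1 + 2 * Real.pi * η * τ * I : ℂ)‖ ≤ (1 + 2 * Real.pi * |η|) * (1 + |τ|) := by
      refine (norm_add_le _ _).trans ?_
      simp only [norm_one, norm_mul, norm_I, norm_real, Real.norm_eq_abs, mul_one,
        abs_of_pos Real.pi_pos, Complex.norm_two]
      have := Real.pi_pos
      nlinarith [abs_nonneg τ, abs_nonneg η, mul_nonneg Real.pi_pos.le (abs_nonneg η)]
    calc _ ≤ ((1 + 2 * Real.pi * |η|) * (1 + |τ|)) ^ j * ‖phaseMellin ψ ζ τ‖ := by gcongr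
      _ = (1 + 2 * Real.pi * |η|) ^ j * ((1 + |τ|) ^ j * ‖phaseMellin ψ ζ τ‖) := by
          rw [mul_pow]; ring
      _ ≤ _ := by
          have := hC τ
          have hp : 0 ≤ 1 + 2 * Real.pi * |η| := by positivity
          exact mul_le_mul_of_nonneg_left this (by positivity)

lemma phaseOp_succ {ψ : ℝ → ℂ} (hψ : IsTest ψ) {η : ℝ} (hη : η ≠ 0) (j : ℕ) {Q : ℝ → ℂ}
    (hQ : Integrable Q) (ξ : ℝ) :
    phaseOp ψ η (j + 1) Q ξ = phaseOp ψ η j Q ξ + η * phaseOp (deriv ψ) η j Q ξ +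
      ξ * phaseOp (fun u => ψ u * (2 * Real.pi * Real.exp u * I)) η j Q ξ := by
  unfold phaseOp
  have h1 := integrable_phase_mul hψ η j hQ (ξ / η)
  have h2 := (integrable_phase_mul hψ.deriv η j hQ (ξ / η)).const_mul (η : ℂ)
  have h3 := (integrable_phase_mul hψ.mul_exp η j hQ (ξ / η)).const_mul (ξ : ℂ)
  have h12 := h1.add h2
  simp only [Pi.add_def] at h12
  rw [← integral_const_mul, ← integral_const_mul, ← integral_add h1 h2,
    ← integral_add h12 h3]
  refine integral_congr_ae (Eventually.of_forall fun τ => ?_)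
  simp only
  rw [pow_succ, mul_assoc (_ ^ j), phaseMellin_recursion hψ hη]
  ring

lemma norm_add_three_sq_le (a b c : ℂ) :
    ‖a + b + c‖ ^ 2 ≤ 3 * (‖a‖ ^ 2 + ‖b‖ ^ 2 + ‖c‖ ^ 2) := by
  have h : ‖a + b + c‖ ≤ ‖a‖ + ‖b‖ + ‖c‖ := norm_add₃_le
  calc ‖a + b + c‖ ^ 2 ≤ (‖a‖ + ‖b‖ + ‖c‖) ^ 2 := by gcongr
    _ ≤ _ := by nlinarith [sq_nonneg (‖a‖ - ‖b‖), sq_nonneg (‖a‖ - ‖c‖), sq_nonneg (‖b‖ - ‖c‖)]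

lemma exists_phaseOp_bound (C₀ : ℝ) (j : ℕ) : ∀ ψ : ℝ → ℂ, IsTest ψ →
    ∃ C, 0 ≤ C ∧ ∀ η, 0 < η → η ≤ C₀ → ∀ Q : ℝ → ℂ, Measurable Q → Integrable Q → MemLp Q 2 →
      ∫⁻ ξ, ENNReal.ofReal (((1 + ξ ^ 2) ^ j)⁻¹ * ‖phaseOp ψ η j Q ξ‖ ^ 2) ≤
        ENNReal.ofReal (C * η) * ∫⁻ τ, ‖Q τ‖ₑ ^ 2 := by
  induction j with
  | zero =>
    intro ψ hψ
    obtain ⟨C, hC0, hC⟩ := exists_phase_l2_bound hψ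
    refine ⟨C, hC0, fun η hη _ Q _ hQ hQ2 => ?_⟩
    refine le_trans (le_of_eq ?_) (hC η hη Q hQ hQ2)
    refine lintegral_congr fun ξ => ?_
    simp only [phaseOp, pow_zero, inv_one, one_mul, ← ofReal_norm]
    rw [ENNReal.ofReal_pow (norm_nonneg _)]
  | succ j ih =>
    intro ψ hψ
    obtain ⟨C₁, h₁0, h₁⟩ := ih ψ hψ
    obtain ⟨C₂, h₂0, h₂⟩ := ih _ hψ.deriv
    obtain ⟨C₃, h₃0, h₃⟩ := ih _ hψ.mul_exp
    refine ⟨3 * C₁ + 3 * C₀ ^ 2 * C₂ + 3 * C₃, by positivity, fun η hη hηC Q hQm hQ hQ2 => ?_⟩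
    have hm : ∀ φ : ℝ → ℂ, IsTest φ → Measurable fun ξ : ℝ =>
        ENNReal.ofReal (((1 + ξ ^ 2) ^ j)⁻¹ * ‖phaseOp φ η j Q ξ‖ ^ 2) := by
      intro φ hφ
      have := measurable_phaseOp hφ η j hQm
      fun_prop
    have e₁ := h₁ η hη hηC Q hQm hQ hQ2
    have e₂ := h₂ η hη hηC Q hQm hQ hQ2
    have e₃ := h₃ η hη hηC Q hQm hQ hQ2
    have m₁ := hm _ hψ
    have m₂ := hm _ hψ.deriv
    have m₃ := hm _ hψ.mul_exp
    obtain ⟨ψ₂, hψ₂⟩ : ∃ p, p = deriv ψ := ⟨_, rfl⟩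
    obtain ⟨ψ₃, hψ₃⟩ : ∃ p, p = fun u => ψ u * (2 * Real.pi * Real.exp u * I) := ⟨_, rfl⟩
    have hrec := phaseOp_succ hψ hη.ne' j hQ
    rw [← hψ₂] at e₂ m₂
    rw [← hψ₃] at e₃ m₃
    rw [← hψ₂, ← hψ₃] at hrec
    have key : ∀ ξ : ℝ, ENNReal.ofReal (((1 + ξ ^ 2) ^ (j + 1))⁻¹ *
        ‖phaseOp ψ η (j + 1) Q ξ‖ ^ 2) ≤
        ENNReal.ofReal 3 * ENNReal.ofReal (((1 + ξ ^ 2) ^ j)⁻¹ * ‖phaseOp ψ η j Q ξ‖ ^ 2) +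
        ENNReal.ofReal (3 * C₀ ^ 2) *
          ENNReal.ofReal (((1 + ξ ^ 2) ^ j)⁻¹ * ‖phaseOp ψ₂ η j Q ξ‖ ^ 2) +
        ENNReal.ofReal 3 *
          ENNReal.ofReal (((1 + ξ ^ 2) ^ j)⁻¹ * ‖phaseOp ψ₃ η j Q ξ‖ ^ 2) := by
      intro ξ
      rw [← ENNReal.ofReal_mul (by norm_num), ← ENNReal.ofReal_mul (by positivity),
        ← ENNReal.ofReal_mul (by norm_num), ← ENNReal.ofReal_add (by positivity) (by positivity),
        ← ENNReal.ofReal_add (by positivity) (by positivity)]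
      refine ENNReal.ofReal_le_ofReal ?_
      rw [hrec ξ, pow_succ, mul_inv]
      obtain ⟨a, ha⟩ : ∃ a, a = ‖phaseOp ψ η j Q ξ‖ ^ 2 := ⟨_, rfl⟩
      obtain ⟨b, hb⟩ : ∃ a, a = ‖phaseOp ψ₂ η j Q ξ‖ ^ 2 := ⟨_, rfl⟩
      obtain ⟨c, hc⟩ : ∃ a, a = ‖phaseOp ψ₃ η j Q ξ‖ ^ 2 := ⟨_, rfl⟩
      have h := norm_add_three_sq_le (phaseOp ψ η j Q ξ) (η * phaseOp ψ₂ η j Q ξ)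
        (ξ * phaseOp ψ₃ η j Q ξ)
      rw [norm_mul, norm_mul, mul_pow, mul_pow, norm_real, norm_real, Real.norm_eq_abs,
        Real.norm_eq_abs, sq_abs, sq_abs, ← ha, ← hb, ← hc] at h
      rw [← ha, ← hb, ← hc]
      have ha0 : 0 ≤ a := ha ▸ by positivity
      have hb0 : 0 ≤ b := hb ▸ by positivity
      have hc0 : 0 ≤ c := hc ▸ by positivity
      obtain ⟨w, hw⟩ : ∃ w, w = ((1 + ξ ^ 2) ^ j)⁻¹ := ⟨_, rfl⟩
      have hw0 : 0 ≤ w := hw ▸ by positivity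
      rw [← hw]
      have hη2 : η ^ 2 ≤ C₀ ^ 2 := by gcongr
      have hx : 0 < 1 + ξ ^ 2 := by positivity
      have hstep : ‖phaseOp ψ η j Q ξ + η * phaseOp ψ₂ η j Q ξ + ξ * phaseOp ψ₃ η j Q ξ‖ ^ 2 ≤
          (1 + ξ ^ 2) * (3 * a + 3 * C₀ ^ 2 * b + 3 * c) := by
        refine h.trans ?_
        nlinarith [mul_le_mul_of_nonneg_right hη2 hb0, mul_nonneg (sq_nonneg ξ) ha0,
          mul_nonneg (sq_nonneg ξ) (mul_nonneg (sq_nonneg C₀) hb0)]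
      calc _ ≤ w * (1 + ξ ^ 2)⁻¹ * ((1 + ξ ^ 2) * (3 * a + 3 * C₀ ^ 2 * b + 3 * c)) := by
            gcongr
        _ = _ := by field_simp
    refine (lintegral_mono key).trans ?_
    rw [lintegral_add_left (by fun_prop), lintegral_add_left (by fun_prop),
      lintegral_const_mul _ m₁, lintegral_const_mul _ m₂, lintegral_const_mul _ m₃]
    calc _ ≤ ENNReal.ofReal 3 * (ENNReal.ofReal (C₁ * η) * ∫⁻ τ, ‖Q τ‖ₑ ^ 2) +
          ENNReal.ofReal (3 * C₀ ^ 2) * (ENNReal.ofReal (C₂ * η) * ∫⁻ τ, ‖Q τ‖ₑ ^ 2) +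
          ENNReal.ofReal 3 * (ENNReal.ofReal (C₃ * η) * ∫⁻ τ, ‖Q τ‖ₑ ^ 2) := by gcongr
      _ = _ := by
        rw [← mul_assoc, ← mul_assoc, ← mul_assoc, ← add_mul, ← add_mul,
          ← ENNReal.ofReal_mul (by norm_num), ← ENNReal.ofReal_mul (by positivity),
          ← ENNReal.ofReal_mul (by norm_num), ← ENNReal.ofReal_add (by positivity) (by positivity),
          ← ENNReal.ofReal_add (by positivity) (by positivity)]
        congr 2
        ring

end

section
open Set Filter Topology FourierTransform

lemma norm_one_add_mul_I_sq (x : ℝ) : ‖(1 + (x : ℂ) * I)‖ ^ 2 = 1 + x ^ 2 := by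
  rw [← normSq_eq_norm_sq]
  simp [normSq_apply]
  ring

lemma exists_phaseOp_growth_bound (C₀ : ℝ) (k : ℕ) {ψ : ℝ → ℂ} (hψ : IsTest ψ) :
    ∃ C, 0 ≤ C ∧ ∀ η T, 0 < η → η ≤ C₀ → 0 < T → 1 ≤ η * T → ∀ (F : ℝ → ℂ) (A : ℝ), Measurable F →
      (∀ τ, ‖F τ‖ ≤ A * (1 + |τ|) ^ k) →
      ∫⁻ ξ, ENNReal.ofReal (((1 + ξ ^ 2) ^ (k + 2))⁻¹ *
          ‖∫ τ, phaseMellin ψ (ξ / η) τ * F τ‖ ^ 2) ≤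
        ENNReal.ofReal (C * η) *
          ∫⁻ τ, ENNReal.ofReal ((lw T τ ^ (2 * k + 2))⁻¹ * ‖F τ‖ ^ 2) := by
  obtain ⟨C, hC0, hC⟩ := exists_phaseOp_bound C₀ (k + 2) ψ hψ
  refine ⟨C * 2 ^ (k + 2), by positivity, fun η T hη hηC hT hηT F A hFm hF => ?_⟩
  obtain ⟨D, hD⟩ : ∃ D : ℝ → ℂ, D = fun τ : ℝ => 1 + 2 * Real.pi * η * τ * I := ⟨_, rfl⟩
  have hDsq : ∀ τ, ‖D τ‖ ^ 2 = 1 + (2 * Real.pi * η * τ) ^ 2 := by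
    intro τ
    rw [hD, ← norm_one_add_mul_I_sq]
    push_cast; rfl
  have hDpos : ∀ τ, 0 < ‖D τ‖ := by
    intro τ
    have : 0 < ‖D τ‖ ^ 2 := by rw [hDsq]; positivity
    exact lt_of_le_of_ne (norm_nonneg _) fun h => by simp [← h] at this
  have hDne : ∀ τ, D τ ≠ 0 := fun τ => norm_pos_iff.1 (hDpos τ)
  have hDm : Measurable D := by rw [hD]; fun_prop
  obtain ⟨Q, hQ⟩ : ∃ Q : ℝ → ℂ, Q = fun τ => F τ / D τ ^ (k + 2) := ⟨_, rfl⟩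
  have hQm : Measurable Q := by rw [hQ]; fun_prop
  have hA : 0 ≤ A := by
    have := (norm_nonneg _).trans (hF 0)
    simpa using this
  have hπ : 1 ≤ 2 * Real.pi := by linarith [Real.pi_gt_three]
  have hηx : ∀ τ : ℝ, (η * τ) ^ 2 ≤ (2 * Real.pi * η * τ) ^ 2 := by
    intro τ
    rw [mul_assoc (2 * Real.pi), mul_pow (2 * Real.pi)]
    exact le_mul_of_one_le_left (by positivity) (one_le_pow₀ hπ)
  obtain ⟨E, hE1, hE⟩ : ∃ E : ℝ, 0 ≤ E ∧ ∀ τ, (1 + |τ|) ^ 2 ≤ E * ‖D τ‖ ^ 2 := by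
    refine ⟨2 * (1 + (η ^ 2)⁻¹), by positivity, fun τ => ?_⟩
    have h1 : (1 + |τ|) ^ 2 ≤ 2 * (1 + τ ^ 2) := by
      nlinarith [sq_abs τ, sq_nonneg (1 - |τ|)]
    have h2 : τ ^ 2 = (η ^ 2)⁻¹ * (η * τ) ^ 2 := by field_simp
    rw [hDsq]
    have h3 := hηx τ
    have h4 : 0 < (η ^ 2)⁻¹ := by positivity
    have h5 : (η ^ 2)⁻¹ * (η * τ) ^ 2 ≤ (η ^ 2)⁻¹ * (2 * Real.pi * η * τ) ^ 2 := by gcongr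
    nlinarith [sq_nonneg (2 * Real.pi * η * τ)]
  have hE' : ∀ τ, (1 + |τ|) ^ (2 * k + 4) ≤ E ^ (k + 2) * ‖D τ‖ ^ (2 * (k + 2)) := by
    intro τ
    calc (1 + |τ|) ^ (2 * k + 4) = ((1 + |τ|) ^ 2) ^ (k + 2) := by rw [← pow_mul]; ring_nf
      _ ≤ (E * ‖D τ‖ ^ 2) ^ (k + 2) := pow_le_pow_left₀ (by positivity) (hE τ) _
      _ = _ := by rw [mul_pow, ← pow_mul]
  have hQsq : ∀ τ, ‖Q τ‖ ^ 2 * ‖D τ‖ ^ (2 * (k + 2)) = ‖F τ‖ ^ 2 := by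
    intro τ
    have := hDpos τ
    rw [hQ]
    simp only [norm_div, norm_pow, div_pow, ← pow_mul]
    rw [mul_comm (k + 2) 2]
    field_simp
  have hQle : ∀ τ, ‖Q τ‖ ^ 2 ≤ (A ^ 2 * E ^ (k + 2)) * ((1 + |τ|) ^ 4)⁻¹ := by
    intro τ
    have h1 := hE' τ
    have h2 := hQsq τ
    have h3 : ‖F τ‖ ^ 2 ≤ A ^ 2 * (1 + |τ|) ^ (2 * k) := by
      calc ‖F τ‖ ^ 2 ≤ (A * (1 + |τ|) ^ k) ^ 2 := pow_le_pow_left₀ (norm_nonneg _) (hF τ) _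
        _ = _ := by rw [mul_pow, ← pow_mul]; ring_nf
    have h4 : 0 < ‖D τ‖ ^ (2 * (k + 2)) := pow_pos (hDpos τ) _
    rw [← div_eq_mul_inv, le_div_iff₀ (by positivity)]
    have h5 : 0 < (1 + |τ|) ^ (2 * k) := by positivity
    refine le_of_mul_le_mul_right ?_ (mul_pos h4 h5)
    calc ‖Q τ‖ ^ 2 * (1 + |τ|) ^ 4 * (‖D τ‖ ^ (2 * (k + 2)) * (1 + |τ|) ^ (2 * k))
        = (‖Q τ‖ ^ 2 * ‖D τ‖ ^ (2 * (k + 2))) * (1 + |τ|) ^ (2 * k + 4) := by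
          rw [pow_add]; ring
      _ = ‖F τ‖ ^ 2 * (1 + |τ|) ^ (2 * k + 4) := by rw [h2]
      _ ≤ (A ^ 2 * (1 + |τ|) ^ (2 * k)) * (E ^ (k + 2) * ‖D τ‖ ^ (2 * (k + 2))) := by gcongr
      _ = _ := by ring
  have hone : ∀ τ : ℝ, 1 + τ ^ 2 ≤ (1 + |τ|) ^ 2 := fun τ => by
    nlinarith [sq_abs τ, abs_nonneg τ]
  have hQi : Integrable Q := by
    refine ((integrable_inv_one_add_sq).const_mul
      (√(A ^ 2 * E ^ (k + 2)))).mono' hQm.aestronglyMeasurable (Eventually.of_forall fun τ => ?_)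
    refine (Real.le_sqrt_of_sq_le (hQle τ)).trans ?_
    rw [Real.sqrt_mul (by positivity)]
    gcongr
    rw [Real.sqrt_le_left (by positivity), inv_pow]
    have := hone τ
    gcongr
    calc (1 + τ ^ 2) ^ 2 ≤ ((1 + |τ|) ^ 2) ^ 2 := by gcongr
      _ = _ := by ring
  have hQ2 : MemLp Q 2 := by
    rw [memLp_two_iff_integrable_sq_norm hQm.aestronglyMeasurable]
    refine ((integrable_inv_one_add_sq).const_mul
      (A ^ 2 * E ^ (k + 2))).mono' (by fun_prop) (Eventually.of_forall fun τ => ?_)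
    rw [Real.norm_of_nonneg (by positivity)]
    refine (hQle τ).trans ?_
    gcongr
    refine (hone τ).trans ?_
    exact pow_le_pow_right₀ (by linarith [abs_nonneg τ]) (by norm_num)
  have h := hC η hη hηC Q hQm hQi hQ2
  have hop : ∀ ξ, phaseOp ψ η (k + 2) Q ξ = ∫ τ, phaseMellin ψ (ξ / η) τ * F τ := by
    intro ξ
    unfold phaseOp
    refine integral_congr_ae (Eventually.of_forall fun τ => ?_)
    have h1 : (1 + 2 * Real.pi * η * τ * I : ℂ) = D τ := by rw [hD]
    have h2 := hDne τ
    simp only [h1, hQ]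
    field_simp
  simp only [hop] at h
  refine h.trans ?_
  rw [show C * 2 ^ (k + 2) * η = C * η * 2 ^ (k + 2) by ring,
    ENNReal.ofReal_mul (p := C * η) (by positivity), mul_assoc,
    ← lintegral_const_mul' (ENNReal.ofReal (2 ^ (k + 2))) _ ENNReal.ofReal_ne_top]
  gcongr with τ
  rw [← ofReal_norm, ← ENNReal.ofReal_pow (norm_nonneg _), ← ENNReal.ofReal_mul (by positivity)]
  refine ENNReal.ofReal_le_ofReal ?_
  have hlw1 : 1 ≤ lw T τ := one_le_lw hT.le τ
  have hlw : lw T τ ^ 2 ≤ 2 * ‖D τ‖ ^ 2 := by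
    have h1 : lw T τ ≤ 1 + η * |τ| := by
      unfold lw
      have : |τ| / T ≤ η * |τ| := by
        rw [div_le_iff₀ hT]
        nlinarith [mul_le_mul_of_nonneg_right hηT (abs_nonneg τ)]
      linarith
    rw [hDsq]
    have h3 := hηx τ
    calc lw T τ ^ 2 ≤ (1 + η * |τ|) ^ 2 := by gcongr
      _ ≤ 2 * (1 + (η * τ) ^ 2) := by
          rw [mul_pow, ← sq_abs τ]; nlinarith [sq_nonneg (1 - η * |τ|)]
      _ ≤ _ := by linarith
  have hlw' : lw T τ ^ (2 * k + 2) ≤ 2 ^ (k + 2) * ‖D τ‖ ^ (2 * (k + 2)) := by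
    calc lw T τ ^ (2 * k + 2) ≤ lw T τ ^ (2 * (k + 2)) :=
          pow_le_pow_right₀ hlw1 (by omega)
      _ = (lw T τ ^ 2) ^ (k + 2) := by rw [pow_mul]
      _ ≤ (2 * ‖D τ‖ ^ 2) ^ (k + 2) := by gcongr
      _ = _ := by rw [mul_pow, ← pow_mul]
  rw [← hQsq τ]
  have hp : 0 < lw T τ ^ (2 * k + 2) := by positivity
  calc ‖Q τ‖ ^ 2 = ‖Q τ‖ ^ 2 * ((lw T τ ^ (2 * k + 2))⁻¹ * lw T τ ^ (2 * k + 2)) := by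
        field_simp
    _ ≤ ‖Q τ‖ ^ 2 * ((lw T τ ^ (2 * k + 2))⁻¹ *
        (2 ^ (k + 2) * ‖D τ‖ ^ (2 * (k + 2)))) := by gcongr
    _ = _ := by ring

end

section
open Set Filter Topology FourierTransform

lemma exists_support_bounds {Ψ : ℝ → ℝ} (hc : HasCompactSupport Ψ) (hs : tsupport Ψ ⊆ Ioi 0) :
    ∃ a b, 0 < a ∧ a ≤ b ∧ ∀ y, Ψ y ≠ 0 → a ≤ y ∧ y ≤ b := by
  obtain ⟨B, hB⟩ := hc.isCompact.isBounded.subset_closedBall (0 : ℝ)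
  by_cases hne : (tsupport Ψ).Nonempty
  · obtain ⟨a, ha, hmin⟩ := hc.isCompact.exists_isMinOn hne continuousOn_id
    refine ⟨a, max a B, hs ha, le_max_left _ _, fun y hy => ?_⟩
    have hy' := subset_tsupport Ψ hy
    have h2 := hB hy'
    rw [mem_closedBall_zero_iff, Real.norm_eq_abs] at h2
    exact ⟨hmin hy', (le_abs_self y).trans (h2.trans (le_max_right _ _))⟩
  · exact ⟨1, 1, one_pos, le_rfl, fun y hy => (hne ⟨y, subset_tsupport Ψ hy⟩).elim⟩

/-- `Ψ` in logarithmic coordinates, normalised for the critical line. -/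
noncomputable def logForm (Ψ : ℝ → ℝ) (u : ℝ) : ℂ := ((Ψ (Real.exp u) * Real.exp (u / 2) : ℝ) : ℂ)

lemma isTest_logForm {Ψ : ℝ → ℝ} (h : ContDiff ℝ (⊤ : ℕ∞) Ψ) (hc : HasCompactSupport Ψ)
    (hs : tsupport Ψ ⊆ Ioi 0) : IsTest (logForm Ψ) := by
  obtain ⟨a, b, ha, hab, hab'⟩ := exists_support_bounds hc hs
  constructor
  · have h0 : ContDiff ℝ (⊤ : ℕ∞) fun u : ℝ => Ψ (Real.exp u) * Real.exp (u / 2) :=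
      (h.comp Real.contDiff_exp).mul (by fun_prop)
    exact Complex.ofRealCLM.contDiff.comp h0
  · refine HasCompactSupport.intro (isCompact_Icc (a := Real.log a) (b := Real.log b))
      fun u hu => ?_
    unfold logForm
    by_contra hne
    have h1 : Ψ (Real.exp u) ≠ 0 := fun h2 => hne (by simp [h2])
    obtain ⟨h3, h4⟩ := hab' _ h1
    exact hu ⟨(Real.log_le_iff_le_exp ha).2 h3, (Real.le_log_iff_exp_le (ha.trans_le hab)).2 h4⟩

lemma nice_mul_phase {Ψ : ℝ → ℝ} (h : ContDiff ℝ (⊤ : ℕ∞) Ψ) (hc : HasCompactSupport Ψ)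
    (hs : tsupport Ψ ⊆ Ioi 0) {C : ℝ} (hC : 0 < C) (hv : ∀ y, C ≤ y → Ψ y = 0) (ζ : ℝ) :
    Nice C (fun y => Ψ y * cexp (2 * Real.pi * ζ * y * I)) (phaseMellin (logForm Ψ) ζ) where
  pos := hC
  vanish y hy := by simp [hv y hy]
  integrable := ((isTest_logForm h hc hs).mul_expPhase ζ).integrable_pow_fourier
  eq x hx := by
    have h1 := ((isTest_logForm h hc hs).mul_expPhase ζ).inversion (Real.log x)
    have h2 : ∀ τ : ℝ, ker x τ = cexp (2 * Real.pi * τ * Real.log x * I) *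
        ((Real.exp (-(Real.log x) / 2) : ℝ) : ℂ) := by
      intro τ
      unfold ker
      rw [Complex.ofReal_exp, ← Complex.exp_add]
      congr 1; push_cast; ring
    simp only [h2, ← mul_assoc]
    rw [integral_mul_const]
    change _ = (∫ τ, 𝓕 (fun u => logForm Ψ u * expPhase ζ u) τ * _) * _
    rw [← h1]
    unfold logForm expPhase
    rw [Real.exp_log hx]
    have h3 : Real.exp (Real.log x / 2) * Real.exp (-(Real.log x) / 2) = 1 := by
      rw [← Real.exp_add]; ring_nf; simp
    have h4 : (Real.exp (Real.log x / 2) : ℂ) * (Real.exp (-(Real.log x) / 2) : ℂ) = 1 := by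
      exact_mod_cast h3
    push_cast at h4 ⊢
    linear_combination (-((Ψ x : ℂ) * cexp (2 * Real.pi * ζ * x * I))) * h4

/-- The even extension of `Φ`. -/
noncomputable def evenForm (Φ : ℝ → ℝ) (x : ℝ) : ℂ := ((Φ x + Φ (-x) : ℝ) : ℂ)

lemma isTest_evenForm {Φ : ℝ → ℝ} (h : ContDiff ℝ (⊤ : ℕ∞) Φ) (hc : HasCompactSupport Φ) :
    IsTest (evenForm Φ) := by
  constructor
  · have h0 : ContDiff ℝ (⊤ : ℕ∞) fun x : ℝ => Φ x + Φ (-x) := h.add (h.comp contDiff_neg)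
    exact Complex.ofRealCLM.contDiff.comp h0
  · have h1 : HasCompactSupport fun x : ℝ => Φ (-x) :=
      hc.comp_homeomorph (Homeomorph.neg ℝ)
    have h2 : HasCompactSupport fun x : ℝ => Φ x + Φ (-x) := hc.add h1
    exact h2.comp_left (g := fun x : ℝ => (x : ℂ)) rfl

lemma evenForm_eq {Φ : ℝ → ℝ} (hs : tsupport Φ ⊆ Ioi 0) (x : ℝ) :
    evenForm Φ x = (Φ |x| : ℂ) := by
  have hz : ∀ y, y ≤ 0 → Φ y = 0 := by
    intro y hy
    by_contra h
    exact absurd (hs (subset_tsupport Φ h)) (not_lt.2 hy)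
  unfold evenForm
  rcases le_total 0 x with hx | hx
  · rw [abs_of_nonneg hx, hz (-x) (by linarith)]; simp
  · rw [abs_of_nonpos hx, hz x hx]; simp

/-- The bilinear form attached to the coefficients `c`. -/
noncomputable def bilin (Φ Ψ : ℝ → ℝ) (c : ℕ → ℂ) (η Y : ℝ) (K : ℕ) : ℂ :=
  ∑ m ∈ Finset.Ioc 0 K, ∑ n ∈ Finset.Ioc 0 K, c m * (starRingEnd ℂ) (c n) *
    ((Ψ (m / Y) * Ψ (n / Y) * Φ (|(m : ℝ) - n| / (η * Y)) : ℝ) : ℂ)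

lemma bilin_eq_integral {Φ Ψ : ℝ → ℝ} (hΦ : ContDiff ℝ (⊤ : ℕ∞) Φ) (hΦc : HasCompactSupport Φ)
    (hΦs : tsupport Φ ⊆ Ioi 0) (c : ℕ → ℂ) {η Y : ℝ} (hη : 0 < η) (hY : 0 < Y) (K : ℕ) :
    bilin Φ Ψ c η Y K = ∫ ξ, 𝓕 (evenForm Φ) ξ *
      ((‖∑ n ∈ Finset.Ioc 0 K, c n * (Ψ (n * Y⁻¹) *
        cexp (2 * Real.pi * (ξ / η : ℝ) * (n * Y⁻¹ : ℝ) * I))‖ ^ 2 : ℝ) : ℂ) := by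
  have hV := (isTest_evenForm hΦ hΦc).integrable_fourier
  have hexp : ∀ ξ : ℝ, ((‖∑ n ∈ Finset.Ioc 0 K, c n * (Ψ (n * Y⁻¹) *
        cexp (2 * Real.pi * (ξ / η : ℝ) * (n * Y⁻¹ : ℝ) * I))‖ ^ 2 : ℝ) : ℂ) =
      ∑ m ∈ Finset.Ioc 0 K, ∑ n ∈ Finset.Ioc 0 K, c m * (starRingEnd ℂ) (c n) *
        ((Ψ (m / Y) * Ψ (n / Y) : ℝ) : ℂ) *
          cexp (2 * Real.pi * ξ * (((m : ℝ) - n) / (η * Y) : ℝ) * I) := by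
    intro ξ
    rw [← normSq_eq_norm_sq, ← mul_conj, map_sum, Finset.sum_mul_sum]
    refine Finset.sum_congr rfl fun m _ => Finset.sum_congr rfl fun n _ => ?_
    simp only [map_mul, conj_ofReal, ← exp_conj, conj_I, map_ofNat]
    rw [show (((m : ℝ) - n) / (η * Y) : ℝ) = (m * Y⁻¹ - n * Y⁻¹) / η by field_simp,
      ← div_eq_mul_inv, ← div_eq_mul_inv]
    have h1 : cexp (2 * Real.pi * ξ * (((m / Y - n / Y) / η : ℝ) : ℂ) * I) =
        cexp (2 * Real.pi * (ξ / η : ℝ) * (m / Y : ℝ) * I) *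
          cexp (2 * Real.pi * (ξ / η : ℝ) * (n / Y : ℝ) * -I) := by
      rw [← Complex.exp_add]; congr 1; push_cast; field_simp; ring
    rw [h1]
    push_cast
    ring
  simp only [hexp, Finset.mul_sum]
  have hinteg : ∀ (a : ℂ) (x : ℝ), Integrable fun ξ : ℝ => 𝓕 (evenForm Φ) ξ *
      (a * cexp (2 * Real.pi * ξ * x * I)) := by
    intro a x
    have h1 : Integrable fun ξ : ℝ => (a * cexp (2 * Real.pi * ξ * x * I)) *
        𝓕 (evenForm Φ) ξ := by
      refine hV.bdd_mul (c := ‖a‖) (Continuous.aestronglyMeasurable (by fun_prop))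
        (Eventually.of_forall fun ξ => ?_)
      rw [norm_mul]
      have : ‖cexp (2 * Real.pi * ξ * x * I)‖ = 1 := by
        rw [← norm_exp_ofReal_mul_I (2 * Real.pi * ξ * x)]; push_cast; rfl
      rw [this, mul_one]
    exact h1.congr (Eventually.of_forall fun ξ => mul_comm _ _)
  rw [integral_finsetSum _ fun m _ => integrable_finsetSum _ fun n _ => hinteg _ _]
  refine Finset.sum_congr rfl fun m _ => ?_
  rw [integral_finsetSum _ fun n _ => hinteg _ _]
  refine Finset.sum_congr rfl fun n _ => ?_
  have h2 := (isTest_evenForm hΦ hΦc).inversion (((m : ℝ) - n) / (η * Y))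
  rw [evenForm_eq hΦs, abs_div, abs_of_pos (mul_pos hη hY)] at h2
  rw [ofReal_mul, h2, ← mul_assoc, ← integral_const_mul]
  refine integral_congr_ae (Eventually.of_forall fun ξ => ?_)
  simp only
  ring

theorem exists_bilin_bound (C₀ : ℝ) (k : ℕ) {Φ Ψ : ℝ → ℝ} (hΦ : ContDiff ℝ (⊤ : ℕ∞) Φ)
    (hΦc : HasCompactSupport Φ) (hΦs : tsupport Φ ⊆ Ioi 0) (hΨ : ContDiff ℝ (⊤ : ℕ∞) Ψ)
    (hΨc : HasCompactSupport Ψ) (hΨs : tsupport Ψ ⊆ Ioi 0) {b : ℝ} (hb : 0 < b)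
    (hv : ∀ y, b ≤ y → Ψ y = 0) :
    ∃ C, 0 ≤ C ∧ ∀ (c : ArithmeticFunction ℂ) (P : ℝ → ℂ), IsMultiplier c P →
      ∀ (A : ℝ), (∀ τ, ‖P τ‖ ≤ A * (1 + |τ|) ^ k) → ∀ η T J Y, 0 < η → η ≤ C₀ → 0 < T →
        1 ≤ η * T → 0 < Y → 0 ≤ J →
        ∫⁻ τ, ENNReal.ofReal ((lw T τ ^ (2 * k + 2))⁻¹ * ‖P τ‖ ^ 2) ≤ ENNReal.ofReal J →
        ∀ K : ℕ, b * Y ≤ K → ‖bilin Φ Ψ c η Y K‖ ≤ C * η * Y * J := by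
  obtain ⟨C, hC0, hC⟩ := exists_phaseOp_growth_bound C₀ k (isTest_logForm hΨ hΨc hΨs)
  obtain ⟨V, hV0, hV⟩ := (isTest_evenForm hΦ hΦc).fourier_decay (2 * (k + 2))
  refine ⟨V * C, by positivity, fun c P hP A hPA η T J Y hη hηC hT hηT hY hJ0 hJ K hK => ?_⟩
  have hS : ∀ ξ : ℝ, ∑ n ∈ Finset.Ioc 0 K, c n * (Ψ (n * Y⁻¹) *
        cexp (2 * Real.pi * (ξ / η : ℝ) * (n * Y⁻¹ : ℝ) * I)) =
      ∫ τ, phaseMellin (logForm Ψ) (ξ / η) τ * (P τ * ker Y⁻¹ τ) := by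
    intro ξ
    have h := hP.eq b _ _ (nice_mul_phase hΨ hΨc hΨs hb hv (ξ / η)) Y⁻¹ (inv_pos.2 hY) K
      (by rwa [← div_eq_mul_inv, le_div_iff₀ hY])
    simp only [← mul_assoc] at h ⊢
    exact h
  have hker : ∀ τ, ‖ker Y⁻¹ τ‖ ^ 2 = Y := by
    intro τ
    rw [norm_ker_eq (inv_pos.2 hY), ← Real.rpow_natCast, ← Real.rpow_mul (inv_pos.2 hY).le]
    norm_num
    rw [Real.rpow_neg_one, inv_inv]
  have hbd := hC η T hη hηC hT hηT (fun τ => P τ * ker Y⁻¹ τ) (A * √Y)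
    (hP.measurable.mul (continuous_ker _).measurable) (fun τ => by
      rw [norm_mul, ← Real.sqrt_sq (norm_nonneg (ker Y⁻¹ τ)), hker, mul_right_comm]
      exact mul_le_mul_of_nonneg_right (hPA τ) (Real.sqrt_nonneg _))
  simp only [← hS, norm_mul, mul_pow, hker] at hbd
  have h1 : ∫⁻ τ, ENNReal.ofReal ((lw T τ ^ (2 * k + 2))⁻¹ * (‖P τ‖ ^ 2 * Y)) ≤
      ENNReal.ofReal (J * Y) := by
    rw [ENNReal.ofReal_mul hJ0]
    refine le_trans (le_of_eq ?_) (mul_le_mul_left hJ _)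
    rw [← lintegral_mul_const' _ _ ENNReal.ofReal_ne_top]
    refine lintegral_congr fun τ => ?_
    have := lw_pos hT.le τ
    rw [← ENNReal.ofReal_mul (by positivity), mul_assoc]
  rw [bilin_eq_integral hΦ hΦc hΦs _ hη hY]
  have h2 : ‖∫ ξ, 𝓕 (evenForm Φ) ξ *
      ((‖∑ n ∈ Finset.Ioc 0 K, c n * (Ψ (n * Y⁻¹) *
        cexp (2 * Real.pi * (ξ / η : ℝ) * (n * Y⁻¹ : ℝ) * I))‖ ^ 2 : ℝ) : ℂ)‖ₑ ≤
      ENNReal.ofReal (V * C * η * Y * J) := by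
    refine (enorm_integral_le_lintegral_enorm _).trans ?_
    calc _ ≤ ∫⁻ ξ, ENNReal.ofReal V * ENNReal.ofReal (((1 + ξ ^ 2) ^ (k + 2))⁻¹ *
          ‖∑ n ∈ Finset.Ioc 0 K, c n * (Ψ (n * Y⁻¹) *
            cexp (2 * Real.pi * (ξ / η : ℝ) * (n * Y⁻¹ : ℝ) * I))‖ ^ 2) := by
          refine lintegral_mono fun ξ => ?_
          rw [← ofReal_norm, ← ENNReal.ofReal_mul hV0]
          refine ENNReal.ofReal_le_ofReal ?_
          rw [norm_mul, norm_real, Real.norm_of_nonneg (by positivity), ← mul_assoc]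
          refine mul_le_mul_of_nonneg_right ?_ (by positivity)
          rw [← div_eq_mul_inv, le_div_iff₀ (by positivity), mul_comm]
          refine le_trans ?_ (hV ξ)
          refine mul_le_mul_of_nonneg_right ?_ (norm_nonneg _)
          rw [pow_mul]
          refine pow_le_pow_left₀ (by positivity) ?_ _
          nlinarith [sq_abs ξ, abs_nonneg ξ]
      _ ≤ ENNReal.ofReal V * (ENNReal.ofReal (C * η) * ENNReal.ofReal (J * Y)) := by
          rw [lintegral_const_mul' _ _ ENNReal.ofReal_ne_top]
          refine mul_le_mul_right (hbd.trans (mul_le_mul_right ?_ _)) _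
          exact h1
      _ = _ := by
          rw [← ENNReal.ofReal_mul (by positivity), ← ENNReal.ofReal_mul hV0]
          congr 1; ring
  rw [← ofReal_norm] at h2
  exact (ENNReal.ofReal_le_ofReal_iff (by positivity)).1 h2

end

section
open Set Filter Topology

/-- The weighted moment of the `L`-function attached to a character. -/
noncomputable def momentLL (k : ℕ) (T : ℝ) {d : ℕ} (χ : DirichletCharacter ℂ d) : ℝ :=
  ∫ τ, (lw T τ ^ (2 * k + 2))⁻¹ * ‖LL χ τ‖ ^ (2 * k)

lemma momentLL_nonneg (k : ℕ) {T : ℝ} (hT : 0 ≤ T) {d : ℕ} (χ : DirichletCharacter ℂ d) :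
    0 ≤ momentLL k T χ := integral_nonneg fun τ => by
  have := lw_pos hT τ
  positivity

lemma exists_primitive_of_conductor_eq (f : ∀ d : ℕ, DirichletCharacter ℂ d → ℝ) {q d : ℕ}
    (χ : DirichletCharacter ℂ q) (h : χ.conductor = d) :
    ∃ ψ : DirichletCharacter ℂ d, ψ.IsPrimitive ∧ f _ χ.primitiveCharacter = f d ψ ∧
      ∃ hd : d ∣ q, χ = DirichletCharacter.changeLevel hd ψ := by
  subst h
  exact ⟨χ.primitiveCharacter, χ.primitiveCharacter_isPrimitive, rfl, χ.conductor_dvd_level,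
    χ.changeLevel_primitiveCharacter.symm⟩

lemma sum_primitiveCharacter_le (f : ∀ d : ℕ, DirichletCharacter ℂ d → ℝ)
    (hf : ∀ d χ, 0 ≤ f d χ) {q d : ℕ} [NeZero q] [NeZero d] :
    ∑ χ : DirichletCharacter ℂ q with χ.conductor = d, f _ χ.primitiveCharacter ≤
      ∑ ψ : DirichletCharacter ℂ d with ψ.IsPrimitive, f d ψ := by
  have h1 : ∀ χ : DirichletCharacter ℂ q, ∃ ψ : DirichletCharacter ℂ d, χ.conductor = d →
      ψ.IsPrimitive ∧ f _ χ.primitiveCharacter = f d ψ ∧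
      ∃ hd : d ∣ q, χ = DirichletCharacter.changeLevel hd ψ := by
    intro χ
    by_cases h : χ.conductor = d
    · obtain ⟨ψ, hψ⟩ := exists_primitive_of_conductor_eq f χ h
      exact ⟨ψ, fun _ => hψ⟩
    · exact ⟨1, fun h' => (h h').elim⟩
  choose g hg using h1
  have hinj : Set.InjOn g
      (Finset.univ.filter fun χ : DirichletCharacter ℂ q => χ.conductor = d) := by
    intro χ₁ h₁ χ₂ h₂ h
    simp only [Finset.coe_filter, Finset.mem_univ, true_and, mem_ofPred_eq] at h₁ h₂
    obtain ⟨hd, e₁⟩ := (hg χ₁ h₁).2.2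
    obtain ⟨_, e₂⟩ := (hg χ₂ h₂).2.2
    rw [e₁, e₂, h]
  calc _ = ∑ χ : DirichletCharacter ℂ q with χ.conductor = d, f d (g χ) :=
        Finset.sum_congr rfl fun χ hχ => (hg χ (Finset.mem_filter.1 hχ).2).2.1
    _ = ∑ ψ ∈ (Finset.univ.filter fun χ : DirichletCharacter ℂ q => χ.conductor = d).image g,
          f d ψ := (Finset.sum_image hinj).symm
    _ ≤ _ := by
        refine Finset.sum_le_sum_of_subset_of_nonneg ?_ fun ψ _ _ => hf d ψ
        intro ψ hψ
        obtain ⟨χ, hχ, rfl⟩ := Finset.mem_image.1 hψ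
        exact Finset.mem_filter.2 ⟨Finset.mem_univ _, (hg χ (Finset.mem_filter.1 hχ).2).1⟩

lemma exists_sum_momentLL {k : ℕ} (hk : 2 ≤ k) {ε : ℝ} (hε : 0 < ε) : ∃ C : ℝ, 0 ≤ C ∧
    ∀ (q : ℕ) [NeZero q] (T : ℝ), 1 ≤ T →
    ∑ χ : DirichletCharacter ℂ q with χ ≠ 1, momentLL k T χ.primitiveCharacter ≤
      C * q.divisors.card * q.totient * T * (q * T) ^ ((k : ℝ) / 2 - 1 + ε) := by
  obtain ⟨C, hC0, hC⟩ := exists_moment_LL hk hε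
  refine ⟨C, hC0, fun q _ T hT => ?_⟩
  have hk' : (2 : ℝ) ≤ k := by exact_mod_cast hk
  have hs : 0 ≤ (k : ℝ) / 2 - 1 + ε := by linarith
  have hT0 : 0 ≤ T := by linarith
  have hq0 : q ≠ 0 := NeZero.ne q
  have hmaps : ∀ χ ∈ Finset.univ.filter (fun χ : DirichletCharacter ℂ q => χ ≠ 1),
      χ.conductor ∈ q.divisors.erase 1 := by
    intro χ hχ
    refine Finset.mem_erase.2 ⟨fun h => (Finset.mem_filter.1 hχ).2 ?_,
      Nat.mem_divisors.2 ⟨χ.conductor_dvd_level, hq0⟩⟩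
    exact (DirichletCharacter.eq_one_iff_conductor_eq_one).2 h
  rw [← Finset.sum_fiberwise_of_maps_to hmaps]
  calc _ ≤ ∑ d ∈ q.divisors.erase 1,
        C * q.totient * T * (q * T) ^ ((k : ℝ) / 2 - 1 + ε) := by
        refine Finset.sum_le_sum fun d hd => ?_
        obtain ⟨hd1, hd⟩ := Finset.mem_erase.1 hd
        have hdq := Nat.dvd_of_mem_divisors hd
        have : NeZero d := ⟨(Nat.pos_of_mem_divisors hd).ne'⟩
        calc _ ≤ ∑ χ : DirichletCharacter ℂ q with χ.conductor = d,
              momentLL k T χ.primitiveCharacter := by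
              rw [Finset.filter_filter]
              refine Finset.sum_le_sum_of_subset_of_nonneg ?_
                fun χ _ _ => momentLL_nonneg k hT0 _
              exact Finset.monotone_filter_right _ fun χ _ h => h.2
          _ ≤ ∑ ψ : DirichletCharacter ℂ d with ψ.IsPrimitive, momentLL k T ψ :=
              sum_primitiveCharacter_le (fun d χ => momentLL k T χ)
                (fun d χ => momentLL_nonneg k hT0 χ)
          _ ≤ C * d.totient * T * (d * T) ^ ((k : ℝ) / 2 - 1 + ε) := hC d T hd1 hT
          _ ≤ _ := by
              have h1 : d.totient ≤ q.totient :=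
                Nat.le_of_dvd (Nat.totient_pos.2 (Nat.pos_of_ne_zero hq0))
                  (Nat.totient_dvd_of_dvd hdq)
              have h2 : d ≤ q := Nat.le_of_dvd (Nat.pos_of_ne_zero hq0) hdq
              gcongr
    _ ≤ ∑ d ∈ q.divisors, C * q.totient * T * (q * T) ^ ((k : ℝ) / 2 - 1 + ε) :=
        Finset.sum_le_sum_of_subset_of_nonneg (Finset.erase_subset _ _)
          fun _ _ _ => by positivity
    _ = _ := by rw [Finset.sum_const, nsmul_eq_mul]; ring

lemma bilin_congr {Φ Ψ : ℝ → ℝ} {c c' : ℕ → ℂ} (h : ∀ n, n ≠ 0 → c n = c' n) (η Y : ℝ) (K : ℕ) :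
    bilin Φ Ψ c η Y K = bilin Φ Ψ c' η Y K := by
  unfold bilin
  refine Finset.sum_congr rfl fun m hm => Finset.sum_congr rfl fun n hn => ?_
  rw [h m (Finset.mem_Ioc.1 hm).1.ne', h n (Finset.mem_Ioc.1 hn).1.ne']

theorem exists_sum_bilin_bound {k : ℕ} (hk : 2 ≤ k) (C₀ : ℝ) {ε : ℝ} (hε : 0 < ε)
    {Φ Ψ : ℝ → ℝ} (hΦ : ContDiff ℝ (⊤ : ℕ∞) Φ)
    (hΦc : HasCompactSupport Φ) (hΦs : tsupport Φ ⊆ Ioi 0) (hΨ : ContDiff ℝ (⊤ : ℕ∞) Ψ)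
    (hΨc : HasCompactSupport Ψ) (hΨs : tsupport Ψ ⊆ Ioi 0) {b : ℝ} (hb : 0 < b)
    (hv : ∀ y, b ≤ y → Ψ y = 0) :
    ∃ C, 0 ≤ C ∧ ∀ (q : ℕ) [NeZero q] (G D : ℕ), 0 < G → G.divisors.card ≤ D →
      ∀ η Y, 0 < η → η ≤ C₀ → 0 < Y → ∀ K : ℕ, b * Y ≤ K →
      ∑ χ : DirichletCharacter ℂ q with χ ≠ 1,
        ‖bilin Φ Ψ (fun n => dk k (G * n) * χ n) η Y K‖ ≤
      C * Y * q.totient * (D ^ 2 * q.divisors.card) ^ (2 * k) * q.divisors.card *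
        (q / η) ^ ((k : ℝ) / 2 - 1 + ε) := by
  obtain ⟨C, hC0, hC⟩ := exists_bilin_bound C₀ k hΦ hΦc hΦs hΨ hΨc hΨs hb hv
  obtain ⟨C', hC'0, hC'⟩ := exists_sum_momentLL hk hε
  obtain ⟨C₁, hC₁⟩ : ∃ C₁, C₁ = max C₀ 1 := ⟨_, rfl⟩
  have hC₁0 : C₀ ≤ C₁ := hC₁ ▸ le_max_left _ _
  have hC₁1 : 1 ≤ C₁ := hC₁ ▸ le_max_right _ _
  have hC₁p : 0 < C₁ := by linarith
  refine ⟨C * C' * C₁ * C₁ ^ ((k : ℝ) / 2 - 1 + ε), by positivity,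
    fun q _ G D hG hD η Y hη hηC hY K hK => ?_⟩
  obtain ⟨T, hT⟩ : ∃ T, T = C₁ / η := ⟨_, rfl⟩
  have hT1 : 1 ≤ T := by rw [hT, le_div_iff₀ hη]; linarith
  have hT0 : 0 < T := by linarith
  have hηT : η * T = C₁ := by rw [hT]; field_simp
  have hq0 : q ≠ 0 := NeZero.ne q
  obtain ⟨E, hE⟩ : ∃ E : ℝ, E = D ^ 2 * q.divisors.card := ⟨_, rfl⟩
  have hE0 : 0 ≤ E := by rw [hE]; positivity
  have hone : ∀ χ : DirichletCharacter ℂ q, χ ≠ 1 →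
      ‖bilin Φ Ψ (fun n => dk k (G * n) * χ n) η Y K‖ ≤
        C * η * Y * (E ^ (2 * k) * momentLL k T χ.primitiveCharacter) := by
    intro χ hχ
    obtain ⟨P, hP, hPb⟩ := exists_isMultiplier_dkFn χ hχ k G hG hD
    rw [← hE] at hPb
    have : NeZero χ.conductor := ⟨χ.conductor_ne_zero⟩
    have hc1 : χ.conductor ≠ 1 := fun h =>
      hχ ((DirichletCharacter.eq_one_iff_conductor_eq_one).2 h)
    have hprim := χ.primitiveCharacter_isPrimitive
    obtain ⟨A, hA0, hA⟩ := exists_norm_LL_le χ.primitiveCharacter hprim hc1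
    rw [bilin_congr (c' := dkFn k G χ) fun n hn => (dkFn_apply k G χ hn).symm]
    refine hC _ P hP ((E * A) ^ k) (fun τ => ?_) η T _ Y hη hηC hT0 (by linarith) hY
      (mul_nonneg (by positivity) (momentLL_nonneg k hT0.le _)) ?_ K hK
    · refine (hPb τ).trans ?_
      rw [← mul_pow, mul_assoc]
      have := hA τ
      gcongr
    · unfold momentLL
      rw [← integral_const_mul, ofReal_integral_eq_lintegral_ofReal
        ((integrable_moment_LL k _ hprim hc1 hT1).const_mul _)
        (Eventually.of_forall fun τ => by
          have := lw_pos hT0.le τ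
          change 0 ≤ _
          positivity)]
      refine lintegral_mono fun τ => ENNReal.ofReal_le_ofReal ?_
      have hl := lw_pos hT0.le τ
      calc _ ≤ (lw T τ ^ (2 * k + 2))⁻¹ * ((E * ‖LL χ.primitiveCharacter τ‖) ^ k) ^ 2 := by
            have := hPb τ
            gcongr
        _ = _ := by rw [← pow_mul, mul_pow, mul_comm k 2]; ring
  calc _ ≤ ∑ χ : DirichletCharacter ℂ q with χ ≠ 1,
        C * η * Y * (E ^ (2 * k) * momentLL k T χ.primitiveCharacter) :=
        Finset.sum_le_sum fun χ hχ => hone χ (Finset.mem_filter.1 hχ).2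
    _ = C * η * Y * E ^ (2 * k) *
        ∑ χ : DirichletCharacter ℂ q with χ ≠ 1, momentLL k T χ.primitiveCharacter := by
        rw [Finset.mul_sum]; refine Finset.sum_congr rfl fun χ _ => ?_; ring
    _ ≤ C * η * Y * E ^ (2 * k) *
        (C' * q.divisors.card * q.totient * T * (q * T) ^ ((k : ℝ) / 2 - 1 + ε)) :=
        mul_le_mul_of_nonneg_left (hC' q T hT1) (by positivity)
    _ = _ := by
        rw [show (q : ℝ) * T = C₁ * (q / η) by rw [hT]; ring,
          Real.mul_rpow hC₁p.le (by positivity), ← hE, ← hηT]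
        ring

end

section
open Set Filter Topology

lemma tsum_four_eq_sum {F : ℕ → ℕ → ℕ → ℕ → ℂ} {S T : Finset ℕ}
    (h : ∀ m n a r, F m n a r ≠ 0 → m ∈ S ∧ n ∈ S ∧ a ∈ S ∧ r ∈ T) :
    ∑' m, ∑' n, ∑' a, ∑' r, F m n a r =
      ∑ m ∈ S, ∑ n ∈ S, ∑ a ∈ S, ∑ r ∈ T, F m n a r := by
  have h' : ∀ m n a r, ¬(m ∈ S ∧ n ∈ S ∧ a ∈ S ∧ r ∈ T) → F m n a r = 0 := fun m n a r hn => by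
    by_contra hne
    exact hn (h m n a r hne)
  have h1 : ∀ m n a, ∑' r, F m n a r = ∑ r ∈ T, F m n a r := fun m n a =>
    tsum_eq_sum fun r hr => h' m n a r (by tauto)
  have h2 : ∀ m n, ∑' a, ∑ r ∈ T, F m n a r = ∑ a ∈ S, ∑ r ∈ T, F m n a r := fun m n =>
    tsum_eq_sum fun a ha => Finset.sum_eq_zero fun r _ => h' m n a r (by tauto)
  have h3 : ∀ m, ∑' n, ∑ a ∈ S, ∑ r ∈ T, F m n a r = ∑ n ∈ S, ∑ a ∈ S, ∑ r ∈ T, F m n a r :=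
    fun m => tsum_eq_sum fun n hn => Finset.sum_eq_zero fun a _ =>
      Finset.sum_eq_zero fun r _ => h' m n a r (by tauto)
  simp only [h1, h2, h3]
  exact tsum_eq_sum fun m hm => Finset.sum_eq_zero fun n _ => Finset.sum_eq_zero fun a _ =>
      Finset.sum_eq_zero fun r _ => h' m n a r (by tauto)

lemma sum_comp_mul {N : ℕ} {h : ℕ → ℂ} (hh : ∀ m, N < m → h m = 0) {g : ℕ} (hg : 0 < g) :
    ∑ m ∈ Finset.Ioc 0 N, h (g * m) = ∑ m ∈ Finset.Ioc 0 N, if g ∣ m then h m else 0 := by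
  rw [← Finset.sum_filter]
  have h1 : ∑ m ∈ Finset.Ioc 0 N, h (g * m) =
      ∑ m ∈ (Finset.Ioc 0 N).filter (fun m => g * m ≤ N), h (g * m) := by
    refine (Finset.sum_filter_of_ne fun m _ hne => ?_).symm
    by_contra hlt
    exact hne (hh _ (not_le.1 hlt))
  rw [h1]
  refine Finset.sum_nbij' (fun m => g * m) (fun m => m / g) ?_ ?_ ?_ ?_ ?_
  · intro m hm
    simp only [Finset.mem_filter, Finset.mem_Ioc] at hm ⊢
    exact ⟨⟨Nat.mul_pos hg hm.1.1, hm.2⟩, dvd_mul_right _ _⟩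
  · intro m hm
    simp only [Finset.mem_filter, Finset.mem_Ioc] at hm ⊢
    obtain ⟨⟨hm0, hmN⟩, c, rfl⟩ := hm
    rw [Nat.mul_div_cancel_left _ hg]
    exact ⟨⟨Nat.pos_of_mul_pos_left hm0, (Nat.le_mul_of_pos_left _ hg).trans hmN⟩, hmN⟩
  · intro m _
    exact Nat.mul_div_cancel_left _ hg
  · intro m hm
    exact Nat.mul_div_cancel' (Finset.mem_filter.1 hm).2
  · intro m _; rfl

lemma sum_sum_comp_mul {N : ℕ} {h : ℕ → ℕ → ℂ} (hh : ∀ m n, N < m ∨ N < n → h m n = 0) {g : ℕ}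
    (hg : 0 < g) :
    ∑ m ∈ Finset.Ioc 0 N, ∑ n ∈ Finset.Ioc 0 N, h (g * m) (g * n) =
      ∑ m ∈ Finset.Ioc 0 N, ∑ n ∈ Finset.Ioc 0 N, if g ∣ m ∧ g ∣ n then h m n else 0 := by
  have h1 : ∀ m, ∑ n ∈ Finset.Ioc 0 N, h (g * m) (g * n) =
      ∑ n ∈ Finset.Ioc 0 N, if g ∣ n then h (g * m) n else 0 := fun m =>
    sum_comp_mul (fun n hn => hh _ n (Or.inr hn)) hg
  simp only [h1]
  rw [sum_comp_mul (h := fun m => ∑ n ∈ Finset.Ioc 0 N, if g ∣ n then h m n else 0) _ hg]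
  · refine Finset.sum_congr rfl fun m _ => ?_
    split_ifs with hm
    · simp [hm]
    · simp [hm]
  · intro m hm
    refine Finset.sum_eq_zero fun n _ => ?_
    rw [hh m n (Or.inl hm), ite_self]

lemma sum_sum_eq_sum_gcd {N : ℕ} {f : ℕ → ℕ → ℂ} (hf : ∀ m n, N < m ∨ N < n → f m n = 0) :
    ∑ m ∈ Finset.Ioc 0 N, ∑ n ∈ Finset.Ioc 0 N, f m n =
      ∑ g ∈ Finset.Ioc 0 N, ∑ m ∈ Finset.Ioc 0 N, ∑ n ∈ Finset.Ioc 0 N,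
        if m.Coprime n then f (g * m) (g * n) else 0 := by
  have h1 : ∀ g ∈ Finset.Ioc 0 N, (∑ m ∈ Finset.Ioc 0 N, ∑ n ∈ Finset.Ioc 0 N,
        if m.Coprime n then f (g * m) (g * n) else 0) =
      ∑ m ∈ Finset.Ioc 0 N, ∑ n ∈ Finset.Ioc 0 N, if m.gcd n = g then f m n else 0 := by
    intro g hg
    have hg0 : 0 < g := (Finset.mem_Ioc.1 hg).1
    have h2 := sum_sum_comp_mul (N := N) (g := g)
      (h := fun m n => if (m / g).Coprime (n / g) then f m n else 0)
      (fun m n hmn => by rw [hf m n hmn, ite_self]) hg0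
    simp only [Nat.mul_div_cancel_left _ hg0] at h2
    rw [h2]
    refine Finset.sum_congr rfl fun m _ => Finset.sum_congr rfl fun n _ => ?_
    by_cases hmn : g ∣ m ∧ g ∣ n
    · rw [if_pos hmn]
      obtain ⟨⟨c, rfl⟩, d, rfl⟩ := hmn
      rw [Nat.mul_div_cancel_left _ hg0, Nat.mul_div_cancel_left _ hg0, Nat.gcd_mul_left]
      refine if_congr ?_ rfl rfl
      unfold Nat.Coprime
      constructor
      · intro h; rw [h, mul_one]
      · intro h; exact Nat.eq_of_mul_eq_mul_left hg0 (by rw [h, mul_one])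
    · rw [if_neg hmn, if_neg]
      rintro rfl
      exact hmn ⟨Nat.gcd_dvd_left _ _, Nat.gcd_dvd_right _ _⟩
  rw [Finset.sum_congr rfl h1]
  symm
  rw [Finset.sum_comm]
  refine Finset.sum_congr rfl fun m hm => ?_
  rw [Finset.sum_comm]
  refine Finset.sum_congr rfl fun n hn => ?_
  rw [Finset.sum_ite_eq, if_pos]
  obtain ⟨hm0, hmN⟩ := Finset.mem_Ioc.1 hm
  exact Finset.mem_Ioc.2 ⟨Nat.gcd_pos_of_pos_left _ hm0, (Nat.gcd_le_left _ hm0).trans hmN⟩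

lemma sum_coprime_eq_sum_moebius {N : ℕ} {h : ℕ → ℕ → ℂ}
    (hh : ∀ m n, N < m ∨ N < n → h m n = 0) :
    (∑ m ∈ Finset.Ioc 0 N, ∑ n ∈ Finset.Ioc 0 N, if m.Coprime n then h m n else 0) =
      ∑ e ∈ Finset.Ioc 0 N, ((ArithmeticFunction.moebius e : ℤ) : ℂ) *
        ∑ m ∈ Finset.Ioc 0 N, ∑ n ∈ Finset.Ioc 0 N, h (e * m) (e * n) := by
  have h1 : ∀ e ∈ Finset.Ioc 0 N, ((ArithmeticFunction.moebius e : ℤ) : ℂ) *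
        ∑ m ∈ Finset.Ioc 0 N, ∑ n ∈ Finset.Ioc 0 N, h (e * m) (e * n) =
      ∑ m ∈ Finset.Ioc 0 N, ∑ n ∈ Finset.Ioc 0 N,
        (if e ∣ m ∧ e ∣ n then ((ArithmeticFunction.moebius e : ℤ) : ℂ) else 0) * h m n := by
    intro e he
    rw [sum_sum_comp_mul hh (Finset.mem_Ioc.1 he).1, Finset.mul_sum]
    refine Finset.sum_congr rfl fun m _ => ?_
    rw [Finset.mul_sum]
    refine Finset.sum_congr rfl fun n _ => ?_
    split_ifs <;> simp
  rw [Finset.sum_congr rfl h1]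
  symm
  rw [Finset.sum_comm]
  refine Finset.sum_congr rfl fun m hm => ?_
  rw [Finset.sum_comm]
  refine Finset.sum_congr rfl fun n hn => ?_
  rw [← Finset.sum_mul]
  obtain ⟨hm0, hmN⟩ := Finset.mem_Ioc.1 hm
  have h2 := sum_moebius_gcd (n := n) (m := m) (Finset.mem_Ioc.1 hn).1.ne' hm0.ne'
  have h3 : (∑ e ∈ Finset.Ioc 0 N,
      if e ∣ m ∧ e ∣ n then ((ArithmeticFunction.moebius e : ℤ) : ℂ) else 0) =
      if n.Coprime m then 1 else 0 := by
    rw [← h2, ← Finset.sum_filter]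
    refine Finset.sum_congr ?_ fun _ _ => rfl
    ext e
    simp only [Finset.mem_filter, Finset.mem_Ioc, Nat.mem_divisors]
    constructor
    · rintro ⟨-, h4, h5⟩
      exact ⟨⟨h4, hm0.ne'⟩, h5⟩
    · rintro ⟨⟨h4, -⟩, h5⟩
      exact ⟨⟨Nat.pos_of_dvd_of_pos h4 hm0, (Nat.le_of_dvd hm0 h4).trans hmN⟩, h4, h5⟩
  rw [h3]
  by_cases hc : m.Coprime n
  · rw [if_pos hc, if_pos hc.symm, one_mul]
  · rw [if_neg hc, if_neg (mt Nat.Coprime.symm hc), zero_mul]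

end

section
open Set Filter Topology

/-- The sum of `χ m * conj (χ n)` over the non-principal characters modulo `q`. -/
noncomputable def nonprincipalSum (q m n : ℕ) : ℂ :=
  ∑' χ : DirichletCharacter ℂ q,
    (if χ ≠ 1 then χ (m : ZMod q) * (starRingEnd ℂ) (χ (n : ZMod q)) else 0)

lemma nonprincipalSum_eq_sum (q : ℕ) [NeZero q] (m n : ℕ) :
    nonprincipalSum q m n =
      ∑ χ : DirichletCharacter ℂ q with χ ≠ 1,
        χ (m : ZMod q) * (starRingEnd ℂ) (χ (n : ZMod q)) := by
  rw [nonprincipalSum, tsum_fintype, Finset.sum_filter]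
  refine Finset.sum_congr rfl fun χ _ => ?_
  congr

/-- The real weight attached to a coprime pair `(m, n)` and a common divisor `g`. -/
noncomputable def pairWeight (k : ℕ) (Φ Ψ : ℝ → ℝ) (Q X : ℝ) (g r m n : ℕ) : ℝ :=
  dk k (g * m) * dk k (g * n) * Ψ ((g * m : ℕ) / X) * Ψ ((g * n : ℕ) / X) *
    Φ (|(m : ℝ) - n| / (r * Q))

lemma pairWeight_mul_nonprincipalSum (k : ℕ) (Φ Ψ : ℝ → ℝ) {Q X : ℝ} (hX : 0 < X) (q : ℕ)
    [NeZero q] {g r e : ℕ} (hg : 0 < g) (hr : 0 < r) (he : 0 < e) (N : ℕ) :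
    ∑ m ∈ Finset.Ioc 0 N, ∑ n ∈ Finset.Ioc 0 N,
        (pairWeight k Φ Ψ Q X g r (e * m) (e * n) : ℂ) * nonprincipalSum q (e * m) (e * n) =
      ∑ χ : DirichletCharacter ℂ q with χ ≠ 1, χ (e : ZMod q) * (starRingEnd ℂ) (χ (e : ZMod q)) *
        bilin Φ Ψ (fun n => dk k (g * e * n) * χ (n : ZMod q)) (r * g * Q / X)
          (X / (g * e : ℕ)) N := by
  have hg' : (g : ℝ) ≠ 0 := by positivity
  have he' : (e : ℝ) ≠ 0 := by positivity
  have hr' : (r : ℝ) ≠ 0 := by positivity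
  simp only [nonprincipalSum_eq_sum, bilin, Finset.mul_sum]
  symm
  rw [Finset.sum_comm]
  refine Finset.sum_congr rfl fun m _ => ?_
  rw [Finset.sum_comm]
  refine Finset.sum_congr rfl fun n _ => Finset.sum_congr rfl fun χ _ => ?_
  have h1 : ∀ j : ℕ, (j : ℝ) / (X / (g * e : ℕ)) = (g * (e * j) : ℕ) / X := fun j => by
    push_cast
    field_simp
  have h2 : |(m : ℝ) - n| / (r * g * Q / X * (X / (g * e : ℕ))) =
      |((e * m : ℕ) : ℝ) - (e * n : ℕ)| / (r * Q) := by
    push_cast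
    rw [← mul_sub, abs_mul, abs_of_pos (by positivity : (0 : ℝ) < e)]
    by_cases hQ : Q = 0
    · simp [hQ]
    · field_simp
  rw [h1, h1, h2, pairWeight]
  simp only [Nat.cast_mul, map_mul, mul_assoc, ofReal_mul, ofReal_natCast, Complex.conj_natCast]
  ring

lemma norm_coprime_sum_le (k : ℕ) {Φ Ψ : ℝ → ℝ} {Q X : ℝ} (hX : 0 < X) {N : ℕ}
    (hN : ∀ m : ℕ, N < m → Ψ (m / X) = 0) (q : ℕ)
    [NeZero q] {g r : ℕ} (hg : 0 < g) (hr : 0 < r) :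
    ‖∑ m ∈ Finset.Ioc 0 N, ∑ n ∈ Finset.Ioc 0 N, if m.Coprime n then
        (pairWeight k Φ Ψ Q X g r m n : ℂ) * nonprincipalSum q m n else 0‖ ≤
      ∑ e ∈ Finset.Ioc 0 N, ∑ χ : DirichletCharacter ℂ q with χ ≠ 1,
        ‖bilin Φ Ψ (fun n => dk k (g * e * n) * χ (n : ZMod q)) (r * g * Q / X)
          (X / (g * e : ℕ)) N‖ := by
  rw [sum_coprime_eq_sum_moebius]
  · refine (norm_sum_le _ _).trans (Finset.sum_le_sum fun e he => ?_)
    rw [pairWeight_mul_nonprincipalSum k Φ Ψ hX q hg hr (Finset.mem_Ioc.1 he).1, norm_mul]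
    have h1 : ‖((ArithmeticFunction.moebius e : ℤ) : ℂ)‖ ≤ 1 := by
      rw [Complex.norm_intCast]
      exact_mod_cast ArithmeticFunction.abs_moebius_le_one
    refine (mul_le_of_le_one_left (norm_nonneg _) h1).trans
      ((norm_sum_le _ _).trans (Finset.sum_le_sum fun χ _ => ?_))
    rw [norm_mul, norm_mul, RCLike.norm_conj]
    have h2 := χ.norm_le_one (e : ZMod q)
    exact mul_le_of_le_one_left (norm_nonneg _)
      (mul_le_one₀ h2 (norm_nonneg _) h2)
  · rintro m n (h | h)
    · rw [pairWeight, hN (g * m) (h.trans_le (Nat.le_mul_of_pos_left _ hg))]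
      simp
    · rw [pairWeight, hN (g * n) (h.trans_le (Nat.le_mul_of_pos_left _ hg))]
      simp

lemma EGk_eq_sum (k : ℕ) {Φ Ψ : ℝ → ℝ} {Q X : ℝ} {N R : ℕ}
    (hN : ∀ m : ℕ, N < m → Ψ (m / X) = 0)
    (hR : ∀ m n r : ℕ, m ≤ N → n ≤ N → R < r → Φ (|(m : ℝ) - n| / (r * Q)) = 0) :
    EGk k Φ Ψ Q X = ∑ g ∈ Finset.Ioc 0 N, ∑ a ∈ g.divisors, ∑ r ∈ Finset.Ioc 0 R,
      (((ArithmeticFunction.moebius a : ℤ) : ℝ) / (Nat.totient (a * r) : ℝ) : ℝ) *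
        ∑ m ∈ Finset.Ioc 0 N, ∑ n ∈ Finset.Ioc 0 N, if m.Coprime n then
          (pairWeight k Φ Ψ Q X g r m n : ℂ) * nonprincipalSum (a * r) m n else 0 := by
  obtain ⟨F, hF⟩ : ∃ F : ℕ → ℕ → ℕ → ℕ → ℂ, F = fun m n a r =>
    if 1 ≤ m ∧ 1 ≤ n ∧ 1 ≤ r ∧ a ∣ Nat.gcd m n then
      (((dk k m : ℝ) * (dk k n : ℝ) * Ψ ((m : ℝ) / X) * Ψ ((n : ℝ) / X) *
          (((ArithmeticFunction.moebius a : ℤ) : ℝ) / (Nat.totient (a * r) : ℝ)) *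
          Φ (|((m / Nat.gcd m n : ℕ) : ℝ) - ((n / Nat.gcd m n : ℕ) : ℝ)| /
              ((r : ℝ) * Q)) : ℝ) : ℂ) *
        nonprincipalSum (a * r) (m / Nat.gcd m n) (n / Nat.gcd m n)
    else 0 := ⟨_, rfl⟩
  have hEG : EGk k Φ Ψ Q X = ∑' m, ∑' n, ∑' a, ∑' r, F m n a r := by rw [hF]; rfl
  have hFm : ∀ m n a r, N < m → F m n a r = 0 := fun m n a r h => by
    simp only [hF, hN m h]; simp
  have hFn : ∀ m n a r, N < n → F m n a r = 0 := fun m n a r h => by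
    simp only [hF, hN n h]; simp
  rw [hEG, tsum_four_eq_sum (S := Finset.Ioc 0 N) (T := Finset.Ioc 0 R)]
  · rw [sum_sum_eq_sum_gcd]
    · refine Finset.sum_congr rfl fun g hg => ?_
      obtain ⟨hg0, hgN⟩ := Finset.mem_Ioc.1 hg
      have hdiv : g.divisors ⊆ Finset.Ioc 0 N := fun a ha =>
        Finset.mem_Ioc.2 ⟨Nat.pos_of_mem_divisors ha, (Nat.divisor_le ha).trans hgN⟩
      have hFg : ∀ m ∈ Finset.Ioc 0 N, ∀ n ∈ Finset.Ioc 0 N,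
          (if m.Coprime n then ∑ a ∈ Finset.Ioc 0 N, ∑ r ∈ Finset.Ioc 0 R, F (g * m) (g * n) a r
            else 0) = ∑ a ∈ g.divisors, ∑ r ∈ Finset.Ioc 0 R,
          (((ArithmeticFunction.moebius a : ℤ) : ℝ) / (Nat.totient (a * r) : ℝ) : ℝ) *
           (if m.Coprime n then
          (pairWeight k Φ Ψ Q X g r m n : ℂ) * nonprincipalSum (a * r) m n else 0) := by
        intro m hm n hn
        by_cases hc : m.Coprime n
        · have hgcd : (g * m).gcd (g * n) = g := by
            rw [Nat.gcd_mul_left, Nat.Coprime.gcd_eq_one hc, mul_one]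
          simp only [if_pos hc]
          symm
          rw [← Finset.sum_subset hdiv]
          · refine Finset.sum_congr rfl fun a ha => Finset.sum_congr rfl fun r hr => ?_
            have hcond : 1 ≤ g * m ∧ 1 ≤ g * n ∧ 1 ≤ r ∧ a ∣ Nat.gcd (g * m) (g * n) :=
              ⟨Nat.mul_pos hg0 (Finset.mem_Ioc.1 hm).1, Nat.mul_pos hg0 (Finset.mem_Ioc.1 hn).1,
                (Finset.mem_Ioc.1 hr).1, by rw [hgcd]; exact Nat.dvd_of_mem_divisors ha⟩
            simp only [hF]
            rw [if_pos hcond, hgcd, Nat.mul_div_cancel_left _ hg0, Nat.mul_div_cancel_left _ hg0,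
              pairWeight, ← mul_assoc, ← ofReal_mul]
            congr 2
            ring
          · intro a _ ha
            refine Finset.sum_eq_zero fun r _ => ?_
            simp only [hF]
            rw [if_neg]
            rintro ⟨-, -, -, h⟩
            rw [hgcd] at h
            exact ha (Nat.mem_divisors.2 ⟨h, hg0.ne'⟩)
        · simp [hc]
      rw [Finset.sum_congr rfl fun m hm => Finset.sum_congr rfl fun n hn => hFg m hm n hn]
      simp only [Finset.mul_sum]
      rw [Finset.sum_congr rfl fun m _ => Finset.sum_comm, Finset.sum_comm]
      refine Finset.sum_congr rfl fun a _ => ?_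
      rw [Finset.sum_congr rfl fun m _ => Finset.sum_comm, Finset.sum_comm]
    · rintro m n (h | h)
      · simp [hFm _ _ _ _ h]
      · simp [hFn _ _ _ _ h]
  · intro m n a r hne
    have hm : m ≤ N := not_lt.1 fun h => hne (hFm _ _ _ _ h)
    have hn : n ≤ N := not_lt.1 fun h => hne (hFn _ _ _ _ h)
    simp only [hF] at hne
    obtain ⟨⟨hm1, hn1, hr1, ha⟩, hne⟩ := ite_ne_right_iff.1 hne
    have hgpos : 0 < m.gcd n := Nat.gcd_pos_of_pos_left _ hm1
    refine ⟨Finset.mem_Ioc.2 ⟨hm1, hm⟩, Finset.mem_Ioc.2 ⟨hn1, hn⟩, Finset.mem_Ioc.2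
      ⟨Nat.pos_of_dvd_of_pos ha hgpos,
        (Nat.le_of_dvd hgpos ha).trans ((Nat.gcd_le_left _ hm1).trans hm)⟩,
      Finset.mem_Ioc.2 ⟨hr1, not_lt.1 fun h => hne ?_⟩⟩
    rw [hR _ _ _ ((Nat.div_le_self _ _).trans hm) ((Nat.div_le_self _ _).trans hn) h]
    simp

end

section
open Set Filter Topology

lemma exists_sum_inv_le {δ : ℝ} (hδ : 0 < δ) :
    ∃ A : ℝ, 0 ≤ A ∧ ∀ N : ℕ, ∑ g ∈ Finset.Ioc 0 N, (g : ℝ)⁻¹ ≤ A * (N : ℝ) ^ δ := by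
  have hs : Summable fun n : ℕ => ((n : ℝ) ^ (1 + δ))⁻¹ :=
    Real.summable_nat_rpow_inv.2 (by linarith)
  have h0 : ∀ n : ℕ, 0 ≤ ((n : ℝ) ^ (1 + δ))⁻¹ := fun n => by positivity
  refine ⟨∑' n : ℕ, ((n : ℝ) ^ (1 + δ))⁻¹, tsum_nonneg h0, fun N => ?_⟩
  calc ∑ g ∈ Finset.Ioc 0 N, (g : ℝ)⁻¹
      ≤ ∑ g ∈ Finset.Ioc 0 N, ((g : ℝ) ^ (1 + δ))⁻¹ * (N : ℝ) ^ δ := by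
        refine Finset.sum_le_sum fun g hg => ?_
        obtain ⟨hg0, hgN⟩ := Finset.mem_Ioc.1 hg
        have hg' : (0 : ℝ) < g := by exact_mod_cast hg0
        rw [Real.rpow_add hg', Real.rpow_one, mul_inv, mul_assoc]
        refine le_mul_of_one_le_right (by positivity) ?_
        rw [inv_mul_eq_div, one_le_div (by positivity)]
        exact Real.rpow_le_rpow hg'.le (by exact_mod_cast hgN) hδ.le
    _ = (∑ g ∈ Finset.Ioc 0 N, ((g : ℝ) ^ (1 + δ))⁻¹) * (N : ℝ) ^ δ := (Finset.sum_mul _ _ _).symm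
    _ ≤ _ := mul_le_mul_of_nonneg_right (hs.sum_le_tsum _ fun n _ => h0 n) (by positivity)

lemma exists_card_divisors_le_of_le_sq {δ : ℝ} (hδ : 0 < δ) {B : ℝ} (hB : 0 ≤ B) :
    ∃ A : ℝ, 0 ≤ A ∧ ∀ X : ℝ, 1 ≤ X → ∀ n : ℕ, n ≠ 0 → (n : ℝ) ≤ B * X ^ 2 →
      (n.divisors.card : ℝ) ≤ A * X ^ δ := by
  obtain ⟨A, hA, h⟩ := exists_card_divisors_le (half_pos hδ)
  refine ⟨A * B ^ (δ / 2), by positivity, fun X hX n hn hnB => (h n hn).trans ?_⟩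
  have hX0 : 0 ≤ X := by linarith
  rw [mul_assoc]
  refine mul_le_mul_of_nonneg_left ?_ (by linarith)
  refine (Real.rpow_le_rpow (Nat.cast_nonneg n) hnB (by positivity)).trans_eq ?_
  rw [Real.mul_rpow hB (by positivity), ← Real.rpow_natCast X 2, ← Real.rpow_mul hX0]
  congr 2
  push_cast
  ring

lemma bilin_eq_zero {Φ Ψ : ℝ → ℝ} {β α' : ℝ} (hα' : 0 < α')
    (hΨ : ∀ y, Ψ y ≠ 0 → y ≤ β) (hΦ : ∀ y, Φ y ≠ 0 → α' ≤ y) (c : ℕ → ℂ) {η Y : ℝ}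
    (hY : 0 < Y) (hη : β / α' < η) (hη0 : 0 < η) (K : ℕ) : bilin Φ Ψ c η Y K = 0 := by
  refine Finset.sum_eq_zero fun m _ => Finset.sum_eq_zero fun n _ => ?_
  suffices h : Ψ (m / Y) * Ψ (n / Y) * Φ (|(m : ℝ) - n| / (η * Y)) = 0 by
    rw [h]; simp
  by_contra hne
  obtain ⟨⟨hm, hn⟩, hd⟩ : (Ψ (m / Y) ≠ 0 ∧ Ψ (n / Y) ≠ 0) ∧ Φ (|(m : ℝ) - n| / (η * Y)) ≠ 0 := by
    simpa [not_or] using hne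
  have h1 := hΦ _ hd
  have h2 := hΨ _ hm
  have h3 := hΨ _ hn
  rw [le_div_iff₀ (by positivity)] at h1
  rw [div_le_iff₀ hY] at h2 h3
  rw [div_lt_iff₀ hα'] at hη
  have h4 : |(m : ℝ) - n| ≤ β * Y := by
    have h5 : (0 : ℝ) ≤ m := Nat.cast_nonneg m
    have h6 : (0 : ℝ) ≤ n := Nat.cast_nonneg n
    rw [abs_le]; constructor <;> linarith
  have h7 : β * Y < η * α' * Y := mul_lt_mul_of_pos_right hη hY
  nlinarith

lemma sum_indicator_le {R : ℕ} {z : ℝ} (hz : 0 ≤ z) :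
    ∑ r ∈ Finset.Ioc 0 R, (if (r : ℝ) ≤ z then (1 : ℝ) else 0) ≤ z := by
  rw [← Finset.sum_filter, Finset.sum_const, nsmul_eq_mul, mul_one]
  have h1 : ((Finset.Ioc 0 R).filter fun r : ℕ => (r : ℝ) ≤ z).card ≤ ⌊z⌋₊ := by
    refine (Finset.card_le_card (t := Finset.Ioc 0 ⌊z⌋₊) fun r hr => ?_).trans_eq (by simp)
    obtain ⟨h2, h3⟩ := Finset.mem_filter.1 hr
    exact Finset.mem_Ioc.2 ⟨(Finset.mem_Ioc.1 h2).1, Nat.le_floor h3⟩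
  exact (Nat.cast_le.2 h1).trans (Nat.floor_le hz)

lemma norm_EGk_le (k : ℕ) {Φ Ψ : ℝ → ℝ} {Q X : ℝ} (hX : 0 < X) {N R : ℕ}
    (hN : ∀ m : ℕ, N < m → Ψ (m / X) = 0)
    (hR : ∀ m n r : ℕ, m ≤ N → n ≤ N → R < r → Φ (|(m : ℝ) - n| / (r * Q)) = 0)
    {B : ℕ → ℕ → ℝ}
    (hB : ∀ g a r e : ℕ, ∀ [NeZero (a * r)], g ∈ Finset.Ioc 0 N → a ∣ g → 0 < r →
      e ∈ Finset.Ioc 0 N →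
      ∑ χ : DirichletCharacter ℂ (a * r) with χ ≠ 1,
        ‖bilin Φ Ψ (fun n => dk k (g * e * n) * χ (n : ZMod (a * r))) (r * g * Q / X)
          (X / (g * e : ℕ)) N‖ ≤ (a * r).totient * (B g r * (e : ℝ)⁻¹)) :
    ‖EGk k Φ Ψ Q X‖ ≤ ∑ g ∈ Finset.Ioc 0 N, g.divisors.card * ∑ r ∈ Finset.Ioc 0 R,
      B g r * ∑ e ∈ Finset.Ioc 0 N, (e : ℝ)⁻¹ := by
  rw [EGk_eq_sum k hN hR]
  refine (norm_sum_le _ _).trans (Finset.sum_le_sum fun g hg => ?_)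
  refine (norm_sum_le _ _).trans ?_
  rw [← nsmul_eq_mul]
  refine Finset.sum_le_card_nsmul _ _ _ fun a ha => ?_
  refine (norm_sum_le _ _).trans (Finset.sum_le_sum fun r hr => ?_)
  have hr0 : 0 < r := (Finset.mem_Ioc.1 hr).1
  have hq : 0 < a * r := Nat.mul_pos (Nat.pos_of_mem_divisors ha) hr0
  have : NeZero (a * r) := ⟨hq.ne'⟩
  have hφ : (0 : ℝ) < (a * r).totient := by exact_mod_cast Nat.totient_pos.2 hq
  rw [norm_mul, Complex.norm_real, Real.norm_eq_abs, abs_div, abs_of_pos hφ]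
  have h1 : |((ArithmeticFunction.moebius a : ℤ) : ℝ)| ≤ 1 := by
    exact_mod_cast ArithmeticFunction.abs_moebius_le_one
  have h2 : ∑ e ∈ Finset.Ioc 0 N, ((a * r).totient : ℝ) * (B g r * (e : ℝ)⁻¹) =
      (a * r).totient * (B g r * ∑ e ∈ Finset.Ioc 0 N, (e : ℝ)⁻¹) := by
    rw [Finset.mul_sum, Finset.mul_sum]
  have h3 := (norm_coprime_sum_le k (Φ := Φ) (Q := Q) hX hN (a * r) (Finset.mem_Ioc.1 hg).1
    hr0).trans ((Finset.sum_le_sum fun e he =>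
      hB g a r e hg (Nat.dvd_of_mem_divisors ha) hr0 he).trans_eq h2)
  calc _ ≤ 1 / ((a * r).totient : ℝ) *
        ((a * r).totient * (B g r * ∑ e ∈ Finset.Ioc 0 N, (e : ℝ)⁻¹)) :=
        mul_le_mul (div_le_div_of_nonneg_right h1 hφ.le) h3 (norm_nonneg _) (by positivity)
    _ = _ := by field_simp

end

section
open Set Filter Topology

lemma sum_bilin_le_of_bound {k : ℕ} (hk : 2 ≤ k) {δ C E C₀ b Q X : ℝ} (hδ : 0 < δ) (hC : 0 ≤ C)
    (hQ : 1 ≤ Q) (hX : 2 ≤ X) {N : ℕ} (hbN : b * X ≤ N) (hb : 0 < b) {Φ Ψ : ℝ → ℝ}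
    (hK : ∀ (q : ℕ) [NeZero q] (G D : ℕ), 0 < G → G.divisors.card ≤ D →
      ∀ η Y, 0 < η → η ≤ C₀ → 0 < Y → ∀ K : ℕ, b * Y ≤ K →
      ∑ χ : DirichletCharacter ℂ q with χ ≠ 1,
        ‖bilin Φ Ψ (fun n => dk k (G * n) * χ n) η Y K‖ ≤
      C * Y * q.totient * (D ^ 2 * q.divisors.card) ^ (2 * k) * q.divisors.card *
        (q / η) ^ ((k : ℝ) / 2 - 1 + δ))
    (hzero : ∀ (c : ℕ → ℂ) (η Y : ℝ) (K : ℕ), 0 < Y → 0 < η → C₀ < η → bilin Φ Ψ c η Y K = 0)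
    (hE : ∀ n : ℕ, n ≠ 0 → n ≤ N ^ 2 ∨ (n : ℝ) ≤ C₀ * (X / Q) → (n.divisors.card : ℝ) ≤ E)
    {g a r e : ℕ} [NeZero (a * r)] (hg : g ∈ Finset.Ioc 0 N) (hag : a ∣ g) (hr : 0 < r)
    (he : e ∈ Finset.Ioc 0 N) :
    ∑ χ : DirichletCharacter ℂ (a * r) with χ ≠ 1,
      ‖bilin Φ Ψ (fun n => dk k (g * e * n) * χ (n : ZMod (a * r))) (r * g * Q / X)
        (X / (g * e : ℕ)) N‖ ≤
      (a * r).totient * ((C * X * E ^ (6 * k + 1) * (X / Q) ^ ((k : ℝ) / 2 - 1 + δ) * (g : ℝ)⁻¹ *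
        (if (r : ℝ) ≤ C₀ * (X / Q) / g then 1 else 0)) * (e : ℝ)⁻¹) := by
  obtain ⟨hg0, hgN⟩ := Finset.mem_Ioc.1 hg
  obtain ⟨he0, heN⟩ := Finset.mem_Ioc.1 he
  have hg' : (0 : ℝ) < g := by exact_mod_cast hg0
  have he' : (0 : ℝ) < e := by exact_mod_cast he0
  have hr' : (0 : ℝ) < r := by exact_mod_cast hr
  have hQ0 : 0 < Q := by linarith
  have hX0 : 0 < X := by linarith
  have ha0 : 0 < a := Nat.pos_of_dvd_of_pos hag hg0
  have hge : 0 < g * e := Nat.mul_pos hg0 he0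
  have hge' : (0 : ℝ) < (g * e : ℕ) := by exact_mod_cast hge
  have hY : 0 < X / (g * e : ℕ) := by positivity
  have hη : 0 < r * g * Q / X := by positivity
  have hiff : (r : ℝ) ≤ C₀ * (X / Q) / g ↔ r * g * Q / X ≤ C₀ := by
    rw [le_div_iff₀ hg', ← mul_div_assoc, le_div_iff₀ hQ0, div_le_iff₀ hX0]
  by_cases hle : (r : ℝ) ≤ C₀ * (X / Q) / g
  swap
  · rw [if_neg hle]
    rw [hiff, not_le] at hle
    simp only [hzero _ _ _ N hY hη hle]
    simp
  rw [if_pos hle]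
  have hdge : ((g * e).divisors.card : ℝ) ≤ E := hE _ hge.ne' (Or.inl (by
    rw [pow_two]; exact Nat.mul_le_mul hgN heN))
  have hag' : (a : ℝ) ≤ g := by exact_mod_cast Nat.le_of_dvd hg0 hag
  have hdq : ((a * r).divisors.card : ℝ) ≤ E := hE _ (NeZero.ne _) (Or.inr (by
    push_cast
    calc (a : ℝ) * r ≤ g * (C₀ * (X / Q) / g) := mul_le_mul hag' hle hr'.le hg'.le
      _ = _ := by field_simp))
  have hE0 : 0 ≤ E := (Nat.cast_nonneg _).trans hdge
  have hbY : b * (X / (g * e : ℕ)) ≤ N := by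
    refine le_trans (mul_le_mul_of_nonneg_left (div_le_self hX0.le ?_) hb.le) hbN
    exact_mod_cast hge
  refine (hK (a * r) (g * e) _ hge le_rfl _ _ hη (hiff.1 hle) hY N hbY).trans ?_
  have hs : (0 : ℝ) ≤ (k : ℝ) / 2 - 1 + δ := by
    have : (2 : ℝ) ≤ k := by exact_mod_cast hk
    linarith
  have h1 : (((a * r : ℕ) : ℝ) / (r * g * Q / X)) ^ ((k : ℝ) / 2 - 1 + δ) ≤
      (X / Q) ^ ((k : ℝ) / 2 - 1 + δ) := by
    refine Real.rpow_le_rpow (by positivity) ?_ hs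
    have : ((a * r : ℕ) : ℝ) / (r * g * Q / X) = a / g * (X / Q) := by
      push_cast; field_simp
    rw [this]
    exact mul_le_of_le_one_left (by positivity) ((div_le_one hg').2 hag')
  have h2 : (((g * e).divisors.card : ℝ) ^ 2 * (a * r).divisors.card) ^ (2 * k) *
      (a * r).divisors.card ≤ E ^ (6 * k + 1) := by
    calc _ ≤ (E ^ 2 * E) ^ (2 * k) * E := by gcongr
      _ = E ^ (6 * k + 1) := by ring
  calc _ = C * (X / (g * e : ℕ)) * (a * r).totient *
        (((((g * e).divisors.card : ℝ) ^ 2 * (a * r).divisors.card) ^ (2 * k) *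
          (a * r).divisors.card) *
        (((a * r : ℕ) : ℝ) / (r * g * Q / X)) ^ ((k : ℝ) / 2 - 1 + δ)) := by ring
    _ ≤ C * (X / (g * e : ℕ)) * (a * r).totient *
        (E ^ (6 * k + 1) * (X / Q) ^ ((k : ℝ) / 2 - 1 + δ)) := by
        refine mul_le_mul_of_nonneg_left ?_ (by positivity)
        exact mul_le_mul h2 h1 (by positivity) (by positivity)
    _ = _ := by
        push_cast
        field_simp

theorem EGk_bound (k : ℕ) (hk : 2 ≤ k) {ε : ℝ} (hε : 0 < ε)
    {Φ Ψ : ℝ → ℝ}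
    (hΦ : ContDiff ℝ (⊤ : ℕ∞) Φ) (hΦc : HasCompactSupport Φ) (hΦs : tsupport Φ ⊆ Ioi 0)
    (hΨ : ContDiff ℝ (⊤ : ℕ∞) Ψ) (hΨc : HasCompactSupport Ψ) (hΨs : tsupport Ψ ⊆ Ioi 0) :
    ∃ C : ℝ, ∀ Q X : ℝ, 1 ≤ Q → 2 ≤ X →
      ‖EGk k Φ Ψ Q X‖ ≤ C * X ^ ((1 : ℝ) + ε) * (X / Q) ^ ((k : ℝ) / 2) := by
  obtain ⟨α', β', hα', -, hΦb⟩ := exists_support_bounds hΦc hΦs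
  obtain ⟨α, β, hα, hαβ, hΨb⟩ := exists_support_bounds hΨc hΨs
  have hβ : 0 < β := hα.trans_le hαβ
  have hb : 0 < β + 1 := by linarith
  have hv : ∀ y, β + 1 ≤ y → Ψ y = 0 := fun y hy => by
    by_contra hne
    have := (hΨb y hne).2
    linarith
  have hδ : 0 < ε / (6 * k + 5) := by positivity
  obtain ⟨δ, hδe⟩ : ∃ δ, δ = ε / (6 * k + 5) := ⟨_, rfl⟩
  rw [← hδe] at hδ
  obtain ⟨C, hC0, hC⟩ := exists_sum_bilin_bound hk (β / α') hδ hΦ hΦc hΦs hΨ hΨc hΨs hb hv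
  obtain ⟨A, hA0, hA⟩ := exists_card_divisors_le_of_le_sq hδ
    (B := (β + 2) ^ 2 + β / α') (by positivity)
  obtain ⟨L, hL0, hL⟩ := exists_sum_inv_le hδ
  refine ⟨C * A ^ (6 * k + 2) * (β / α') * (L * (β + 2) ^ δ) ^ 2, fun Q X hQ hX => ?_⟩
  have hX0 : 0 < X := by linarith
  have hQ0 : 0 < Q := by linarith
  have hC₀ : 0 < β / α' := by positivity
  obtain ⟨N, hNdef⟩ : ∃ N, N = ⌈(β + 1) * X⌉₊ := ⟨_, rfl⟩
  have hbN : (β + 1) * X ≤ N := hNdef ▸ Nat.le_ceil _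
  have hNle : (N : ℝ) ≤ (β + 2) * X := by
    have := Nat.ceil_lt_add_one (a := (β + 1) * X) (by positivity)
    rw [← hNdef] at this
    linarith
  have hXQ : X / Q ≤ X := div_le_self hX0.le hQ
  have hΨN : ∀ m : ℕ, N < m → Ψ (m / X) = 0 := fun m hm => hv _ (by
    rw [le_div_iff₀ hX0]
    exact hbN.trans (by exact_mod_cast hm.le))
  have hΦR : ∀ m n r : ℕ, m ≤ N → n ≤ N → ⌊N / α'⌋₊ < r → Φ (|(m : ℝ) - n| / (r * Q)) = 0 := by
    intro m n r hm hn hr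
    by_contra hne
    have h1 := (hΦb _ hne).1
    have h2 := (Nat.floor_lt (by positivity)).1 hr
    have hr0 : (0 : ℝ) < r := by exact_mod_cast (Nat.zero_le _).trans_lt hr
    rw [le_div_iff₀ (by positivity)] at h1
    rw [div_lt_iff₀ hα'] at h2
    have h3 : (m : ℝ) ≤ N := by exact_mod_cast hm
    have h4 : (n : ℝ) ≤ N := by exact_mod_cast hn
    have h5 : |(m : ℝ) - n| ≤ N := by
      have h5 : (0 : ℝ) ≤ m := Nat.cast_nonneg m
      have h6 : (0 : ℝ) ≤ n := Nat.cast_nonneg n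
      rw [abs_le]; constructor <;> linarith
    have h6 : (r : ℝ) * α' ≤ α' * (r * Q) := by
      rw [mul_comm α', mul_right_comm]
      exact le_mul_of_one_le_right (by positivity) hQ
    linarith
  have hE : ∀ n : ℕ, n ≠ 0 → n ≤ N ^ 2 ∨ (n : ℝ) ≤ β / α' * (X / Q) →
      (n.divisors.card : ℝ) ≤ A * X ^ δ := by
    intro n hn h
    refine hA X (by linarith) n hn ?_
    rw [add_mul]
    rcases h with h | h
    · refine le_trans ?_ (le_add_of_nonneg_right (by positivity))
      rw [← mul_pow]
      have h1 : (n : ℝ) ≤ (N : ℝ) ^ 2 := by exact_mod_cast h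
      exact h1.trans (pow_le_pow_left₀ (Nat.cast_nonneg _) hNle 2)
    · refine le_trans ?_ (le_add_of_nonneg_left (by positivity))
      refine h.trans (mul_le_mul_of_nonneg_left (hXQ.trans ?_) hC₀.le)
      nlinarith
  have hzero : ∀ (c : ℕ → ℂ) (η Y : ℝ) (K : ℕ), 0 < Y → 0 < η → β / α' < η →
      bilin Φ Ψ c η Y K = 0 := fun c η Y K hY hη hlt =>
    bilin_eq_zero hα' (fun y hy => (hΨb y hy).2) (fun y hy => (hΦb y hy).1) c hY hlt hη K
  obtain ⟨P, hP⟩ : ∃ P, P = C * X * (A * X ^ δ) ^ (6 * k + 1) *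
    (X / Q) ^ ((k : ℝ) / 2 - 1 + δ) := ⟨_, rfl⟩
  have hP0 : 0 ≤ P := by rw [hP]; positivity
  have hmain := norm_EGk_le k hX0 hΨN hΦR (B := fun g r => P * (g : ℝ)⁻¹ *
    (if (r : ℝ) ≤ β / α' * (X / Q) / g then 1 else 0)) (fun g a r e _ hg hag hr he => by
      rw [hP]
      exact sum_bilin_le_of_bound hk hδ hC0 hQ hX hbN hb (fun q _ => hC q) hzero hE hg hag hr he)
  refine hmain.trans ?_
  obtain ⟨H, hH⟩ : ∃ H, H = ∑ e ∈ Finset.Ioc 0 N, (e : ℝ)⁻¹ := ⟨_, rfl⟩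
  have hH0 : 0 ≤ H := by rw [hH]; exact Finset.sum_nonneg fun e _ => by positivity
  have hHle : H ≤ L * (β + 2) ^ δ * X ^ δ := by
    rw [hH, mul_assoc, ← Real.mul_rpow (by linarith) hX0.le]
    exact (hL N).trans (mul_le_mul_of_nonneg_left
      (Real.rpow_le_rpow (Nat.cast_nonneg _) hNle hδ.le) hL0)
  have hterm : ∀ g ∈ Finset.Ioc 0 N, (g.divisors.card : ℝ) * ∑ r ∈ Finset.Ioc 0 ⌊N / α'⌋₊,
      P * (g : ℝ)⁻¹ * (if (r : ℝ) ≤ β / α' * (X / Q) / g then 1 else 0) *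
        ∑ e ∈ Finset.Ioc 0 N, (e : ℝ)⁻¹ ≤
      A * X ^ δ * P * (β / α' * (X / Q)) * H * (g : ℝ)⁻¹ := by
    intro g hg
    obtain ⟨hg0, hgN⟩ := Finset.mem_Ioc.1 hg
    have hg1 : (1 : ℝ) ≤ g := by exact_mod_cast hg0
    have hd : (g.divisors.card : ℝ) ≤ A * X ^ δ :=
      hE g hg0.ne' (Or.inl (hgN.trans (Nat.le_self_pow two_ne_zero N)))
    rw [← hH, ← Finset.sum_mul, ← Finset.mul_sum]
    have h1 : ∑ r ∈ Finset.Ioc 0 ⌊N / α'⌋₊,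
        (if (r : ℝ) ≤ β / α' * (X / Q) / g then (1 : ℝ) else 0) ≤ β / α' * (X / Q) :=
      (sum_indicator_le (by positivity)).trans (div_le_self (by positivity) hg1)
    calc _ ≤ A * X ^ δ * (P * (g : ℝ)⁻¹ * (β / α' * (X / Q)) * H) := by
          refine mul_le_mul hd ?_ ?_ (by positivity)
          · exact mul_le_mul_of_nonneg_right (mul_le_mul_of_nonneg_left h1 (by positivity)) hH0
          · exact mul_nonneg (mul_nonneg (by positivity)
              (Finset.sum_nonneg fun r _ => by split_ifs <;> norm_num)) hH0
      _ = _ := by ring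
  refine (Finset.sum_le_sum hterm).trans ?_
  rw [← Finset.mul_sum, ← hH]
  have hXd : 0 < X ^ δ := Real.rpow_pos_of_pos hX0 _
  have hH2 : H * H ≤ (L * (β + 2) ^ δ * X ^ δ) ^ 2 := by
    rw [pow_two]; exact mul_le_mul hHle hHle hH0 (by positivity)
  have hR : (X / Q) ^ ((k : ℝ) / 2 - 1 + δ) * (X / Q) ≤ (X / Q) ^ ((k : ℝ) / 2) * X ^ δ := by
    have hRpos : 0 < X / Q := by positivity
    rw [← Real.rpow_add_one hRpos.ne',
      show (k : ℝ) / 2 - 1 + δ + 1 = (k : ℝ) / 2 + δ by ring, Real.rpow_add hRpos]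
    exact mul_le_mul_of_nonneg_left (Real.rpow_le_rpow hRpos.le hXQ hδ.le) (by positivity)
  have hpow : X * (X ^ δ) ^ (6 * k + 5) = X ^ (1 + ε) := by
    rw [Real.rpow_add hX0, Real.rpow_one, ← Real.rpow_natCast (X ^ δ), ← Real.rpow_mul hX0.le, hδe]
    congr 2
    push_cast
    field_simp
  calc _ = C * X * (A * X ^ δ) ^ (6 * k + 2) * (β / α') *
        ((X / Q) ^ ((k : ℝ) / 2 - 1 + δ) * (X / Q)) * (H * H) := by rw [hP]; ring
    _ ≤ C * X * (A * X ^ δ) ^ (6 * k + 2) * (β / α') *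
        ((X / Q) ^ ((k : ℝ) / 2) * X ^ δ) * (L * (β + 2) ^ δ * X ^ δ) ^ 2 := by
        refine mul_le_mul (mul_le_mul_of_nonneg_left hR (by positivity)) hH2
          (mul_nonneg hH0 hH0) (by positivity)
    _ = C * A ^ (6 * k + 2) * (β / α') * (L * (β + 2) ^ δ) ^ 2 * (X * (X ^ δ) ^ (6 * k + 5)) *
        (X / Q) ^ ((k : ℝ) / 2) := by ring
    _ = _ := by rw [hpow]

end

end EGB

/-- unconditional bound `EG_k(Q;X) ≪_ε X^{1+ε} (X/Q)^{k/2}`. -/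
theorem EGk_bound_unconditional (k : ℕ) (hk : 2 ≤ k) (ε : ℝ) (hε : 0 < ε)
    (Φ Ψ : ℝ → ℝ)
    (hΦsmooth : ContDiff ℝ (⊤ : ℕ∞) Φ) (hΦsupp : HasCompactSupport Φ)
    (hΦpos : ∀ x, 0 ≤ Φ x) (hΦsupp' : tsupport Φ ⊆ Set.Ioi 0)
    (hΦint : ∫ u, Φ u = 1)
    (hΨsmooth : ContDiff ℝ (⊤ : ℕ∞) Ψ) (hΨsupp : HasCompactSupport Ψ)
    (hΨpos : ∀ x, 0 ≤ Ψ x) (hΨsupp' : tsupport Ψ ⊆ Set.Ioi 0)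
    (hΨint : ∫ u, (Ψ u)^2 = 1) :
    ∃ Cε : ℝ, ∀ Q X : ℝ, 1 ≤ Q → 2 ≤ X →
      ‖EGk k Φ Ψ Q X‖ ≤ Cε * X ^ ((1 : ℝ) + ε) * (X / Q) ^ ((k : ℝ) / 2) := by
  exact EGB.EGk_bound k hk hε hΦsmooth hΦsupp hΦsupp' hΨsmooth hΨsupp hΨsupp'
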